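/- There exist universal constants C, c > 0 with the following property. Let A = (a_{ijk})_{i,j≤n,k≤m} be a real array, ‖·‖ any norm on ℝⁿ, t ∈ ℝᵐ, ε > 0, and set A_ε = {x ∈ ℝⁿ : α_{∞,A}(x ⊗ t) ≤ ε²·E α_A(Gₙ ⊗ t) and ‖x‖ ≤ C·ε·E‖Eₙ‖}. Then for every y ∈ B₂ⁿ: γ_{n,ε}(A_ε + y) ≥ c·e^{−c/ε²}, where γ_{n,ε} is the law of ε·Gₙ. -/

import Mathlib

open MeasureTheory ProbabilityTheory Set
open scoped ENNReal BigOperators Pointwise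

noncomputable section

namespace Stmt14

/-- the symmetric exponential distribution on `ℝ`, with density `e^{-|x|}/2`. -/
def symExp : Measure ℝ :=
  MeasureTheory.volume.withDensity fun x => ENNReal.ofReal (Real.exp (-|x|) / 2)

/-- the law of `Eₙ`, a vector of `n` i.i.d. symmetric exponential variables. -/
def expVec (n : ℕ) : Measure (Fin n → ℝ) := Measure.pi fun _ => symExp

/-- the law of a standard Gaussian vector in `ℝⁿ`. -/
def gaussVec (n : ℕ) : Measure (Fin n → ℝ) := Measure.pi fun _ => gaussianReal 0 1

/-- the law of an `n × n` array of i.i.d. standard Gaussian variables. -/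
def gaussMat (n : ℕ) : Measure (Fin n × Fin n → ℝ) := Measure.pi fun _ => gaussianReal 0 1

variable {n m : ℕ}

/-- `α_A(y) = √(∑ᵢ (∑_{jk} a_{ijk} y_{jk})²)` for `y ∈ ℝ^{n×m}`. -/
def alphaA (A : Fin n → Fin n → Fin m → ℝ) (y : Fin n → Fin m → ℝ) : ℝ :=
  Real.sqrt (∑ i, (∑ j, ∑ k, A i j k * y j k) ^ 2)

/-- `α_{∞,A}(y) = maxᵢ |∑_{jk} a_{ijk} y_{jk}|`. -/
def alphaInf (A : Fin n → Fin n → Fin m → ℝ) (y : Fin n → Fin m → ℝ) : ℝ :=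
  ⨆ i, |∑ j, ∑ k, A i j k * y j k|

/-- `x ⊗ t = (x_j t_k)_{jk}`. -/
def tens (x : Fin n → ℝ) (t : Fin m → ℝ) : Fin n → Fin m → ℝ := fun j k => x j * t k

/-- the distance `d_A((x,t),(x',t')) = α_A(x⊗t − x'⊗t')`. -/
def dA (A : Fin n → Fin n → Fin m → ℝ) (z w : (Fin n → ℝ) × (Fin m → ℝ)) : ℝ :=
  alphaA A (tens z.1 z.2 - tens w.1 w.2)

/-- the distance `d_{∞,A}((x,t),(x',t')) = α_{∞,A}(x⊗t − x'⊗t')`. -/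
def dInf (A : Fin n → Fin n → Fin m → ℝ) (z w : (Fin n → ℝ) × (Fin m → ℝ)) : ℝ :=
  alphaInf A (tens z.1 z.2 - tens w.1 w.2)

/-- the diameter of `V` in the metric `d_A`. -/
def diamA (A : Fin n → Fin n → Fin m → ℝ) (V : Set ((Fin n → ℝ) × (Fin m → ℝ))) : ℝ :=
  ⨆ z ∈ V, ⨆ w ∈ V, dA A z w

/-- the diameter of `V` in the metric `d_{∞,A}`. -/
def diamInf (A : Fin n → Fin n → Fin m → ℝ) (V : Set ((Fin n → ℝ) × (Fin m → ℝ))) : ℝ :=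
  ⨆ z ∈ V, ⨆ w ∈ V, dInf A z w

/-- `F_A(V) = E sup_{(x,t)∈V} ∑_{ijk} a_{ijk} gᵢ x_j t_k`. -/
def FA (A : Fin n → Fin n → Fin m → ℝ) (V : Set ((Fin n → ℝ) × (Fin m → ℝ))) : ℝ :=
  ∫ g, (⨆ z ∈ V, ∑ i, ∑ j, ∑ k, A i j k * g i * z.1 j * z.2 k) ∂gaussVec n

/-- `β_{A,T}(x) = E sup_{s∈T} |∑_{ijk} a_{ijk} gᵢ x_j s_k|`. -/
def betaA (A : Fin n → Fin n → Fin m → ℝ) (T : Set (Fin m → ℝ)) (x : Fin n → ℝ) : ℝ :=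
  ∫ g, (⨆ s ∈ T, |∑ i, ∑ j, ∑ k, A i j k * g i * x j * s k|) ∂gaussVec n

/-- `s_A(T) = E sup_{t∈T} |∑_{ijk} a_{ijk} g_{ij} t_k| + E sup_{t∈T} |∑_{ijk} a_{ijk} gᵢ ℰⱼ t_k|`. -/
def sA (A : Fin n → Fin n → Fin m → ℝ) (T : Set (Fin m → ℝ)) : ℝ :=
  (∫ G, (⨆ t ∈ T, |∑ i, ∑ j, ∑ k, A i j k * G (i, j) * t k|) ∂gaussMat n) +
  (∫ w, (⨆ t ∈ T, |∑ i, ∑ j, ∑ k, A i j k * w.1 i * w.2 j * t k|)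
      ∂((gaussVec n).prod (expVec n)))

/-- `E α_A(Eₙ ⊗ t)`. -/
def expAlpha (A : Fin n → Fin n → Fin m → ℝ) (t : Fin m → ℝ) : ℝ :=
  ∫ e, alphaA A (tens e t) ∂expVec n

/-- the closed Euclidean unit ball `B₂ⁿ`. -/
def B2 (n : ℕ) : Set (Fin n → ℝ) := {x | Real.sqrt (∑ i, x i ^ 2) ≤ 1}

/-- the closed `ℓ₁` unit ball `B₁ⁿ`. -/
def B1 (n : ℕ) : Set (Fin n → ℝ) := {x | ∑ i, |x i| ≤ 1}

/-- the Minkowski sum `B₂ⁿ + √p·B₁ⁿ`. -/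
def UB (n : ℕ) (p : ℝ) : Set (Fin n → ℝ) := B2 n + Real.sqrt p • B1 n

/-- `s_q(A) = (∑_k (∑_{ij} a_{ijk}²)^{q/2})^{1/q}`. -/
def sq (q : ℝ) (A : Fin n → Fin n → Fin m → ℝ) : ℝ :=
  (∑ k, (∑ i, ∑ j, A i j k ^ 2) ^ (q / 2)) ^ (1 / q)

/-- `φ_A(x) = (∑_k (∑ᵢ (∑ⱼ a_{ijk} x_j)⁴ / ∑ⱼ a_{ijk}²)^{q/2})^{1/(2q)}`. -/
def phiA (q : ℝ) (A : Fin n → Fin n → Fin m → ℝ) (x : Fin n → ℝ) : ℝ :=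
  (∑ k, (∑ i, (∑ j, A i j k * x j) ^ 4 / ∑ j, A i j k ^ 2) ^ (q / 2)) ^ (1 / (2 * q))

/-- `B_{q'} = {t ∈ ℝᵐ : ∑_k |t_k|^{q'} ≤ 1}`. -/
def Bconj (q' : ℝ) (m : ℕ) : Set (Fin m → ℝ) := {t | ∑ k, |t k| ^ q' ≤ 1}


section SmallBall

open scoped Matrix

/-- One-dimensional Brunn–Minkowski inequality. -/
theorem volume_add_le_of_add_mem {A B D : Set ℝ} (hA : MeasurableSet A) (hB : MeasurableSet B)
    (hA0 : A.Nonempty) (hB0 : B.Nonempty) (hD : ∀ a ∈ A, ∀ b ∈ B, a + b ∈ D) :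
    volume A + volume B ≤ volume D := by
  obtain ⟨a₀, ha₀⟩ := hA0
  obtain ⟨b₀, hb₀⟩ := hB0
  have key : ∀ K : Set ℝ, K ⊆ A → IsCompact K → ∀ L : Set ℝ, L ⊆ B → IsCompact L →
      volume K + volume L ≤ volume D := by
    intro K hKA hK L hLB hL
    set K' := insert a₀ K
    set L' := insert b₀ L
    have hK' : IsCompact K' := hK.insert a₀
    have hL' : IsCompact L' := hL.insert b₀
    obtain ⟨a, haK, ha⟩ := hK'.exists_isGreatest ⟨a₀, mem_insert _ _⟩
    obtain ⟨b, hbL, hb⟩ := hL'.exists_isLeast ⟨b₀, mem_insert _ _⟩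
    have haA : K' ⊆ A := insert_subset ha₀ hKA
    have hbB : L' ⊆ B := insert_subset hb₀ hLB
    have hU : ((fun x => x + b) '' K') ∪ ((fun x => a + x) '' L') ⊆ D := by
      rintro x (⟨k, hk, rfl⟩ | ⟨l, hl, rfl⟩)
      · exact hD k (haA hk) b (hbB hbL)
      · exact hD a (haA haK) l (hbB hl)
    have hdis : AEDisjoint volume ((fun x => x + b) '' K') ((fun x => a + x) '' L') := by
      refine measure_mono_null (t := {a + b}) ?_ (by simp)
      rintro x ⟨⟨k, hk, rfl⟩, ⟨l, hl, h⟩⟩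
      have h1 := ha hk
      have h2 := hb hl
      simp only [mem_singleton_iff] at *
      linarith
    have hm : MeasurableSet ((fun x => a + x) '' L') :=
      (hL'.image (by fun_prop)).measurableSet
    calc volume K + volume L ≤ volume K' + volume L' :=
          add_le_add (measure_mono (subset_insert _ _)) (measure_mono (subset_insert _ _))
      _ = volume ((fun x => x + b) '' K') + volume ((fun x => a + x) '' L') := by
          simp [measure_preimage_add]
      _ = volume (((fun x => x + b) '' K') ∪ ((fun x => a + x) '' L')) :=
          (measure_union₀ hm.nullMeasurableSet hdis).symm
      _ ≤ volume D := measure_mono hU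
  rw [hA.measure_eq_iSup_isCompact, hB.measure_eq_iSup_isCompact]
  simp_rw [iSup_and']
  exact ENNReal.biSup_add_biSup_le' ⟨∅, empty_subset _, isCompact_empty⟩
    ⟨∅, empty_subset _, isCompact_empty⟩ fun K hK L hL => key K hK.1 hK.2 L hL.1 hL.2

theorem ennreal_geom_mean_le {θ : ℝ} (h0 : 0 < θ) (h1 : θ < 1) (a b : ℝ≥0∞) :
    a ^ (1 - θ) * b ^ θ ≤ ENNReal.ofReal (1 - θ) * a + ENNReal.ofReal θ * b := by
  have h1' : 0 < 1 - θ := by linarith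
  rcases eq_or_ne a ∞ with rfl | ha
  · rw [ENNReal.mul_top (by simpa using h1)]; simp
  rcases eq_or_ne b ∞ with rfl | hb
  · rw [ENNReal.mul_top (by simpa using h0)]; simp
  lift a to NNReal using ha
  lift b to NNReal using hb
  rw [← ENNReal.coe_rpow_of_nonneg _ h1'.le, ← ENNReal.coe_rpow_of_nonneg _ h0.le]
  have := NNReal.geom_mean_le_arith_mean2_weighted (Real.toNNReal (1-θ)) (Real.toNNReal θ) a b
    (by rw [← Real.toNNReal_add h1'.le h0.le]; simp)
  rw [Real.coe_toNNReal _ h0.le, Real.coe_toNNReal _ h1'.le] at this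
  simp only [ENNReal.ofReal]
  exact_mod_cast this

theorem volume_smul_le_of_convex_mem {θ : ℝ} (h0 : 0 < θ) (h1 : θ < 1) {A B D : Set ℝ}
    (hA : MeasurableSet A) (hB : MeasurableSet B)
    (hA0 : A.Nonempty) (hB0 : B.Nonempty) (hD : ∀ a ∈ A, ∀ b ∈ B, (1 - θ) * a + θ * b ∈ D) :
    ENNReal.ofReal (1 - θ) * volume A + ENNReal.ofReal θ * volume B ≤ volume D := by
  have h1' : 0 < 1 - θ := by linarith
  have e1 : ∀ (r : ℝ), 0 < r → ∀ s : Set ℝ, volume (r • s) = ENNReal.ofReal r * volume s := by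
    intro r hr s
    rw [Measure.addHaar_smul]; simp [abs_of_pos hr]
  rw [← e1 _ h1', ← e1 _ h0]
  refine volume_add_le_of_add_mem (hA.const_smul₀ _) (hB.const_smul₀ _) hA0.smul_set hB0.smul_set ?_
  rintro _ ⟨a, ha, rfl⟩ _ ⟨b, hb, rfl⟩
  exact hD a ha b hb

/-- A measure satisfies the Prékopa–Leindler inequality for functions bounded by `1`. -/
def PrekopaLeindler {E : Type*} [AddCommGroup E] [Module ℝ E] [MeasurableSpace E]
    (μ : Measure E) : Prop :=
  ∀ θ : ℝ, 0 < θ → θ < 1 → ∀ f g h : E → ℝ≥0∞, Measurable f → Measurable g → Measurable h →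
    (∀ x, f x ≤ 1) → (∀ x, g x ≤ 1) →
    (∀ x y, f x ^ (1 - θ) * g y ^ θ ≤ h ((1 - θ) • x + θ • y)) →
    (∫⁻ x, f x ∂μ) ^ (1 - θ) * (∫⁻ x, g x ∂μ) ^ θ ≤ ∫⁻ x, h x ∂μ

theorem lintegral_eq_lintegral_Ioo_meas_lt {f : ℝ → ℝ≥0∞} (hf : Measurable f) {S : ℝ≥0∞}
    (hS0 : S ≠ 0) (hS : S ≠ ∞) (hfS : ∀ x, f x ≤ S) :
    ∫⁻ x, f x = S * ∫⁻ t in Ioo (0 : ℝ) 1, volume {x | ENNReal.ofReal t * S < f x} := by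
  have hlt : ∀ x, f x / S ≠ ∞ := fun x =>
    (ENNReal.div_lt_top ((hfS x).trans_lt hS.lt_top).ne hS0).ne
  have e1 : ∀ x, f x = S * ENNReal.ofReal ((f x / S).toReal) := by
    intro x
    rw [ENNReal.ofReal_toReal (hlt x), ENNReal.mul_div_cancel hS0 hS]
  have hset : ∀ t : ℝ, 0 ≤ t → {x | t < (f x / S).toReal} = {x | ENNReal.ofReal t * S < f x} := by
    intro t ht
    ext x
    simp only [mem_ofPred_eq]
    rw [← ENNReal.ofReal_lt_iff_lt_toReal ht (hlt x),
      ENNReal.lt_div_iff_mul_lt (Or.inl hS0) (Or.inl hS)]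
  calc ∫⁻ x, f x = ∫⁻ x, S * ENNReal.ofReal ((f x / S).toReal) := lintegral_congr e1
    _ = S * ∫⁻ x, ENNReal.ofReal ((f x / S).toReal) :=
        lintegral_const_mul _ (hf.div_const S).ennreal_toReal.ennreal_ofReal
    _ = S * ∫⁻ t in Ioi 0, volume {x | t < (f x / S).toReal} := by
        rw [lintegral_eq_lintegral_meas_lt _
          (Filter.Eventually.of_forall fun x => ENNReal.toReal_nonneg)
          (hf.div_const S).ennreal_toReal.aemeasurable]
    _ = S * ∫⁻ t in Ioo (0 : ℝ) 1, volume {x | t < (f x / S).toReal} := by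
        congr 1
        rw [← lintegral_indicator measurableSet_Ioi, ← lintegral_indicator measurableSet_Ioo]
        refine lintegral_congr fun t => ?_
        by_cases ht : t ∈ Ioo (0 : ℝ) 1
        · rw [indicator_of_mem ht, indicator_of_mem (show t ∈ Ioi (0:ℝ) from ht.1)]
        · rw [indicator_of_notMem ht]
          by_cases ht0 : t ∈ Ioi (0 : ℝ)
          · rw [indicator_of_mem ht0]
            have ht1 : 1 ≤ t := by
              by_contra h
              exact ht ⟨ht0, not_le.mp h⟩
            have : {x | t < (f x / S).toReal} = ∅ := by
              ext x
              simp only [mem_ofPred_eq, mem_empty_iff_false, iff_false, not_lt]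
              refine le_trans ?_ ht1
              exact ENNReal.toReal_le_of_le_ofReal zero_le_one
                (by simpa using ENNReal.div_le_of_le_mul (by simpa using hfS x))
            rw [this]; simp
          · rw [indicator_of_notMem ht0]
    _ = _ := by
        congr 1
        refine setLIntegral_congr_fun measurableSet_Ioo fun t ht => ?_
        simp only [hset t ht.1.le]

/-- One-dimensional Prékopa–Leindler inequality. -/
theorem prekopaLeindler_volume : PrekopaLeindler (volume : Measure ℝ) := by
  intro θ h0 h1 f g h hf hg hh hf1 hg1 hfgh
  have h1' : 0 < 1 - θ := by linarith
  set Sf := ⨆ x, f x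
  set Sg := ⨆ x, g x
  have hSf : Sf ≠ ∞ := ((iSup_le hf1).trans_lt ENNReal.one_lt_top).ne
  have hSg : Sg ≠ ∞ := ((iSup_le hg1).trans_lt ENNReal.one_lt_top).ne
  rcases eq_or_ne Sf 0 with hf0 | hf0
  · have : ∀ x, f x = 0 := fun x => le_antisymm (hf0 ▸ le_iSup f x) bot_le
    simp [this, h1']
  rcases eq_or_ne Sg 0 with hg0 | hg0
  · have : ∀ x, g x = 0 := fun x => le_antisymm (hg0 ▸ le_iSup g x) bot_le
    simp [this, h0]
  set S := Sf ^ (1 - θ) * Sg ^ θ with hSdef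
  have hS0 : S ≠ 0 := mul_ne_zero (by simp [ENNReal.rpow_eq_zero_iff, hf0, hSf])
    (by simp [ENNReal.rpow_eq_zero_iff, hg0, hSg])
  have hS : S ≠ ∞ := ENNReal.mul_ne_top (ENNReal.rpow_ne_top_of_nonneg h1'.le hSf)
    (ENNReal.rpow_ne_top_of_nonneg h0.le hSg)
  set h' : ℝ → ℝ≥0∞ := fun x => min (h x) S
  have hh' : Measurable h' := hh.min measurable_const
  have hlev : ∀ t ∈ Ioo (0:ℝ) 1,
      ENNReal.ofReal (1 - θ) * volume {x | ENNReal.ofReal t * Sf < f x} +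
        ENNReal.ofReal θ * volume {x | ENNReal.ofReal t * Sg < g x} ≤
      volume {x | ENNReal.ofReal t * S < h' x} := by
    intro t ht
    have htlt : ∀ R : ℝ≥0∞, R ≠ 0 → R ≠ ∞ → ENNReal.ofReal t * R < R := by
      intro R hR0 hR
      conv_rhs => rw [← one_mul R]
      exact ENNReal.mul_lt_mul_left hR0 hR (by simpa using ht.2)
    refine volume_smul_le_of_convex_mem h0 h1 (measurableSet_lt measurable_const hf)
      (measurableSet_lt measurable_const hg) ?_ ?_ ?_
    · exact (lt_iSup_iff.mp (htlt Sf hf0 hSf))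
    · exact (lt_iSup_iff.mp (htlt Sg hg0 hSg))
    · intro x hx y hy
      have hx' : ENNReal.ofReal t * Sf < f x := hx
      have hy' : ENNReal.ofReal t * Sg < g y := hy
      refine lt_min ?_ (htlt S hS0 hS)
      refine lt_of_lt_of_le ?_ (hfgh x y)
      calc ENNReal.ofReal t * S
          = (ENNReal.ofReal t * Sf) ^ (1 - θ) * (ENNReal.ofReal t * Sg) ^ θ := by
            rw [ENNReal.mul_rpow_of_nonneg _ _ h1'.le, ENNReal.mul_rpow_of_nonneg _ _ h0.le,
              mul_mul_mul_comm, ← ENNReal.rpow_add _ _ (by simpa using ht.1) ENNReal.ofReal_ne_top]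
            simp [hSdef]
        _ < f x ^ (1 - θ) * g y ^ θ :=
            ENNReal.mul_lt_mul (ENNReal.rpow_lt_rpow hx' h1') (ENNReal.rpow_lt_rpow hy' h0)
  calc (∫⁻ x, f x) ^ (1 - θ) * (∫⁻ x, g x) ^ θ
      = S * ((∫⁻ t in Ioo (0 : ℝ) 1, volume {x | ENNReal.ofReal t * Sf < f x}) ^ (1 - θ) *
          (∫⁻ t in Ioo (0 : ℝ) 1, volume {x | ENNReal.ofReal t * Sg < g x}) ^ θ) := by
        rw [lintegral_eq_lintegral_Ioo_meas_lt hf hf0 hSf (le_iSup f),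
          lintegral_eq_lintegral_Ioo_meas_lt hg hg0 hSg (le_iSup g),
          ENNReal.mul_rpow_of_nonneg _ _ h1'.le, ENNReal.mul_rpow_of_nonneg _ _ h0.le,
          mul_mul_mul_comm]
    _ ≤ S * (ENNReal.ofReal (1 - θ) *
            (∫⁻ t in Ioo (0 : ℝ) 1, volume {x | ENNReal.ofReal t * Sf < f x}) +
          ENNReal.ofReal θ *
            ∫⁻ t in Ioo (0 : ℝ) 1, volume {x | ENNReal.ofReal t * Sg < g x}) := by
        gcongr
        exact ennreal_geom_mean_le h0 h1 _ _
    _ ≤ S * ∫⁻ t in Ioo (0 : ℝ) 1, volume {x | ENNReal.ofReal t * S < h' x} := by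
        gcongr
        have hmeas : ∀ (f : ℝ → ℝ≥0∞) (R : ℝ≥0∞),
            Measurable fun t : ℝ => volume {x | ENNReal.ofReal t * R < f x} := fun f R =>
          (Antitone.measurable fun s t hst => measure_mono fun x hx =>
            lt_of_le_of_lt (mul_le_mul_left (ENNReal.ofReal_le_ofReal hst) R) hx)
        rw [← lintegral_const_mul _ (hmeas f Sf), ← lintegral_const_mul _ (hmeas g Sg),
          ← lintegral_add_left ((hmeas f Sf).const_mul _)]
        exact setLIntegral_mono (hmeas h' S) hlev
    _ = ∫⁻ x, h' x := (lintegral_eq_lintegral_Ioo_meas_lt hh' hS0 hS fun x => min_le_right _ _).symm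
    _ ≤ ∫⁻ x, h x := lintegral_mono fun x => min_le_left _ _

theorem PrekopaLeindler.map {E F : Type*} [AddCommGroup E] [Module ℝ E] [MeasurableSpace E]
    [AddCommGroup F] [Module ℝ F] [MeasurableSpace F] {μ : Measure E} (hμ : PrekopaLeindler μ)
    (T : E →ₗ[ℝ] F) (hT : Measurable T) : PrekopaLeindler (μ.map T) := by
  intro θ h0 h1 f g h hf hg hh hf1 hg1 hfgh
  rw [lintegral_map hf hT, lintegral_map hg hT, lintegral_map hh hT]
  refine hμ θ h0 h1 _ _ _ (hf.comp hT) (hg.comp hT) (hh.comp hT) (fun _ => hf1 _)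
    (fun _ => hg1 _) ?_
  intro x y
  simpa using hfgh (T x) (T y)

theorem PrekopaLeindler.prod {E F : Type*} [AddCommGroup E] [Module ℝ E] [MeasurableSpace E]
    [AddCommGroup F] [Module ℝ F] [MeasurableSpace F] {μ : Measure E} {ν : Measure F}
    [SFinite μ] [IsProbabilityMeasure ν]
    (hμ : PrekopaLeindler μ) (hν : PrekopaLeindler ν) : PrekopaLeindler (μ.prod ν) := by
  intro θ h0 h1 f g h hf hg hh hf1 hg1 hfgh
  rw [lintegral_prod _ hf.aemeasurable, lintegral_prod _ hg.aemeasurable,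
    lintegral_prod _ hh.aemeasurable]
  refine hμ θ h0 h1 _ _ _ hf.lintegral_prod_right' hg.lintegral_prod_right'
    hh.lintegral_prod_right' ?_ ?_ ?_
  · intro x
    calc ∫⁻ y, f (x, y) ∂ν ≤ ∫⁻ y, 1 ∂ν := lintegral_mono fun y => hf1 _
      _ = 1 := by simp
  · intro x
    calc ∫⁻ y, g (x, y) ∂ν ≤ ∫⁻ y, 1 ∂ν := lintegral_mono fun y => hg1 _
      _ = 1 := by simp
  · intro x y
    refine hν θ h0 h1 _ _ _ (hf.comp measurable_prodMk_left) (hg.comp measurable_prodMk_left)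
      (hh.comp measurable_prodMk_left) (fun _ => hf1 _) (fun _ => hg1 _) ?_
    intro u v
    simpa using hfgh (x, u) (y, v)

theorem prekopaLeindler_gaussianReal : PrekopaLeindler (gaussianReal 0 1) := by
  intro θ h0 h1 f g h hf hg hh hf1 hg1 hfgh
  have h1' : 0 < 1 - θ := by linarith
  have hv : (1 : NNReal) ≠ 0 := one_ne_zero
  have hφ := measurable_gaussianPDF 0 1
  have hφ1 : ∀ x, gaussianPDF 0 1 x ≤ 1 := by
    intro x
    rw [gaussianPDF, ← ENNReal.ofReal_one]
    refine ENNReal.ofReal_le_ofReal ?_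
    rw [gaussianPDFReal]
    refine mul_le_one₀ ?_ (Real.exp_pos _).le ?_
    · refine inv_le_one_of_one_le₀ ?_
      rw [Real.one_le_sqrt]
      have := Real.pi_gt_three
      simp; linarith
    · rw [Real.exp_le_one_iff]
      have := sq_nonneg (x - 0)
      simp only [NNReal.coe_one, mul_one]; linarith
  have hint : ∀ f : ℝ → ℝ≥0∞, Measurable f →
      ∫⁻ x, f x ∂gaussianReal 0 1 = ∫⁻ x, gaussianPDF 0 1 x * f x := by
    intro f hf
    rw [gaussianReal_of_var_ne_zero _ hv, lintegral_withDensity_eq_lintegral_mul _ hφ hf]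
    rfl
  rw [hint f hf, hint g hg, hint h hh]
  refine prekopaLeindler_volume θ h0 h1 _ _ _ (hφ.mul hf) (hφ.mul hg) (hφ.mul hh)
    (fun x => mul_le_one' (hφ1 x) (hf1 x)) (fun x => mul_le_one' (hφ1 x) (hg1 x)) ?_
  intro x y
  rw [ENNReal.mul_rpow_of_nonneg _ _ h1'.le, ENNReal.mul_rpow_of_nonneg _ _ h0.le, mul_mul_mul_comm]
  refine mul_le_mul' ?_ (hfgh x y)
  simp only [gaussianPDF]
  rw [ENNReal.ofReal_rpow_of_nonneg (gaussianPDFReal_nonneg _ _ _) h1'.le,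
    ENNReal.ofReal_rpow_of_nonneg (gaussianPDFReal_nonneg _ _ _) h0.le,
    ← ENNReal.ofReal_mul (Real.rpow_nonneg (gaussianPDFReal_nonneg _ _ _) _)]
  refine ENNReal.ofReal_le_ofReal ?_
  simp only [gaussianPDFReal]
  have hs : (0:ℝ) < (√(2 * Real.pi * (1 : NNReal)))⁻¹ := by positivity
  rw [Real.mul_rpow hs.le (Real.exp_pos _).le, Real.mul_rpow hs.le (Real.exp_pos _).le,
    mul_mul_mul_comm, ← Real.rpow_add hs, ← Real.exp_mul, ← Real.exp_mul, ← Real.exp_add]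
  rw [sub_add_cancel, Real.rpow_one]
  refine mul_le_mul_of_nonneg_left (Real.exp_le_exp.mpr ?_) hs.le
  simp only [NNReal.coe_one, smul_eq_mul]
  nlinarith [mul_nonneg (mul_nonneg h0.le h1'.le) (sq_nonneg (x - y))]

/-- Splitting off the first coordinate of a Gaussian vector. -/
theorem gaussVec_succ (n : ℕ) : gaussVec (n + 1) =
    ((gaussianReal 0 1).prod (gaussVec n)).map (fun p => (Fin.cons p.1 p.2 : Fin (n + 1) → ℝ)) := by
  have := (measurePreserving_piFinSuccAbove (fun _ : Fin (n + 1) => gaussianReal 0 1) 0).symm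
  rw [gaussVec, gaussVec, ← this.map_eq]
  congr 1
  funext p
  exact Fin.insertNth_zero' p.1 p.2

theorem measurable_finCons (n : ℕ) :
    Measurable (fun p : ℝ × (Fin n → ℝ) => (Fin.cons p.1 p.2 : Fin (n + 1) → ℝ)) := by
  convert (MeasurableEquiv.piFinSuccAbove (fun _ : Fin (n + 1) => ℝ) 0).symm.measurable using 1
  funext p
  exact (Fin.insertNth_zero' p.1 p.2).symm

instance (n : ℕ) : IsProbabilityMeasure (gaussVec n) := by
  unfold gaussVec; infer_instance

theorem prekopaLeindler_gaussVec (n : ℕ) : PrekopaLeindler (gaussVec n) := by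
  induction n with
  | zero =>
    intro θ h0 h1 f g h hf hg hh hf1 hg1 hfgh
    have : gaussVec 0 = Measure.dirac 0 := by
      rw [gaussVec, Measure.pi_of_empty _ 0]
    rw [this, lintegral_dirac, lintegral_dirac, lintegral_dirac]
    simpa using hfgh 0 0
  | succ n ih =>
    rw [gaussVec_succ]
    exact (prekopaLeindler_gaussianReal.prod ih).map
      { toFun := fun p => (Fin.cons p.1 p.2 : Fin (n + 1) → ℝ)
        map_add' := fun p q => by
          ext i; refine Fin.cases ?_ (fun j => ?_) i <;> simp
        map_smul' := fun c p => by
          ext i; refine Fin.cases ?_ (fun j => ?_) i <;> simp } (measurable_finCons n)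

theorem gaussianReal_map_mul_sign {c : ℝ} (hc : c ^ 2 = 1) :
    (gaussianReal 0 1).map (c * ·) = gaussianReal 0 1 := by
  rw [gaussianReal_map_const_mul]
  congr 1
  · simp
  · ext; simp [hc]

theorem measurePreserving_sign (n : ℕ) {c : Fin n → ℝ} (hc : ∀ i, c i ^ 2 = 1) :
    MeasurePreserving (fun x : Fin n → ℝ => fun i => c i * x i) (gaussVec n) (gaussVec n) :=
  measurePreserving_pi _ _ fun i => ⟨by fun_prop, gaussianReal_map_mul_sign (hc i)⟩

theorem measurePreserving_neg_gaussVec (n : ℕ) :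
    MeasurePreserving (fun x : Fin n → ℝ => -x) (gaussVec n) (gaussVec n) := by
  convert measurePreserving_sign n (c := fun _ => -1) (by simp) using 1
  funext x i
  simp

/-- Gaussian measures of sections of a symmetric convex set decrease away from the centre. -/
theorem gaussVec_section_antitone {n : ℕ} {W : Set (ℝ × (Fin n → ℝ))} (hW : MeasurableSet W)
    (hconv : Convex ℝ W) (hsymm : ∀ p ∈ W, -p ∈ W) {s r : ℝ} (hsr : |s| ≤ |r|) :
    gaussVec n {x | (r, x) ∈ W} ≤ gaussVec n {x | (s, x) ∈ W} := by
  have hmeas : ∀ s, MeasurableSet {x | (s, x) ∈ W} := fun s => measurable_prodMk_left hW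
  have hneg : ∀ s, gaussVec n {x | (-s, x) ∈ W} = gaussVec n {x | (s, x) ∈ W} := by
    intro s
    rw [← (measurePreserving_neg_gaussVec n).measure_preimage (hmeas s).nullMeasurableSet]
    congr 1
    ext x
    simp only [mem_ofPred_eq, mem_preimage]
    constructor
    · intro h; simpa using hsymm _ h
    · intro h; simpa using hsymm _ h
  rcases eq_or_lt_of_le hsr with h | hlt
  · rcases abs_eq_abs.mp h with rfl | rfl
    · exact le_rfl
    · rw [hneg]
  have hr : r ≠ 0 := by
    rintro rfl
    simp at hlt
    exact absurd hlt (not_lt.mpr (abs_nonneg s))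
  set θ : ℝ := (1 - s / r) / 2 with hθ
  have hsr1 : |s / r| < 1 := by
    rw [abs_div, div_lt_one (abs_pos.mpr hr)]; exact hlt
  obtain ⟨ha, hb⟩ := abs_lt.mp hsr1
  have h0 : 0 < θ := by rw [hθ]; linarith
  have h1 : θ < 1 := by rw [hθ]; linarith
  have h1' : 0 < 1 - θ := by linarith
  have hs : (1 - θ) * r + θ * (-r) = s := by
    rw [hθ]; field_simp; ring
  have key := prekopaLeindler_gaussVec n θ h0 h1
    (indicator {x | (r, x) ∈ W} 1) (indicator {x | (-r, x) ∈ W} 1) (indicator {x | (s, x) ∈ W} 1)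
    (measurable_one.indicator (hmeas _)) (measurable_one.indicator (hmeas _))
    (measurable_one.indicator (hmeas _))
    (fun x => indicator_le_self _ _ x) (fun x => indicator_le_self _ _ x) ?_
  · rw [lintegral_indicator_one (hmeas _), lintegral_indicator_one (hmeas _),
      lintegral_indicator_one (hmeas _), hneg,
      ← ENNReal.rpow_add_of_nonneg _ _ h1'.le h0.le, sub_add_cancel, ENNReal.rpow_one] at key
    exact key
  · intro x y
    by_cases hx : (r, x) ∈ W
    · by_cases hy : (-r, y) ∈ W
      · have hm := hconv hx hy h1'.le h0.le (by ring)
        simp only [Prod.smul_mk, Prod.mk_add_mk, smul_eq_mul, hs] at hm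
        rw [indicator_of_mem (show x ∈ {x | (r, x) ∈ W} from hx),
          indicator_of_mem (show y ∈ {x | (-r, x) ∈ W} from hy), indicator_of_mem (by exact hm)]
        simp
      · rw [indicator_of_notMem (show y ∉ {x | (-r, x) ∈ W} from hy)]
        simp [h0]
    · rw [indicator_of_notMem (show x ∉ {x | (r, x) ∈ W} from hx)]
      simp [h1']

/-- A lower bound for the relative second-order gain at Gaussian measure `q`. -/
def gainH (q : ℝ) : ℝ := 0.2617 * q ^ 2 + 0.0822 * q ^ 4

theorem gainH_nonneg (q : ℝ) : 0 ≤ gainH q := by unfold gainH; positivity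

theorem integrable_of_mem_unitInterval {α : Type*} [MeasurableSpace α] {μ : Measure α}
    [IsFiniteMeasure μ] {h : α → ℝ}
    (hm : Measurable h) (h0 : ∀ s, 0 ≤ h s) (h1 : ∀ s, h s ≤ 1) : Integrable h μ :=
  (integrable_const (1 : ℝ)).mono' hm.aestronglyMeasurable
    (Filter.Eventually.of_forall fun s => by rw [Real.norm_of_nonneg (h0 s)]; exact h1 s)

theorem Integrable.mul_unitInterval {α : Type*} [MeasurableSpace α] {μ : Measure α}
    {f h : α → ℝ} (hf : Integrable f μ)
    (hm : Measurable h) (h0 : ∀ s, 0 ≤ h s) (h1 : ∀ s, h s ≤ 1) :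
    Integrable (fun s => f s * h s) μ :=
  hf.mono (hf.aestronglyMeasurable.mul hm.aestronglyMeasurable)
    (Filter.Eventually.of_forall fun s => by
      rw [norm_mul, Real.norm_of_nonneg (h0 s)]
      exact mul_le_of_le_one_right (norm_nonneg _) (h1 s))

theorem integrable_sq_gaussianReal : Integrable (fun s : ℝ => s ^ 2) (gaussianReal 0 1) := by
  simpa using (memLp_id_gaussianReal (μ := 0) (v := 1) 2).integrable_sq

/-- One-dimensional correlation inequality for functions decreasing in `|s|`. -/
theorem measureReal_mul_integral_le_setIntegral {ν : Measure ℝ} [IsProbabilityMeasure ν]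
    {h : ℝ → ℝ} (hm : Measurable h)
    (h0 : ∀ s, 0 ≤ h s) (h1 : ∀ s, h s ≤ 1) (hanti : ∀ s r, |s| ≤ |r| → h r ≤ h s) {T : ℝ}
    (hT : 0 ≤ T) :
    ν.real {s | |s| ≤ T} * ∫ s, h s ∂ν ≤ ∫ s in {s | |s| ≤ T}, h s ∂ν := by
  set I : Set ℝ := {s | |s| ≤ T}
  have hI : MeasurableSet I := measurableSet_le (by fun_prop) measurable_const
  set p := ν.real I
  have hp1 : p ≤ 1 := measureReal_le_one
  have hp0 : 0 ≤ p := measureReal_nonneg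
  have hint : Integrable h ν := integrable_of_mem_unitInterval hm h0 h1
  have hintI : Integrable (I.indicator h) ν := hint.indicator hI
  have hone : Integrable (I.indicator (fun _ => (1 : ℝ))) ν := (integrable_const 1).indicator hI
  have hpt : ∀ s, I.indicator (fun _ => (1 : ℝ)) s * h T - p * h T ≤ I.indicator h s - p * h s := by
    intro s
    by_cases hs : s ∈ I
    · rw [indicator_of_mem hs, indicator_of_mem hs]
      have : h T ≤ h s := hanti s T (by rw [abs_of_nonneg hT]; exact hs)
      nlinarith
    · rw [indicator_of_notMem hs, indicator_of_notMem hs]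
      have hs' : T < |s| := not_le.mp hs
      have : h s ≤ h T := hanti T s (by rw [abs_of_nonneg hT]; exact hs'.le)
      nlinarith
  have := integral_mono ((hone.mul_const (h T)).sub (integrable_const (p * h T)))
    (hintI.sub (hint.const_mul p)) hpt
  simp only [Pi.sub_apply] at this
  rw [integral_sub (hone.mul_const _) (integrable_const _), integral_sub hintI (hint.const_mul p),
    integral_mul_const, integral_const_mul, integral_indicator hI, integral_indicator hI] at this
  rw [integral_const_mul] at this
  simp at this
  linarith

theorem exp_neg_le_quadratic {u : ℝ} (hu : 0 ≤ u) : Real.exp (-u) ≤ 1 - u + u ^ 2 / 2 := by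
  have h := Real.quadratic_le_exp_of_nonneg hu
  have hp : 0 < 1 - u + u ^ 2 / 2 := by nlinarith [sq_nonneg (u - 1)]
  rw [Real.exp_neg, inv_le_comm₀ (Real.exp_pos _) hp]
  refine le_trans ?_ h
  rw [inv_le_iff_one_le_mul₀ hp]
  nlinarith [sq_nonneg (u ^ 2)]

theorem gaussianPDFReal_le_poly (s : ℝ) :
    gaussianPDFReal 0 1 s ≤ (√(2 * Real.pi))⁻¹ * (1 - s ^ 2 / 2 + s ^ 4 / 8) := by
  rw [gaussianPDFReal]
  simp only [NNReal.coe_one, mul_one, sub_zero]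
  refine mul_le_mul_of_nonneg_left ?_ (by positivity)
  have := exp_neg_le_quadratic (u := s ^ 2 / 2) (by positivity)
  rw [neg_div]
  nlinarith

theorem integral_parabola_le {r : ℝ} (hr : 0 ≤ r) :
    ∫ s, max (r ^ 2 - s ^ 2) 0 ∂gaussianReal 0 1 ≤
      2 * (√(2 * Real.pi))⁻¹ * (2 * r ^ 3 / 3 - r ^ 5 / 15 + r ^ 7 / 140) := by
  rw [integral_gaussianReal_eq_integral_smul one_ne_zero]
  have e1 : (fun s => gaussianPDFReal 0 1 s • max (r ^ 2 - s ^ 2) 0) =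
      (Icc (-r) r).indicator fun s => gaussianPDFReal 0 1 s * (r ^ 2 - s ^ 2) := by
    funext s
    by_cases hs : s ∈ Icc (-r) r
    · rw [indicator_of_mem hs, max_eq_left (by nlinarith [hs.1, hs.2]), smul_eq_mul]
    · rw [indicator_of_notMem hs, max_eq_right, smul_zero]
      by_contra hlt
      push Not at hlt
      exact hs (abs_le.mp (abs_le_of_sq_le_sq (by linarith) hr))
  rw [e1, integral_indicator measurableSet_Icc, integral_Icc_eq_integral_Ioc,
    ← intervalIntegral.integral_of_le (by linarith)]
  have hc : Continuous (gaussianPDFReal 0 1) := by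
    unfold gaussianPDFReal; fun_prop
  calc ∫ s in (-r)..r, gaussianPDFReal 0 1 s * (r ^ 2 - s ^ 2)
      ≤ ∫ s in (-r)..r, (√(2 * Real.pi))⁻¹ * (1 - s ^ 2 / 2 + s ^ 4 / 8) * (r ^ 2 - s ^ 2) := by
        refine intervalIntegral.integral_mono_on (by linarith)
          (Continuous.intervalIntegrable (by fun_prop) _ _)
          (Continuous.intervalIntegrable (by fun_prop) _ _) fun s hs => ?_
        exact mul_le_mul_of_nonneg_right (gaussianPDFReal_le_poly s) (by nlinarith [hs.1, hs.2])
    _ = _ := by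
        have hd : ∀ s : ℝ, HasDerivAt (fun s => (√(2 * Real.pi))⁻¹ * (r ^ 2 * s - s ^ 3 / 3
            - r ^ 2 * s ^ 3 / 6 + s ^ 5 / 10 + r ^ 2 * s ^ 5 / 40 - s ^ 7 / 56))
            ((√(2 * Real.pi))⁻¹ * (1 - s ^ 2 / 2 + s ^ 4 / 8) * (r ^ 2 - s ^ 2)) s := by
          intro s
          have h1 := ((hasDerivAt_id s).const_mul (r ^ 2))
          have h3 := ((hasDerivAt_id s).pow 3)
          have h5 := ((hasDerivAt_id s).pow 5)
          have h7 := ((hasDerivAt_id s).pow 7)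
          have := (((((h1.sub (h3.div_const 3)).sub ((h3.const_mul (r ^ 2)).div_const 6)).add
            (h5.div_const 10)).add ((h5.const_mul (r ^ 2)).div_const 40)).sub
            (h7.div_const 56)).const_mul ((√(2 * Real.pi))⁻¹)
          refine (this.congr_deriv ?_)
          simp; ring
        rw [intervalIntegral.integral_eq_sub_of_hasDerivAt (fun s _ => hd s)
          (Continuous.intervalIntegrable (by fun_prop) _ _)]
        ring

theorem integral_sq_mul_ge {h : ℝ → ℝ} (hm : Measurable h)
    (h0 : ∀ s, 0 ≤ h s) (h1 : ∀ s, h s ≤ 1) :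
    2 * (∫ s, h s ∂gaussianReal 0 1) * gainH (∫ s, h s ∂gaussianReal 0 1) ≤
      ∫ s, s ^ 2 * h s ∂gaussianReal 0 1 := by
  set ν := gaussianReal 0 1
  set q := ∫ s, h s ∂ν
  have hint : Integrable h ν := integrable_of_mem_unitInterval hm h0 h1
  have hq0 : 0 ≤ q := integral_nonneg h0
  have hq1 : q ≤ 1 := by
    calc q ≤ ∫ s, (1:ℝ) ∂ν := integral_mono hint (integrable_const _) h1
      _ = 1 := by simp
  set k := √(2 * Real.pi) with hk
  have hk0 : 0 < k := by positivity
  have hk2 : k ^ 2 = 2 * Real.pi := Real.sq_sqrt (by positivity)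
  have hpi1 := Real.pi_gt_d4
  have hpi2 := Real.pi_lt_d4
  set t := k / 2 * q with ht
  have ht0 : 0 ≤ t := by positivity
  have ht2 : t ^ 2 ≤ 1.571 := by
    have : t ^ 2 = Real.pi / 2 * q ^ 2 := by rw [ht, mul_pow, div_pow, hk2]; ring
    rw [this]; nlinarith
  set r := t * (1 + t ^ 2 / 6) with hr
  have hr0 : 0 ≤ r := by positivity
  have hA : Integrable (fun s : ℝ => s ^ 2 * h s) ν :=
    Integrable.mul_unitInterval integrable_sq_gaussianReal hm h0 h1
  have hB : Integrable (fun s : ℝ => max (r ^ 2 - s ^ 2) 0) ν :=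
    ((integrable_const _).sub integrable_sq_gaussianReal).pos_part
  have main : r ^ 2 * q - ∫ s, max (r ^ 2 - s ^ 2) 0 ∂ν ≤ ∫ s, s ^ 2 * h s ∂ν := by
    rw [← integral_const_mul, ← integral_sub (hint.const_mul _) hB]
    refine integral_mono ((hint.const_mul _).sub hB) hA fun s => ?_
    have a0 := h0 s
    have a1 := h1 s
    simp only
    rcases le_total (s ^ 2) (r ^ 2) with hs | hs
    · rw [max_eq_left (by linarith)]; nlinarith
    · rw [max_eq_right (by linarith)]; nlinarith
  have hpar := integral_parabola_le hr0
  have hq : q = 2 * k⁻¹ * t := by rw [ht]; field_simp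
  have poly : t ^ 3 / 3 + t ^ 5 / 15 ≤ r ^ 2 * t - (2 * r ^ 3 / 3 - r ^ 5 / 15 + r ^ 7 / 140) := by
    have : r ^ 2 * t - (2 * r ^ 3 / 3 - r ^ 5 / 15 + r ^ 7 / 140) - (t ^ 3 / 3 + t ^ 5 / 15) =
      t ^ 3 * ((1 + t ^ 2 / 6) ^ 2 - 2 / 3 * (1 + t ^ 2 / 6) ^ 3 + t ^ 2 * (1 + t ^ 2 / 6) ^ 5 / 15
        - (t ^ 2) ^ 2 * (1 + t ^ 2 / 6) ^ 7 / 140 - 1 / 3 - t ^ 2 / 15) := by rw [hr]; ring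
    have h2 : 0 ≤ (1 + t ^ 2 / 6) ^ 2 - 2 / 3 * (1 + t ^ 2 / 6) ^ 3
        + t ^ 2 * (1 + t ^ 2 / 6) ^ 5 / 15
        - (t ^ 2) ^ 2 * (1 + t ^ 2 / 6) ^ 7 / 140 - 1 / 3 - t ^ 2 / 15 := by
      have hp0 : 0 ≤ t ^ 2 := sq_nonneg t
      generalize t ^ 2 = p at ht2 hp0
      have hb : ∀ k : ℕ, p ^ k ≤ 1.571 ^ k := fun k => pow_le_pow_left₀ hp0 ht2 k
      have e : (1 + p / 6) ^ 2 - 2 / 3 * (1 + p / 6) ^ 3 + p * (1 + p / 6) ^ 5 / 15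
          - p ^ 2 * (1 + p / 6) ^ 7 / 140 - 1 / 3 - p / 15 =
          p ^ 2 * (13 / 630 + 23 / 3240 * p - 7 / 6480 * p ^ 2 - 7 / 7776 * p ^ 3
            - 43 / 233280 * p ^ 4 - 1 / 51840 * p ^ 5 - 1 / 933120 * p ^ 6
            - 1 / 39191040 * p ^ 7) := by ring
      rw [e]
      refine mul_nonneg (sq_nonneg p) ?_
      linarith [hb 2, hb 3, hb 4, hb 5, hb 6, hb 7]
    have := mul_nonneg (pow_nonneg ht0 3) h2
    linarith
  have hfin : 2 * q * gainH q ≤ 2 * k⁻¹ * (t ^ 3 / 3 + t ^ 5 / 15) := by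
    have e : 2 * k⁻¹ * (t ^ 3 / 3 + t ^ 5 / 15) =
        q * (Real.pi / 6 * q ^ 2 + Real.pi ^ 2 / 60 * q ^ 4) := by
      have : 2 * k⁻¹ * (t ^ 3 / 3 + t ^ 5 / 15) =
          k ^ 2 / 12 * q ^ 3 + (k ^ 2) ^ 2 / 240 * q ^ 5 := by
        rw [ht]; field_simp; ring
      rw [this, hk2]; ring
    rw [e, gainH]
    have h3 : 0.5234 ≤ Real.pi / 6 := by linarith
    have h4 : 0.1644 ≤ Real.pi ^ 2 / 60 := by nlinarith
    have := mul_le_mul_of_nonneg_right h3 (pow_nonneg hq0 2)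
    have := mul_le_mul_of_nonneg_right h4 (pow_nonneg hq0 4)
    nlinarith
  have := mul_le_mul_of_nonneg_left poly (show 0 ≤ 2 * k⁻¹ by positivity)
  rw [hq] at main
  linarith

theorem two_add_sq_le_exp_add_exp_neg (u : ℝ) : 2 + u ^ 2 ≤ Real.exp u + Real.exp (-u) := by
  wlog hu : 0 ≤ u generalizing u
  · have := this (-u) (by linarith)
    simp only [neg_neg, neg_sq] at this
    linarith
  have h1 := Real.quadratic_le_exp_of_nonneg (x := u / 2) (by linarith)
  have h2 : u / 2 ≤ Real.sinh (u / 2) := Real.self_le_sinh_iff.mpr (by linarith)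
  have h3 : Real.cosh u = 1 + 2 * Real.sinh (u / 2) ^ 2 := by
    have := Real.cosh_two_mul (u / 2)
    rw [mul_div_cancel₀ _ two_ne_zero, Real.cosh_sq] at this
    linarith
  rw [Real.cosh_eq] at h3
  nlinarith

/-- Shifting an even function costs at most the Cameron–Martin factor, up to a gain. -/
theorem integral_shift_ge {h : ℝ → ℝ} (hm : Measurable h)
    (h0 : ∀ s, 0 ≤ h s) (h1 : ∀ s, h s ≤ 1) (heven : ∀ s, h (-s) = h s) (t : ℝ) :
    Real.exp (-(t ^ 2 / 2)) * ((∫ s, h s ∂gaussianReal 0 1) *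
      (1 + t ^ 2 * gainH (∫ s, h s ∂gaussianReal 0 1))) ≤
      ∫ s, h (s + t) ∂gaussianReal 0 1 := by
  set ν := gaussianReal 0 1 with hν
  set q := ∫ s, h s ∂ν with hq
  have hint : Integrable h ν := integrable_of_mem_unitInterval hm h0 h1
  have hexp : ∀ t : ℝ, Integrable (fun s => Real.exp (t * s) * h s) ν := fun t =>
    Integrable.mul_unitInterval (integrable_exp_mul_gaussianReal t) hm h0 h1
  have hshift : ∫ s, h (s + t) ∂ν = Real.exp (-(t ^ 2 / 2)) * ∫ s, Real.exp (t * s) * h s ∂ν := by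
    have e1 : ∫ s, h (s + t) ∂ν = ∫ s, h s ∂gaussianReal t 1 := by
      rw [← zero_add t, ← gaussianReal_map_add_const, zero_add,
        integral_map (by fun_prop) hm.aestronglyMeasurable]
    rw [e1, ← integral_const_mul, integral_gaussianReal_eq_integral_smul one_ne_zero, hν,
      integral_gaussianReal_eq_integral_smul one_ne_zero]
    congr 1
    funext s
    simp only [gaussianPDFReal, smul_eq_mul, NNReal.coe_one, mul_one, sub_zero]
    have : Real.exp (-(s - t) ^ 2 / 2) =
        Real.exp (-s ^ 2 / 2) * (Real.exp (-(t ^ 2 / 2)) * Real.exp (t * s)) := by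
      rw [← Real.exp_add, ← Real.exp_add]; congr 1; ring
    rw [this]; ring
  have hsym : ∫ s, Real.exp (-t * s) * h s ∂ν = ∫ s, Real.exp (t * s) * h s ∂ν := by
    have hneg : ν.map (fun s => -s) = ν := by rw [hν, gaussianReal_map_neg, neg_zero]
    conv_lhs => rw [← hneg]
    have hmm : Measurable fun s => Real.exp (-t * s) * h s := by fun_prop
    rw [integral_map (by fun_prop) hmm.aestronglyMeasurable]
    simp only [heven, neg_mul_neg]
  have hA : Integrable (fun s : ℝ => s ^ 2 * h s) ν :=
    Integrable.mul_unitInterval integrable_sq_gaussianReal hm h0 h1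
  have hsum : 2 * q + t ^ 2 * ∫ s, s ^ 2 * h s ∂ν ≤ 2 * ∫ s, Real.exp (t * s) * h s ∂ν := by
    rw [hq, ← integral_const_mul, ← integral_const_mul,
      ← integral_add (hint.const_mul 2) (hA.const_mul _)]
    calc ∫ s, (2 * h s + t ^ 2 * (s ^ 2 * h s)) ∂ν
        ≤ ∫ s, (Real.exp (t * s) * h s + Real.exp (-t * s) * h s) ∂ν := by
          refine integral_mono ((hint.const_mul 2).add (hA.const_mul _)) ((hexp t).add (hexp (-t)))
            fun s => ?_
          have := mul_le_mul_of_nonneg_right (two_add_sq_le_exp_add_exp_neg (t * s)) (h0 s)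
          simp only [neg_mul]
          nlinarith
      _ = _ := by rw [integral_add (hexp t) (hexp (-t)), hsym]; ring
  have hgain := integral_sq_mul_ge hm h0 h1
  rw [hshift]
  refine mul_le_mul_of_nonneg_left ?_ (Real.exp_pos _).le
  have := mul_le_mul_of_nonneg_left hgain (sq_nonneg t)
  nlinarith

/-- Comparison of a Gaussian integral with the one of a rescaled function. -/
theorem integral_dilate_ge {h : ℝ → ℝ} (hm : Measurable h)
    (h0 : ∀ s, 0 ≤ h s) (h1 : ∀ s, h s ≤ 1) {τ : ℝ} (hτ0 : 0 < τ) (hτ1 : τ ≤ 1) :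
    τ * ((∫ s, h (τ * s) ∂gaussianReal 0 1) *
      (1 + (1 - τ ^ 2) * gainH (∫ s, h (τ * s) ∂gaussianReal 0 1))) ≤
      ∫ s, h s ∂gaussianReal 0 1 := by
  set ν := gaussianReal 0 1 with hν
  have hm' : Measurable fun s => h (τ * s) := hm.comp (by fun_prop)
  have hgain := integral_sq_mul_ge hm' (fun s => h0 _) (fun s => h1 _)
  set q := ∫ s, h (τ * s) ∂ν with hq
  have hint : Integrable h ν := integrable_of_mem_unitInterval hm h0 h1
  have hint' : Integrable (fun s => h (τ * s)) ν :=
    integrable_of_mem_unitInterval hm' (fun s => h0 _) (fun s => h1 _)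
  have hA : Integrable (fun s : ℝ => s ^ 2 * h (τ * s)) ν :=
    Integrable.mul_unitInterval integrable_sq_gaussianReal hm' (fun s => h0 _) (fun s => h1 _)
  have hφint : Integrable (fun s => gaussianPDFReal 0 1 s * h s) volume :=
    Integrable.mul_unitInterval (integrable_gaussianPDFReal 0 1) hm h0 h1
  have e1 : ∫ s, h s ∂ν = τ * ∫ s, gaussianPDFReal 0 1 (τ * s) * h (τ * s) := by
    rw [hν, integral_gaussianReal_eq_integral_smul one_ne_zero,
      Measure.integral_comp_mul_left (fun s => gaussianPDFReal 0 1 s * h s) τ,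
      abs_of_pos (inv_pos.mpr hτ0), smul_eq_mul, mul_inv_cancel_left₀ hτ0.ne']
    rfl
  have e2 : q + (1 - τ ^ 2) / 2 * ∫ s, s ^ 2 * h (τ * s) ∂ν =
      ∫ s, gaussianPDFReal 0 1 s * ((1 + (1 - τ ^ 2) / 2 * s ^ 2) * h (τ * s)) := by
    rw [hq, ← integral_const_mul, ← integral_add hint' (hA.const_mul _), hν,
      integral_gaussianReal_eq_integral_smul one_ne_zero]
    congr 1
    funext s
    simp only [smul_eq_mul]; ring
  have e3 : ∫ s, gaussianPDFReal 0 1 s * ((1 + (1 - τ ^ 2) / 2 * s ^ 2) * h (τ * s)) ≤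
      ∫ s, gaussianPDFReal 0 1 (τ * s) * h (τ * s) := by
    refine integral_mono_of_nonneg (Filter.Eventually.of_forall fun s => ?_)
      (hφint.comp_mul_left' hτ0.ne') (Filter.Eventually.of_forall fun s => ?_)
    · have := gaussianPDFReal_nonneg 0 1 s
      have := h0 (τ * s)
      have : 0 ≤ 1 - τ ^ 2 := by nlinarith
      simp only [Pi.zero_apply]
      positivity
    · simp only
      rw [← mul_assoc]
      refine mul_le_mul_of_nonneg_right ?_ (h0 _)
      simp only [gaussianPDFReal, NNReal.coe_one, mul_one, sub_zero]
      rw [mul_assoc]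
      refine mul_le_mul_of_nonneg_left ?_ (by positivity)
      have : Real.exp (-(τ * s) ^ 2 / 2) =
          Real.exp (-s ^ 2 / 2) * Real.exp ((1 - τ ^ 2) / 2 * s ^ 2) := by
        rw [← Real.exp_add]; congr 1; ring
      rw [this]
      refine mul_le_mul_of_nonneg_left ?_ (Real.exp_pos _).le
      linarith [Real.add_one_le_exp ((1 - τ ^ 2) / 2 * s ^ 2)]
  rw [e1]
  refine mul_le_mul_of_nonneg_left ?_ hτ0.le
  have : 0 ≤ 1 - τ ^ 2 := by nlinarith
  have := mul_le_mul_of_nonneg_left hgain this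
  nlinarith

theorem measurePreserving_linearIsometryEquiv {n : ℕ}
    (L : EuclideanSpace ℝ (Fin n) ≃ₗᵢ[ℝ] EuclideanSpace ℝ (Fin n)) :
    MeasurePreserving (fun x : Fin n → ℝ => (L (WithLp.toLp 2 x)).ofLp)
      (gaussVec n) (gaussVec n) := by
  have hL : Measurable L := L.continuous.measurable
  have h1 : Measurable (fun x : Fin n → ℝ => WithLp.toLp 2 x) := by fun_prop
  have h2 : Measurable (fun x : EuclideanSpace ℝ (Fin n) => x.ofLp) := by fun_prop
  refine ⟨h2.comp (hL.comp h1), ?_⟩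
  have e1 : (gaussVec n).map (fun x : Fin n → ℝ => WithLp.toLp 2 x) =
    stdGaussian (EuclideanSpace ℝ (Fin n)) := map_pi_eq_stdGaussian
  have e2 : (stdGaussian (EuclideanSpace ℝ (Fin n))).map (fun x => x.ofLp) = gaussVec n := by
    rw [← e1, Measure.map_map h2 h1]
    exact Measure.map_id
  have e3 : (stdGaussian (EuclideanSpace ℝ (Fin n))).map L =
    stdGaussian (EuclideanSpace ℝ (Fin n)) := stdGaussian_map L
  calc (gaussVec n).map (fun x : Fin n → ℝ => (L (WithLp.toLp 2 x)).ofLp)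
      = (((gaussVec n).map (fun x : Fin n → ℝ => WithLp.toLp 2 x)).map L).map
        (fun x => x.ofLp) := by
        rw [Measure.map_map hL h1, Measure.map_map h2 (hL.comp h1)]
        rfl
    _ = gaussVec n := by rw [e1, e3, e2]

theorem measurePreserving_of_dotProduct {n : ℕ} (U : (Fin n → ℝ) →ₗ[ℝ] (Fin n → ℝ))
    (hU : ∀ x, U x ⬝ᵥ U x = x ⬝ᵥ x) : MeasurePreserving U (gaussVec n) (gaussVec n) := by
  let e := WithLp.linearEquiv 2 ℝ (Fin n → ℝ)
  let L : EuclideanSpace ℝ (Fin n) →ₗᵢ[ℝ] EuclideanSpace ℝ (Fin n) :=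
    { toLinearMap := e.symm.toLinearMap ∘ₗ U ∘ₗ e.toLinearMap
      norm_map' := fun x => by
        have h := hU x.ofLp
        rw [EuclideanSpace.norm_eq, EuclideanSpace.norm_eq]
        simp only [dotProduct, ← pow_two] at h
        congr 1
        simpa [e] using h }
  exact measurePreserving_linearIsometryEquiv (L.toLinearIsometryEquiv rfl)

/-- Householder reflection. -/
def reflectV {n : ℕ} (d : Fin n → ℝ) : (Fin n → ℝ) →ₗ[ℝ] (Fin n → ℝ) where
  toFun x := x - (2 * (d ⬝ᵥ x) / (d ⬝ᵥ d)) • d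
  map_add' x y := by rw [dotProduct_add]; module
  map_smul' c x := by
    rw [dotProduct_smul, smul_eq_mul, RingHom.id_apply]; module

theorem reflectV_apply {n : ℕ} (d x : Fin n → ℝ) :
    reflectV d x = x - (2 * (d ⬝ᵥ x) / (d ⬝ᵥ d)) • d := rfl

theorem reflectV_dotProduct {n : ℕ} (d x y : Fin n → ℝ) :
    reflectV d x ⬝ᵥ y = x ⬝ᵥ reflectV d y := by
  simp only [reflectV_apply, sub_dotProduct, dotProduct_sub, smul_dotProduct, dotProduct_smul,
    smul_eq_mul]
  rw [dotProduct_comm x d]; ring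

theorem reflectV_reflectV {n : ℕ} (d x : Fin n → ℝ) : reflectV d (reflectV d x) = x := by
  rcases eq_or_ne (d ⬝ᵥ d) 0 with h | h
  · simp [reflectV_apply, h]
  · simp only [reflectV_apply, dotProduct_sub, dotProduct_smul, smul_eq_mul]
    rw [sub_sub, ← add_smul]
    have : 2 * (d ⬝ᵥ x) / (d ⬝ᵥ d) +
        2 * (d ⬝ᵥ x - 2 * (d ⬝ᵥ x) / (d ⬝ᵥ d) * (d ⬝ᵥ d)) / (d ⬝ᵥ d) = 0 := by
      field_simp; ring
    rw [this, zero_smul, sub_zero]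

theorem measurePreserving_reflectV {n : ℕ} (d : Fin n → ℝ) :
    MeasurePreserving (reflectV d) (gaussVec n) (gaussVec n) :=
  measurePreserving_of_dotProduct _ fun x => by
    rw [reflectV_dotProduct, reflectV_reflectV]

/-- Gaussian-preserving coordinates in which a given vector points along the first axis. -/
theorem exists_adapted_coordinates {n : ℕ} (w : Fin (n + 1) → ℝ) :
    ∃ U : (ℝ × (Fin n → ℝ)) →ₗ[ℝ] (Fin (n + 1) → ℝ), Measurable U ∧
      MeasurePreserving U ((gaussianReal 0 1).prod (gaussVec n)) (gaussVec (n + 1)) ∧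
      U (√(w ⬝ᵥ w), 0) = w ∧ ∀ p, w ⬝ᵥ U p = √(w ⬝ᵥ w) * p.1 := by
  let T : (ℝ × (Fin n → ℝ)) →ₗ[ℝ] (Fin (n + 1) → ℝ) :=
      { toFun := fun p => (Fin.cons p.1 p.2 : Fin (n + 1) → ℝ)
        map_add' := fun p q => by
          ext i; refine Fin.cases ?_ (fun j => ?_) i <;> simp
        map_smul' := fun c p => by
          ext i; refine Fin.cases ?_ (fun j => ?_) i <;> simp }
  have hT : ∀ p, T p = Fin.cons p.1 p.2 := fun p => rfl
  have hTp : MeasurePreserving T ((gaussianReal 0 1).prod (gaussVec n)) (gaussVec (n + 1)) :=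
    ⟨measurable_finCons n, (gaussVec_succ n).symm⟩
  set r := √(w ⬝ᵥ w)
  have hr2 : r * r = w ⬝ᵥ w := Real.mul_self_sqrt (by
    rw [dotProduct]; exact Finset.sum_nonneg fun i _ => mul_self_nonneg _)
  set d := T (r, 0) - w
  have hTT : ∀ p, T (r, 0) ⬝ᵥ T p = r * p.1 := by
    intro p
    simp [hT, dotProduct, Fin.sum_univ_succ]
  have hw : reflectV d (T (r, 0)) = w := by
    rcases eq_or_ne (d ⬝ᵥ d) 0 with h | h
    · have hd : d = 0 := dotProduct_self_eq_zero.mp h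
      rw [reflectV_apply, h, div_zero, zero_smul, sub_zero]
      exact sub_eq_zero.mp hd
    · have : 2 * (d ⬝ᵥ T (r, 0)) / (d ⬝ᵥ d) = 1 := by
        rw [div_eq_one_iff_eq h]
        simp only [d, sub_dotProduct, dotProduct_sub]
        rw [hTT, dotProduct_comm w (T (r, 0))]
        simp only
        linarith
      rw [reflectV_apply, this, one_smul]
      simp [d]
  refine ⟨reflectV d ∘ₗ T, ?_, ?_, hw, ?_⟩
  · exact ((measurePreserving_reflectV d).comp hTp).measurable
  · exact (measurePreserving_reflectV d).comp hTp
  · intro p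
    rw [LinearMap.comp_apply, ← reflectV_dotProduct]
    have : reflectV d w = T (r, 0) := by rw [← hw, reflectV_reflectV]
    rw [this, hTT]

/-- Measurable symmetric convex sets. -/
structure SymBody {E : Type*} [AddCommGroup E] [Module ℝ E] [MeasurableSpace E] (W : Set E) :
    Prop where
  meas : MeasurableSet W
  conv : Convex ℝ W
  symm : ∀ p ∈ W, -p ∈ W

theorem SymBody.preimage {E F : Type*} [AddCommGroup E] [Module ℝ E] [MeasurableSpace E]
    [AddCommGroup F] [Module ℝ F] [MeasurableSpace F] {W : Set F} (hW : SymBody W)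
    (U : E →ₗ[ℝ] F) (hU : Measurable U) : SymBody (U ⁻¹' W) :=
  ⟨hU hW.meas, hW.conv.linear_preimage U, fun p hp => by
    rw [mem_preimage, map_neg]; exact hW.symm _ hp⟩

theorem SymBody.inter {E : Type*} [AddCommGroup E] [Module ℝ E] [MeasurableSpace E] {W V : Set E}
    (hW : SymBody W) (hV : SymBody V) : SymBody (W ∩ V) :=
  ⟨hW.meas.inter hV.meas, hW.conv.inter hV.conv, fun p hp => ⟨hW.symm p hp.1, hV.symm p hp.2⟩⟩

/-- The Gaussian measure of a section. -/
def sectionMeasure {n : ℕ} (W : Set (ℝ × (Fin n → ℝ))) (s : ℝ) : ℝ :=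
  (gaussVec n).real {x | (s, x) ∈ W}

section sectionMeasure

variable {n : ℕ} {W : Set (ℝ × (Fin n → ℝ))}

theorem sectionMeasure_nonneg (s : ℝ) : 0 ≤ sectionMeasure W s := measureReal_nonneg

theorem sectionMeasure_le_one (s : ℝ) : sectionMeasure W s ≤ 1 := measureReal_le_one

theorem measurable_sectionMeasure (hW : MeasurableSet W) : Measurable (sectionMeasure W) :=
  (measurable_measure_prodMk_left hW).ennreal_toReal

theorem integral_sectionMeasure (hW : MeasurableSet W) :
    ∫ s, sectionMeasure W s ∂gaussianReal 0 1 =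
      ((gaussianReal 0 1).prod (gaussVec n)).real W := by
  rw [Measure.real, Measure.prod_apply hW]
  exact integral_toReal (measurable_measure_prodMk_left hW).aemeasurable
    (Filter.Eventually.of_forall fun s => measure_lt_top _ _)

theorem sectionMeasure_anti (hW : SymBody W) {s r : ℝ} (hsr : |s| ≤ |r|) :
    sectionMeasure W r ≤ sectionMeasure W s :=
  ENNReal.toReal_mono (measure_ne_top _ _)
    (gaussVec_section_antitone hW.meas hW.conv hW.symm hsr)

theorem sectionMeasure_neg (hW : SymBody W) (s : ℝ) :
    sectionMeasure W (-s) = sectionMeasure W s :=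
  le_antisymm (sectionMeasure_anti hW (by simp)) (sectionMeasure_anti hW (by simp))

end sectionMeasure

theorem dotProduct_self_nonneg' {n : ℕ} (w : Fin n → ℝ) : 0 ≤ w ⬝ᵥ w :=
  Finset.sum_nonneg fun i _ => mul_self_nonneg (w i)

/-- Šidák's inequality. -/
theorem gaussVec_inter_slab_ge {n : ℕ} {W : Set (Fin (n + 1) → ℝ)} (hW : SymBody W)
    (w : Fin (n + 1) → ℝ) {T : ℝ} (hT : 0 ≤ T) (hw : w ≠ 0) :
    (gaussianReal 0 1).real {s | |s| ≤ T / √(w ⬝ᵥ w)} * (gaussVec (n + 1)).real W ≤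
      (gaussVec (n + 1)).real (W ∩ {x | |w ⬝ᵥ x| ≤ T}) := by
  obtain ⟨U, hUm, hU, -, hUw⟩ := exists_adapted_coordinates w
  have hr : 0 < √(w ⬝ᵥ w) := Real.sqrt_pos.mpr
    (lt_of_le_of_ne (dotProduct_self_nonneg' w) fun h => hw (dotProduct_self_eq_zero.mp h.symm))
  have hW' := hW.preimage U hUm
  have hI : MeasurableSet {s : ℝ | |s| ≤ T / √(w ⬝ᵥ w)} :=
    measurableSet_le (by fun_prop) measurable_const
  have hslab : MeasurableSet {x : Fin (n + 1) → ℝ | |w ⬝ᵥ x| ≤ T} :=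
    measurableSet_le (by unfold dotProduct; fun_prop) measurable_const
  rw [← hU.measureReal_preimage hW.meas.nullMeasurableSet,
    ← hU.measureReal_preimage (hW.meas.inter hslab).nullMeasurableSet,
    ← integral_sectionMeasure hW'.meas, ← integral_sectionMeasure (hUm (hW.meas.inter hslab))]
  refine (measureReal_mul_integral_le_setIntegral (measurable_sectionMeasure hW'.meas)
    sectionMeasure_nonneg sectionMeasure_le_one (fun s r => sectionMeasure_anti hW')
    (div_nonneg hT hr.le)).trans (le_of_eq ?_)
  rw [← integral_indicator hI]
  congr 1
  funext s
  by_cases hs : s ∈ {s : ℝ | |s| ≤ T / √(w ⬝ᵥ w)}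
  · rw [indicator_of_mem hs]
    simp only [sectionMeasure]
    congr 1
    ext x
    simp only [mem_ofPred_eq, mem_preimage, mem_inter_iff, hUw, abs_mul, abs_of_pos hr]
    have := (le_div_iff₀' hr).mp hs
    tauto
  · rw [indicator_of_notMem hs]
    simp only [sectionMeasure]
    have : {x | (s, x) ∈ U ⁻¹' (W ∩ {x | |w ⬝ᵥ x| ≤ T})} = ∅ := by
      ext x
      simp only [mem_ofPred_eq, mem_preimage, mem_inter_iff, hUw, abs_mul, abs_of_pos hr,
        mem_empty_iff_false, iff_false, not_and]
      intro _ h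
      exact hs ((le_div_iff₀' hr).mpr h)
    rw [this]; simp

theorem gaussVec_shift_ge {n : ℕ} {W : Set (Fin (n + 1) → ℝ)} (hW : SymBody W)
    (z : Fin (n + 1) → ℝ) :
    Real.exp (-(z ⬝ᵥ z / 2)) * ((gaussVec (n + 1)).real W *
      (1 + z ⬝ᵥ z * gainH ((gaussVec (n + 1)).real W))) ≤
      (gaussVec (n + 1)).real {x | x - z ∈ W} := by
  obtain ⟨U, hUm, hU, hUz, -⟩ := exists_adapted_coordinates z
  have hW' := hW.preimage U hUm
  have hz : √(z ⬝ᵥ z) ^ 2 = z ⬝ᵥ z := Real.sq_sqrt (dotProduct_self_nonneg' z)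
  have hZ : MeasurableSet {x | x - z ∈ W} :=
    hW.meas.preimage (by fun_prop : Measurable fun x => x - z)
  have key := integral_shift_ge (measurable_sectionMeasure hW'.meas)
    sectionMeasure_nonneg sectionMeasure_le_one (sectionMeasure_neg hW') (-√(z ⬝ᵥ z))
  rw [neg_sq, hz, integral_sectionMeasure hW'.meas,
    hU.measureReal_preimage hW.meas.nullMeasurableSet] at key
  refine key.trans (le_of_eq ?_)
  rw [← hU.measureReal_preimage hZ.nullMeasurableSet, ← integral_sectionMeasure (hUm hZ)]
  congr 1
  funext s
  simp only [sectionMeasure]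
  congr 1
  ext x
  simp only [mem_ofPred_eq, mem_preimage]
  have : U (s + -√(z ⬝ᵥ z), x) = U (s, x) - z := by
    conv_rhs => rw [← hUz]
    rw [← map_sub]; congr 1; ext <;> simp [sub_eq_add_neg]
  rw [this]

/-- Contraction by the factor `τ` in the direction `v`. -/
def shrinkV {n : ℕ} (v : Fin n → ℝ) (τ : ℝ) (x : Fin n → ℝ) : Fin n → ℝ :=
  x - ((1 - τ) * (v ⬝ᵥ x)) • v

theorem gaussVec_shrink_ge {n : ℕ} {W : Set (Fin (n + 1) → ℝ)} (hW : SymBody W)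
    {v : Fin (n + 1) → ℝ} (hv : v ⬝ᵥ v = 1) {τ : ℝ} (hτ0 : 0 < τ) (hτ1 : τ ≤ 1) :
    τ * ((gaussVec (n + 1)).real {x | shrinkV v τ x ∈ W} *
      (1 + (1 - τ ^ 2) * gainH ((gaussVec (n + 1)).real {x | shrinkV v τ x ∈ W}))) ≤
      (gaussVec (n + 1)).real W := by
  obtain ⟨U, hUm, hU, hUv, hUw⟩ := exists_adapted_coordinates v
  rw [hv, Real.sqrt_one] at hUv
  simp only [hv, Real.sqrt_one, one_mul] at hUw
  have hW' := hW.preimage U hUm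
  have hS : MeasurableSet {x | shrinkV v τ x ∈ W} :=
    hW.meas.preimage (by unfold shrinkV dotProduct; fun_prop : Measurable (shrinkV v τ))
  have key := integral_dilate_ge (measurable_sectionMeasure hW'.meas)
    sectionMeasure_nonneg sectionMeasure_le_one hτ0 hτ1
  have e : ∫ s, sectionMeasure (U ⁻¹' W) (τ * s) ∂gaussianReal 0 1 =
      (gaussVec (n + 1)).real {x | shrinkV v τ x ∈ W} := by
    rw [← hU.measureReal_preimage hS.nullMeasurableSet, ← integral_sectionMeasure (hUm hS)]
    congr 1
    funext s
    simp only [sectionMeasure]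
    congr 1
    ext x
    simp only [mem_ofPred_eq, mem_preimage]
    have : U (τ * s, x) = shrinkV v τ (U (s, x)) := by
      rw [shrinkV, hUw]
      conv_rhs => rw [← hUv]
      rw [← map_smul, ← map_sub]; congr 1; ext <;> simp; ring
    rw [this]
  rwa [e, integral_sectionMeasure hW'.meas,
    hU.measureReal_preimage hW.meas.nullMeasurableSet] at key

/-- The partial sums of the series of `exp (-u)` enclose it. -/
theorem alternating_exp_neg_taylor (N : ℕ) {u : ℝ} (hu : 0 ≤ u) :
    0 ≤ (-1) ^ N * (Real.exp (-u) - ∑ k ∈ Finset.range N, (-u) ^ k / k.factorial) := by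
  induction N generalizing u with
  | zero => simp [Real.exp_nonneg]
  | succ N ih =>
    let g : ℝ → ℝ := fun u => (-1) ^ (N + 1) *
      (Real.exp (-u) - ∑ k ∈ Finset.range (N + 1), (-u) ^ k / k.factorial)
    have hg : ∀ x, HasDerivAt g ((-1) ^ N *
        (Real.exp (-x) - ∑ k ∈ Finset.range N, (-x) ^ k / k.factorial)) x := by
      intro x
      have h1 : HasDerivAt (fun u : ℝ => Real.exp (-u)) (-Real.exp (-x)) x := by
        simpa using (hasDerivAt_neg x).exp
      have h2 : HasDerivAt (fun u : ℝ => ∑ k ∈ Finset.range (N + 1), (-u) ^ k / k.factorial)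
          (-∑ k ∈ Finset.range N, (-x) ^ k / k.factorial) x := by
        have e : (fun u : ℝ => ∑ k ∈ Finset.range (N + 1), (-u) ^ k / k.factorial) =
            fun u : ℝ => (∑ k ∈ Finset.range N, (-u) ^ (k + 1) / (k + 1).factorial) + 1 := by
          funext u; rw [Finset.sum_range_succ']; simp
        rw [e, ← Finset.sum_neg_distrib]
        refine (HasDerivAt.fun_sum fun k _ => ?_).add_const 1
        have := ((hasDerivAt_neg x).pow (k + 1)).div_const ((k + 1).factorial : ℝ)
        refine this.congr_deriv ?_
        rw [Nat.factorial_succ]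
        push_cast
        have : (k.factorial : ℝ) ≠ 0 := by positivity
        field_simp
      refine ((h1.sub h2).const_mul ((-1) ^ (N + 1))).congr_deriv ?_
      ring
    have hmono : MonotoneOn g (Ici 0) := by
      refine monotoneOn_of_deriv_nonneg (convex_Ici 0)
        (fun x _ => (hg x).continuousAt.continuousWithinAt)
        (fun x _ => (hg x).differentiableAt.differentiableWithinAt) fun x hx => ?_
      rw [interior_Ici] at hx
      rw [(hg x).deriv]
      exact ih (le_of_lt hx)
    have := hmono (self_mem_Ici) hu hu
    refine le_trans (le_of_eq ?_) this
    simp [g, Finset.sum_range_succ']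

theorem gaussianPDFReal_ge_poly (s : ℝ) :
    (√(2 * Real.pi))⁻¹ * (1 - s ^ 2 / 2 + s ^ 4 / 8 - s ^ 6 / 48 + s ^ 8 / 384 - s ^ 10 / 3840
      + s ^ 12 / 46080 - s ^ 14 / 645120) ≤ gaussianPDFReal 0 1 s := by
  rw [gaussianPDFReal]
  simp only [NNReal.coe_one, mul_one, sub_zero]
  refine mul_le_mul_of_nonneg_left ?_ (by positivity)
  have := alternating_exp_neg_taylor 8 (u := s ^ 2 / 2) (by positivity)
  rw [neg_div]
  simp only [Finset.sum_range_succ, Finset.sum_range_zero, Nat.factorial] at this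
  norm_num at this
  linarith

theorem gaussianReal_abs_le_ge_poly {r : ℝ} (hr : 0 ≤ r) :
    2 * (√(2 * Real.pi))⁻¹ * r * (1 - r ^ 2 / 6 + r ^ 4 / 40 - r ^ 6 / 336 + r ^ 8 / 3456
      - r ^ 10 / 42240 + r ^ 12 / 599040 - r ^ 14 / 9676800) ≤
      (gaussianReal 0 1).real {s | |s| ≤ r} := by
  have e : {s : ℝ | |s| ≤ r} = Icc (-r) r := by ext s; simp [abs_le]
  rw [e, Measure.real, gaussianReal_apply_eq_integral _ one_ne_zero,
    ENNReal.toReal_ofReal (integral_nonneg fun s => gaussianPDFReal_nonneg _ _ _),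
    integral_Icc_eq_integral_Ioc, ← intervalIntegral.integral_of_le (by linarith)]
  have hmono : ∫ s in (-r)..r, (√(2 * Real.pi))⁻¹ * (1 - s ^ 2 / 2 + s ^ 4 / 8 - s ^ 6 / 48
      + s ^ 8 / 384 - s ^ 10 / 3840 + s ^ 12 / 46080 - s ^ 14 / 645120) ≤
      ∫ s in (-r)..r, gaussianPDFReal 0 1 s := by
    refine intervalIntegral.integral_mono_on (by linarith) ?_
      ((integrable_gaussianPDFReal 0 1).intervalIntegrable) fun s _ => gaussianPDFReal_ge_poly s
    exact (by fun_prop : Continuous fun s : ℝ => (√(2 * Real.pi))⁻¹ * (1 - s ^ 2 / 2 + s ^ 4 / 8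
      - s ^ 6 / 48 + s ^ 8 / 384 - s ^ 10 / 3840 + s ^ 12 / 46080
      - s ^ 14 / 645120)).intervalIntegrable _ _
  refine le_trans (le_of_eq ?_) hmono
  have hF : ∀ s ∈ uIcc (-r) r, HasDerivAt (fun s : ℝ => (√(2 * Real.pi))⁻¹ * (s - s ^ 3 / 6
      + s ^ 5 / 40 - s ^ 7 / 336 + s ^ 9 / 3456 - s ^ 11 / 42240 + s ^ 13 / 599040
      - s ^ 15 / 9676800)) ((√(2 * Real.pi))⁻¹ * (1 - s ^ 2 / 2 + s ^ 4 / 8 - s ^ 6 / 48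
      + s ^ 8 / 384 - s ^ 10 / 3840 + s ^ 12 / 46080 - s ^ 14 / 645120)) s := by
    intro s _
    have hp (k : ℕ) (c : ℝ) := (hasDerivAt_pow (k + 1) s).div_const c
    refine (((((((((hasDerivAt_id s).sub (hp 2 6)).add (hp 4 40)).sub (hp 6 336)).add
      (hp 8 3456)).sub (hp 10 42240)).add (hp 12 599040)).sub (hp 14 9676800)).const_mul
      (√(2 * Real.pi))⁻¹).congr_deriv ?_
    simp only [Nat.add_sub_cancel]
    push_cast
    ring
  rw [intervalIntegral.integral_eq_sub_of_hasDerivAt hF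
    ((by fun_prop : Continuous _).intervalIntegrable _ _)]
  ring

theorem slab_polynomial_nonneg {w : ℝ} (h0 : 0 ≤ w) (h3 : w ≤ 3) :
    3.1416 * w ^ 4 ≤ 2 * (1 - w / 6 + w ^ 2 / 40 - w ^ 3 / 336 + w ^ 4 / 3456 - w ^ 5 / 42240) ^ 2 *
      (w ^ 5 + 0.77 * w ^ 4 + 0.77 ^ 2 / 2 * w ^ 3 + 0.77 ^ 3 / 6 * w ^ 2 + 0.77 ^ 4 / 24 * w
        + 0.77 ^ 5 / 120) := by
  rcases le_total w 1.2 with h | h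
  · have key : ∀ s r : ℝ, 0 ≤ s → 0 ≤ r → 0 ≤
        1691740098125 / 5777633090469888 * r ^ 15 +
        37881795807625 / 5777633090469888 * s ^ 1 * r ^ 14 +
        429804889744615 / 5777633090469888 * s ^ 2 * r ^ 13 +
        3262725382742287 / 5777633090469888 * s ^ 3 * r ^ 12 +
        392936844603857323 / 144440827261747200 * s ^ 4 * r ^ 11 +
        1226636291776773487 / 144440827261747200 * s ^ 5 * r ^ 10 +
        103433247568532292263 / 5777633090469888000 * s ^ 6 * r ^ 9 +
        1264628074998757875509 / 48146942420582400000 * s ^ 7 * r ^ 8 +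
        14667360402457510115849 / 539245755110522880000 * s ^ 8 * r ^ 7 +
        801676786031972162295671 / 40443431633289216000000 * s ^ 9 * r ^ 6 +
        55252564795549817080150537 / 5560971849577267200000000 * s ^ 10 * r ^ 5 +
        25324425886355708529503099 / 7785360589408174080000000 * s ^ 11 * r ^ 4 +
        9810804158794836423333631 / 15570721178816348160000000 * s ^ 12 * r ^ 3 +
        988501258283391032035291 / 15570721178816348160000000 * s ^ 13 * r ^ 2 +
        1534503598465470533557 / 243292518419005440000000 * s ^ 14 * r ^ 1 +
        1081695867683353656077 / 836318032065331200000000 * s ^ 15 := by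
      intro s r hs hr; positivity
    have := key w (1.2 - w) h0 (by linarith)
    rw [← sub_nonneg]
    convert this using 1
    ring
  · have key : ∀ s r : ℝ, 0 ≤ s → 0 ≤ r → 0 ≤
        1081695867683353656077 / 366218556656752176300000000 * r ^ 15 +
        9950875690221159516719 / 111609464885867329920000000 * s ^ 1 * r ^ 14 +
        5586670506660388567869409 / 3703780760656930652160000000 * s ^ 2 * r ^ 13 +
        619557667054311817126230827 / 42858034516173054689280000000 * s ^ 3 * r ^ 12 +
        8555334077905685055605176129 / 100002080537737127608320000000 * s ^ 4 * r ^ 11 +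
        1427933444414829792389137 / 4227631245676792800000000 * s ^ 5 * r ^ 10 +
        8182721962327594915839342157 / 8727454301475240227635200000 * s ^ 6 * r ^ 9 +
        166783337387523914943735061 / 88156104055305456844800000 * s ^ 7 * r ^ 8 +
        1829144715459320948712008353 / 646478096405573350195200000 * s ^ 8 * r ^ 7 +
        689953926162933464175640501 / 218186357536881005690880000 * s ^ 9 * r ^ 6 +
        127477891558521929782735981 / 48359919938910422040576000 * s ^ 10 * r ^ 5 +
        1472053460387878386719461351 / 910241159739047277074841600 * s ^ 11 * r ^ 4 +
        249076917855782636878295731 / 351093018756489664014581760 * s ^ 12 * r ^ 3 +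
        34516005490319205344528431 / 163843408753028509873471488 * s ^ 13 * r ^ 2 +
        592069793000306744150815 / 15604134166955096178425856 * s ^ 14 * r ^ 1 +
        3076292280315150551913425 / 983060452518171059240828928 * s ^ 15 := by
      intro s r hs hr; positivity
    have := key (w - 1.2) (3 - w) (by linarith) (by linarith)
    rw [← sub_nonneg]
    convert this using 1
    ring

theorem exp_ge_quintic {x : ℝ} (hx : 0 ≤ x) :
    1 + x + x ^ 2 / 2 + x ^ 3 / 6 + x ^ 4 / 24 + x ^ 5 / 120 ≤ Real.exp x := by
  have := Real.sum_le_exp_of_nonneg hx 6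
  simp only [Finset.sum_range_succ, Finset.sum_range_zero, Nat.factorial] at this
  norm_num at this
  linarith

theorem gaussianReal_abs_le_mono {r r' : ℝ} (h : r ≤ r') :
    (gaussianReal 0 1).real {s | |s| ≤ r} ≤ (gaussianReal 0 1).real {s | |s| ≤ r'} :=
  measureReal_mono (fun _ hs => le_trans hs h)

theorem gaussianReal_abs_le_ge_sqrt {w : ℝ} (hw : 0 ≤ w) :
    √(2 * w / Real.pi) * (1 - w / 6 + w ^ 2 / 40 - w ^ 3 / 336 + w ^ 4 / 3456 - w ^ 5 / 42240
      + w ^ 6 / 599040 - w ^ 7 / 9676800) ≤ (gaussianReal 0 1).real {s | |s| ≤ √w} := by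
  have h := gaussianReal_abs_le_ge_poly (Real.sqrt_nonneg w)
  have hs : √w ^ 2 = w := Real.sq_sqrt hw
  have e : 2 * (√(2 * Real.pi))⁻¹ * √w = √(2 * w / Real.pi) := by
    have h2 : √2 * √2 = 2 := Real.mul_self_sqrt (by norm_num)
    have : √Real.pi ≠ 0 := (Real.sqrt_pos.mpr Real.pi_pos).ne'
    rw [Real.sqrt_div (by positivity), Real.sqrt_mul (by norm_num), Real.sqrt_mul (by norm_num)]
    field_simp
    linear_combination (-√w) * h2
  have hk (k : ℕ) : √w ^ (2 * k) = w ^ k := by rw [pow_mul, hs]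
  rw [e, hs, hk 2, hk 3, hk 4, hk 5, hk 6, hk 7] at h
  exact h

theorem exp_neg_le_of_exp_ge {x p c : ℝ} (hp : 0 < p) (h : c ≤ Real.exp x) (hpc : 1 ≤ p * c) :
    Real.exp (-x) ≤ p := by
  rw [Real.exp_neg, inv_le_iff_one_le_mul₀ (Real.exp_pos _)]
  exact hpc.trans (mul_le_mul_of_nonneg_left h hp.le)

theorem gaussianReal_abs_gt_le (w : ℝ) :
    1 - 2 * Real.exp (-(w / 2)) ≤ (gaussianReal 0 1).real {s | |s| ≤ √w} := by
  rcases lt_or_ge w 0 with hw | hw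
  · have := Real.one_le_exp (x := -(w / 2)) (by linarith)
    have := measureReal_nonneg (μ := gaussianReal 0 1) (s := {s | |s| ≤ √w})
    linarith
  have hs : √w * √w = w := Real.mul_self_sqrt hw
  have hint (t : ℝ) : Integrable (fun s : ℝ => Real.exp (t * id s)) (gaussianReal 0 1) := by
    simpa using integrable_exp_mul_gaussianReal t
  have h1 := measure_ge_le_exp_mul_mgf (√w) (Real.sqrt_nonneg w) (hint (√w))
  have h2 := measure_le_le_exp_mul_mgf (-√w) (neg_nonpos.mpr (Real.sqrt_nonneg w)) (hint (-√w))
  rw [mgf_id_gaussianReal, ← Real.exp_add] at h1 h2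
  have hm : MeasurableSet {s : ℝ | |s| ≤ √w} := measurableSet_le (by fun_prop) measurable_const
  have h3 := measureReal_union_le (μ := gaussianReal 0 1) {s : ℝ | √w ≤ id s} {s | id s ≤ -√w}
  have h4 : (gaussianReal 0 1).real {s | |s| ≤ √w}ᶜ ≤
      (gaussianReal 0 1).real ({s : ℝ | √w ≤ id s} ∪ {s | id s ≤ -√w}) := by
    refine measureReal_mono fun s hs => ?_
    simp only [mem_compl_iff, mem_ofPred_eq, not_le, lt_abs] at hs
    rcases hs with hs | hs
    · exact Or.inl hs.le
    · exact Or.inr (by simp only [mem_ofPred_eq, id]; linarith)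
  rw [probReal_compl_eq_one_sub hm] at h4
  have e1 : -√w * √w + (0 * √w + ((1 : NNReal) : ℝ) * √w ^ 2 / 2) = -(w / 2) := by
    rw [pow_two, NNReal.coe_one]; linarith
  have e2 : - -√w * -√w + (0 * -√w + ((1 : NNReal) : ℝ) * (-√w) ^ 2 / 2) = -(w / 2) := by
    rw [pow_two, NNReal.coe_one]; linarith
  rw [e1] at h1
  rw [e2] at h2
  linarith

/-- Slab bound for a standard Gaussian variable. -/
theorem exp_neg_le_gaussianReal_sqrt {w : ℝ} (hw : 0 < w) :
    Real.exp (-(0.385 / w)) ≤ (gaussianReal 0 1).real {s | |s| ≤ √w} := by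
  have hpi := Real.pi_pos
  have hpi' := Real.pi_lt_d4
  have far : ∀ w₀ w₁ p : ℝ, 0 < w₀ → w₀ ≤ w → w ≤ w₁ → 0 < w₁ → 0 < p →
      1 ≤ p * (1 + 0.385 / w₁ + (0.385 / w₁) ^ 2 / 2) →
      p ≤ (gaussianReal 0 1).real {s | |s| ≤ √w₀} →
      Real.exp (-(0.385 / w)) ≤ (gaussianReal 0 1).real {s | |s| ≤ √w} := by
    intro w₀ w₁ p h0 h1 h2 hw₁ hp0 hp hpw
    refine le_trans ?_ (hpw.trans (gaussianReal_abs_le_mono (Real.sqrt_le_sqrt h1)))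
    refine le_trans (Real.exp_le_exp.mpr ?_) (exp_neg_le_of_exp_ge hp0
      (Real.quadratic_le_exp_of_nonneg (by positivity)) hp)
    have : 0.385 / w₁ ≤ 0.385 / w := div_le_div_of_nonneg_left (by norm_num) hw h2
    linarith
  rcases le_total w 3 with h3 | h3
  · have h1 := gaussianReal_abs_le_ge_sqrt hw.le
    have hP0 : 0 < 1 - w / 6 + w ^ 2 / 40 - w ^ 3 / 336 + w ^ 4 / 3456 - w ^ 5 / 42240 := by
      nlinarith [pow_pos hw 2, pow_pos hw 3, mul_nonneg (pow_pos hw 2).le (sub_nonneg.mpr h3),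
        mul_nonneg (pow_pos hw 4).le (sub_nonneg.mpr h3)]
    have h2 : √(2 * w / Real.pi) * (1 - w / 6 + w ^ 2 / 40 - w ^ 3 / 336 + w ^ 4 / 3456
        - w ^ 5 / 42240) ≤ (gaussianReal 0 1).real {s | |s| ≤ √w} := by
      refine le_trans (mul_le_mul_of_nonneg_left ?_ (Real.sqrt_nonneg _)) h1
      nlinarith [mul_nonneg (pow_pos hw 6).le (sub_nonneg.mpr h3), pow_pos hw 6]
    refine le_trans (Real.le_sqrt_of_sq_le (y := 2 * w / Real.pi *
      (1 - w / 6 + w ^ 2 / 40 - w ^ 3 / 336 + w ^ 4 / 3456 - w ^ 5 / 42240) ^ 2) ?_)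
      (le_trans (le_of_eq ?_) h2)
    · rw [← Real.exp_nat_mul, show ((2 : ℕ) : ℝ) * -(0.385 / w) = -(0.77 / w) by push_cast; ring]
      refine exp_neg_le_of_exp_ge (by positivity) (exp_ge_quintic (by positivity)) ?_
      have hpoly := slab_polynomial_nonneg hw.le h3
      rw [div_mul_eq_mul_div, div_mul_eq_mul_div, le_div_iff₀ hpi, one_mul]
      refine hpi'.le.trans ?_
      have hw4 : 0 < w ^ 4 := by positivity
      rw [← mul_le_mul_iff_left₀ hw4]
      refine hpoly.trans (le_of_eq ?_)
      field_simp
    · rw [Real.sqrt_mul (by positivity), Real.sqrt_sq hP0.le]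
  have point : ∀ w₀ p s : ℝ, 0 ≤ w₀ → 0 ≤ s → s ^ 2 * 3.1416 ≤ 2 * w₀ →
      0 ≤ 1 - w₀ / 6 + w₀ ^ 2 / 40 - w₀ ^ 3 / 336 + w₀ ^ 4 / 3456 - w₀ ^ 5 / 42240
        + w₀ ^ 6 / 599040 - w₀ ^ 7 / 9676800 →
      p ≤ s * (1 - w₀ / 6 + w₀ ^ 2 / 40 - w₀ ^ 3 / 336 + w₀ ^ 4 / 3456 - w₀ ^ 5 / 42240
        + w₀ ^ 6 / 599040 - w₀ ^ 7 / 9676800) →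
      p ≤ (gaussianReal 0 1).real {s | |s| ≤ √w₀} := by
    intro w₀ p s h0 hs hs2 hP hp
    refine (hp.trans (mul_le_mul_of_nonneg_right ?_ hP)).trans (gaussianReal_abs_le_ge_sqrt h0)
    refine Real.le_sqrt_of_sq_le ?_
    rw [le_div_iff₀ hpi]
    nlinarith [pow_two_nonneg s]
  rcases le_total w 4.2 with h4 | h4
  · exact far 3 4.2 0.9145 (by norm_num) h3 h4 (by norm_num) (by norm_num) (by norm_num)
      (point 3 _ 1.3819 (by norm_num) (by norm_num) (by norm_num) (by norm_num) (by norm_num))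
  rcases le_total w 8 with h8 | h8
  · exact far 4.2 8 0.955 (by norm_num) h4 h8 (by norm_num) (by norm_num) (by norm_num)
      (point 4.2 _ 1.6351 (by norm_num) (by norm_num) (by norm_num) (by norm_num) (by norm_num))
  have htail := gaussianReal_abs_gt_le w
  have hx : 0.385 / w ≤ 1 := by rw [div_le_one hw]; linarith
  have h5 := exp_neg_le_quadratic (u := 0.385 / w) (by positivity)
  have h6 : 2 * Real.exp (-(w / 2)) ≤ 0.385 / w - (0.385 / w) ^ 2 / 2 := by
    rw [Real.exp_neg, ← div_eq_mul_inv, div_le_iff₀ (Real.exp_pos _)]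
    have h7 := exp_ge_quintic (x := w / 2) (by positivity)
    obtain ⟨s, rfl⟩ : ∃ s, w = 8 + s := ⟨w - 8, by ring⟩
    have hs : 0 ≤ s := by linarith
    have h8 : 2 * (8 + s) ≤ 0.3757 * Real.exp ((8 + s) / 2) := by
      refine le_trans ?_ (mul_le_mul_of_nonneg_left h7 (by norm_num))
      nlinarith [pow_nonneg hs 2, pow_nonneg hs 3, pow_nonneg hs 4, pow_nonneg hs 5]
    have h9 : 0.3757 / (8 + s) ≤ 0.385 / (8 + s) - (0.385 / (8 + s)) ^ 2 / 2 := by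
      rw [← sub_nonneg]
      have : 0.385 / (8 + s) - (0.385 / (8 + s)) ^ 2 / 2 - 0.3757 / (8 + s) =
          (0.0093 * (8 + s) - 0.385 ^ 2 / 2) / (8 + s) ^ 2 := by field_simp; ring
      rw [this]
      exact div_nonneg (by linarith) (by positivity)
    refine le_trans ?_ (mul_le_mul_of_nonneg_right h9 (Real.exp_pos _).le)
    rw [div_mul_eq_mul_div, le_div_iff₀ hw]
    exact h8
  linarith

theorem symBody_slab (w : Fin n → ℝ) (T : ℝ) : SymBody {x : Fin n → ℝ | |w ⬝ᵥ x| ≤ T} := by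
  have e : {x : Fin n → ℝ | |w ⬝ᵥ x| ≤ T} = {x | w ⬝ᵥ x ≤ T} ∩ {x | -T ≤ w ⬝ᵥ x} := by
    ext x; simp [abs_le, and_comm]
  have hlin : IsLinearMap ℝ fun x : Fin n → ℝ => w ⬝ᵥ x :=
    ⟨fun x y => dotProduct_add w x y, fun c x => dotProduct_smul c w x⟩
  have hm : Measurable fun x : Fin n → ℝ => w ⬝ᵥ x := by unfold dotProduct; fun_prop
  refine ⟨?_, ?_, fun p hp => by simpa using hp⟩
  · exact measurableSet_le hm.abs measurable_const
  · rw [e]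
    exact (convex_halfSpace_le hlin T).inter (convex_halfSpace_ge hlin (-T))

theorem gaussVec_inter_slabs_ge {ι : Type*} (I : Finset ι) (w : ι → Fin (n + 1) → ℝ) {T : ℝ}
    (hT : 0 < T) {K : Set (Fin (n + 1) → ℝ)} (hK : SymBody K) :
    (gaussVec (n + 1)).real K * Real.exp (-(0.385 * ((∑ i ∈ I, w i ⬝ᵥ w i) / T ^ 2))) ≤
      (gaussVec (n + 1)).real (K ∩ {x | ∀ i ∈ I, |w i ⬝ᵥ x| ≤ T}) ∧
    SymBody (K ∩ {x | ∀ i ∈ I, |w i ⬝ᵥ x| ≤ T}) := by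
  classical
  induction I using Finset.induction_on with
  | empty => simpa using hK
  | insert j I hj ih =>
    obtain ⟨ih, hs⟩ := ih
    have e : K ∩ {x | ∀ i ∈ insert j I, |w i ⬝ᵥ x| ≤ T} =
        (K ∩ {x | ∀ i ∈ I, |w i ⬝ᵥ x| ≤ T}) ∩ {x | |w j ⬝ᵥ x| ≤ T} := by
      ext x; simp only [Finset.forall_mem_insert, mem_inter_iff, mem_ofPred_eq]; tauto
    rw [e]
    refine ⟨?_, hs.inter (symBody_slab _ _)⟩
    rw [Finset.sum_insert hj]
    by_cases h0 : w j = 0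
    · have : (K ∩ {x | ∀ i ∈ I, |w i ⬝ᵥ x| ≤ T}) ∩ {x | |w j ⬝ᵥ x| ≤ T} =
          K ∩ {x | ∀ i ∈ I, |w i ⬝ᵥ x| ≤ T} := by
        ext x; simp [h0, hT.le]
      rw [this]
      simpa [h0] using ih
    · refine le_trans ?_ (gaussVec_inter_slab_ge hs (w j) hT.le h0)
      have hpos : 0 < w j ⬝ᵥ w j := lt_of_le_of_ne (dotProduct_self_nonneg' _)
        fun h => h0 (dotProduct_self_eq_zero.mp h.symm)
      have hslab := exp_neg_le_gaussianReal_sqrt (w := T ^ 2 / (w j ⬝ᵥ w j)) (by positivity)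
      rw [Real.sqrt_div (by positivity), Real.sqrt_sq hT.le] at hslab
      refine le_trans (le_of_eq ?_) (mul_le_mul hslab ih (by positivity) measureReal_nonneg)
      rw [mul_left_comm, ← Real.exp_add]
      congr 2
      field_simp
      ring

theorem integrable_exp_neg_mul_abs {b : ℝ} (hb : 0 < b) :
    Integrable fun x : ℝ => Real.exp (-(b * |x|)) := by
  have h1 : IntegrableOn (fun x : ℝ => Real.exp (-(b * |x|))) (Ioi 0) :=
    (integrableOn_exp_mul_Ioi (neg_lt_zero.mpr hb) 0).congr_fun
      (fun x hx => by rw [abs_of_pos hx]; ring_nf) measurableSet_Ioi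
  have h2 : IntegrableOn (fun x : ℝ => Real.exp (-(b * |x|))) (Iic 0) :=
    (integrableOn_exp_mul_Iic hb 0).congr_fun
      (fun x hx => by rw [abs_of_nonpos hx]; ring_nf) measurableSet_Iic
  rw [← integrableOn_univ, ← Iic_union_Ioi (a := (0 : ℝ))]
  exact h2.union h1

theorem integrable_abs_mul_exp_neg_mul_abs {b : ℝ} (hb : 0 < b) :
    Integrable fun x : ℝ => |x| * Real.exp (-(b * |x|)) := by
  refine ((integrable_exp_neg_mul_abs (half_pos hb)).const_mul (2 / b)).mono'
    (by fun_prop) (Filter.Eventually.of_forall fun x => ?_)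
  rw [Real.norm_of_nonneg (by positivity)]
  have h1 : |x| ≤ 2 / b * Real.exp (b / 2 * |x|) := by
    have := Real.add_one_le_exp (b / 2 * |x|)
    rw [div_mul_eq_mul_div, le_div_iff₀ hb]
    linarith
  calc |x| * Real.exp (-(b * |x|))
      ≤ 2 / b * Real.exp (b / 2 * |x|) * Real.exp (-(b * |x|)) := by gcongr
    _ = 2 / b * Real.exp (-(b / 2 * |x|)) := by
      rw [mul_assoc, ← Real.exp_add]; ring_nf

theorem integral_exp_neg_abs : ∫ x : ℝ, Real.exp (-|x|) / 2 = 1 := by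
  rw [integral_comp_abs (f := fun x => Real.exp (-x) / 2), integral_div,
    integral_exp_neg_Ioi_zero]
  norm_num

instance : IsProbabilityMeasure symExp := by
  refine ⟨?_⟩
  have hi : Integrable fun x : ℝ => Real.exp (-|x|) / 2 := by
    simpa using (integrable_exp_neg_mul_abs one_pos).div_const 2
  rw [symExp, withDensity_apply _ MeasurableSet.univ, Measure.restrict_univ,
    ← ofReal_integral_eq_lintegral_ofReal hi (Filter.Eventually.of_forall fun x => by positivity),
    integral_exp_neg_abs, ENNReal.ofReal_one]

instance (n : ℕ) : IsProbabilityMeasure (expVec n) := by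
  unfold expVec; infer_instance

theorem measurable_symExp_density :
    Measurable fun x : ℝ => ENNReal.ofReal (Real.exp (-|x|) / 2) := by fun_prop

theorem integrable_symExp_iff {g : ℝ → ℝ} :
    Integrable g symExp ↔ Integrable fun x => Real.exp (-|x|) / 2 * g x := by
  rw [symExp, integrable_withDensity_iff_integrable_smul' measurable_symExp_density
    (Filter.Eventually.of_forall fun x => ENNReal.ofReal_lt_top)]
  refine integrable_congr (Filter.Eventually.of_forall fun x => ?_)
  simp only [smul_eq_mul]
  rw [ENNReal.toReal_ofReal (by positivity)]

theorem integral_symExp (g : ℝ → ℝ) :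
    ∫ x, g x ∂symExp = ∫ x, Real.exp (-|x|) / 2 * g x := by
  rw [symExp, integral_withDensity_eq_integral_toReal_smul measurable_symExp_density
    (Filter.Eventually.of_forall fun x => ENNReal.ofReal_lt_top)]
  refine integral_congr_ae (Filter.Eventually.of_forall fun x => ?_)
  simp only [smul_eq_mul]
  rw [ENNReal.toReal_ofReal (by positivity)]

theorem integrable_abs_symExp : Integrable (fun x : ℝ => |x|) symExp := by
  rw [integrable_symExp_iff]
  refine ((integrable_abs_mul_exp_neg_mul_abs one_pos).div_const 2).congr
    (Filter.Eventually.of_forall fun x => ?_)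
  simp only [one_mul]
  ring

theorem integrable_abs_gaussianReal : Integrable (fun x : ℝ => |x|) (gaussianReal 0 1) := by
  simpa using ((memLp_id_gaussianReal (μ := 0) (v := 1) 1).integrable le_rfl).abs

theorem measurePreserving_neg_symExp : MeasurePreserving (fun x : ℝ => -x) symExp symExp := by
  refine ⟨measurable_neg, Measure.ext fun s hs => ?_⟩
  rw [Measure.map_apply measurable_neg hs, symExp, withDensity_apply _ (measurable_neg hs),
    withDensity_apply _ hs]
  have := (Measure.measurePreserving_neg (volume : Measure ℝ)).setLIntegral_comp_preimage hs
    measurable_symExp_density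
  simpa using this

/-- Even convex functions of at most linear growth. -/
structure EvenConvex {E : Type*} [NormedAddCommGroup E] [NormedSpace ℝ E] (F : E → ℝ) : Prop where
  conv : ConvexOn ℝ univ F
  even : ∀ x, F (-x) = F x
  growth : ∃ A B : ℝ, ∀ x, |F x| ≤ A + B * ‖x‖

theorem EvenConvex.continuous {E : Type*} [NormedAddCommGroup E] [NormedSpace ℝ E]
    [FiniteDimensional ℝ E] {F : E → ℝ} (hF : EvenConvex F) : Continuous F :=
  continuousOn_univ.mp (hF.conv.continuousOn isOpen_univ)

theorem EvenConvex.integrable {E : Type*} [NormedAddCommGroup E] [NormedSpace ℝ E]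
    [FiniteDimensional ℝ E] [MeasurableSpace E] [BorelSpace E] {F : E → ℝ} (hF : EvenConvex F)
    {μ : Measure E} [IsFiniteMeasure μ] (hμ : Integrable (fun x => ‖x‖) μ) : Integrable F μ := by
  obtain ⟨A, B, hAB⟩ := hF.growth
  exact ((integrable_const A).add (hμ.const_mul B)).mono' hF.continuous.aestronglyMeasurable
    (Filter.Eventually.of_forall hAB)

theorem EvenConvex.le_of_abs_le {g : ℝ → ℝ} (hg : EvenConvex g) {s r : ℝ} (h : |s| ≤ |r|) :
    g s ≤ g r := by
  have h1 : g (-|r|) = g |r| := hg.even _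
  have h2 : g |r| = g r := by
    rcases abs_choice r with h | h <;> rw [h]
    exact hg.even r
  have := hg.conv.le_max_of_mem_Icc (mem_univ (-|r|)) (mem_univ |r|) (abs_le.mp h)
  rwa [h1, max_self, h2] at this

theorem exists_density_crossing : ∃ r : ℝ, 0 ≤ r ∧
    (∀ s, |s| ≤ r → Real.exp (-(1 / 2 * |s|)) / 4 ≤ gaussianPDFReal 0 1 s) ∧
    ∀ s, r ≤ |s| → gaussianPDFReal 0 1 s ≤ Real.exp (-(1 / 2 * |s|)) / 4 := by
  have hpi := Real.pi_pos
  have hs : 0 < √(2 * Real.pi) := by positivity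
  have hs4 : √(2 * Real.pi) ≤ 4 := by
    rw [Real.sqrt_le_left (by norm_num)]
    linarith [Real.pi_lt_d2]
  set L := Real.log (4 / √(2 * Real.pi)) with hL
  have hL0 : 0 ≤ L := Real.log_nonneg (by rw [le_div_iff₀ hs]; linarith)
  have hpdf : ∀ s : ℝ, gaussianPDFReal 0 1 s = Real.exp (L - s ^ 2 / 2) / 4 := by
    intro s
    rw [gaussianPDFReal, Real.exp_sub, hL, Real.exp_log (by positivity)]
    simp only [NNReal.coe_one, mul_one, sub_zero, neg_div]
    rw [Real.exp_neg]
    field_simp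
  set D := √(1 + 8 * L)
  have hD : D ^ 2 = 1 + 8 * L := Real.sq_sqrt (by linarith)
  have hD1 : 1 ≤ D := Real.one_le_sqrt.mpr (by linarith)
  refine ⟨(1 + D) / 2, by linarith, fun s h => ?_, fun s h => ?_⟩
  · rw [hpdf]
    gcongr
    rw [← sq_abs s]
    nlinarith [abs_nonneg s]
  · rw [hpdf]
    gcongr
    rw [← sq_abs s]
    nlinarith [abs_nonneg s]

theorem integral_gaussianReal_le_symExp {g : ℝ → ℝ} (hg : EvenConvex g) :
    ∫ s, g s ∂gaussianReal 0 1 ≤ ∫ s, g (2 * s) ∂symExp := by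
  obtain ⟨r, hr0, hin, hout⟩ := exists_density_crossing
  set q : ℝ → ℝ := fun s => Real.exp (-(1 / 2 * |s|)) / 4 with hq
  have hconv : ∀ f : ℝ → ℝ, ∫ s, f (2 * s) ∂symExp = ∫ s, q s * f s := by
    intro f
    have h := Measure.integral_comp_mul_left (fun s => q s * f s) 2
    rw [integral_symExp]
    have e : ∀ s : ℝ, Real.exp (-|s|) / 2 * f (2 * s) = 2 * (q (2 * s) * f (2 * s)) := by
      intro s
      simp only [hq, abs_mul, abs_two]
      ring_nf
    simp_rw [e]
    rw [integral_const_mul, h, abs_of_pos (by norm_num), smul_eq_mul]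
    ring
  have hq1 : ∫ s, q s = 1 := by
    have := hconv fun _ => 1
    simpa using this.symm
  have hqi : Integrable q := (integrable_exp_neg_mul_abs (by norm_num)).div_const 4
  have hqg : Integrable fun s => q s * g s := by
    obtain ⟨A, B, hAB⟩ := hg.growth
    refine ((hqi.const_mul A).add (((integrable_abs_mul_exp_neg_mul_abs
      (b := 1 / 2) (by norm_num)).div_const 4).const_mul B)).mono'
      ((by fun_prop : Continuous q).mul hg.continuous).aestronglyMeasurable
      (Filter.Eventually.of_forall fun s => ?_)
    have hq0 : 0 ≤ q s := by positivity
    rw [norm_mul, Real.norm_of_nonneg hq0]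
    refine (mul_le_mul_of_nonneg_left (hAB s) hq0).trans (le_of_eq ?_)
    simp only [hq, Pi.add_apply, Real.norm_eq_abs]
    ring
  have hpi := integrable_gaussianPDFReal 0 1
  have hpg : Integrable fun s => gaussianPDFReal 0 1 s * g s := by
    have h := hg.integrable (μ := gaussianReal 0 1)
      (by simpa using integrable_abs_gaussianReal)
    rw [gaussianReal_of_var_ne_zero _ one_ne_zero,
      integrable_withDensity_iff_integrable_smul' (measurable_gaussianPDF 0 1)
        (Filter.Eventually.of_forall fun x => gaussianPDF_lt_top)] at h
    simpa [toReal_gaussianPDF] using h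
  rw [hconv, integral_gaussianReal_eq_integral_smul one_ne_zero]
  simp only [smul_eq_mul]
  have hneg : ∫ s, (gaussianPDFReal 0 1 s - q s) * (g s - g r) ≤ 0 := by
    refine integral_nonpos fun s => ?_
    rcases le_total |s| r with h | h
    · exact mul_nonpos_of_nonneg_of_nonpos (sub_nonneg.mpr (hin s h))
        (sub_nonpos.mpr (hg.le_of_abs_le (by rwa [abs_of_nonneg hr0])))
    · exact mul_nonpos_of_nonpos_of_nonneg (sub_nonpos.mpr (hout s h))
        (sub_nonneg.mpr (hg.le_of_abs_le (by rwa [abs_of_nonneg hr0])))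
  have e : (fun s => (gaussianPDFReal 0 1 s - q s) * (g s - g r)) = fun s =>
      (gaussianPDFReal 0 1 s * g s - q s * g s) - (gaussianPDFReal 0 1 s - q s) * g r := by
    funext s; ring
  have hA : Integrable fun s => gaussianPDFReal 0 1 s * g s - q s * g s := hpg.sub hqg
  have hB : Integrable fun s => (gaussianPDFReal 0 1 s - q s) * g r := (hpi.sub hqi).mul_const _
  rw [e, integral_sub hA hB, integral_sub hpg hqg, integral_mul_const, integral_sub hpi hqi, hq1,
    integral_gaussianPDFReal_eq_one 0 one_ne_zero] at hneg
  linarith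

theorem EvenConvex.comp_linear {E G : Type*} [NormedAddCommGroup E] [NormedSpace ℝ E]
    [FiniteDimensional ℝ E] [NormedAddCommGroup G] [NormedSpace ℝ G] {F : G → ℝ}
    (hF : EvenConvex F) (T : E →ₗ[ℝ] G) : EvenConvex fun x => F (T x) := by
  obtain ⟨A, B, hAB⟩ := hF.growth
  refine ⟨by simpa [Function.comp_def] using hF.conv.comp_linearMap T,
    fun x => by rw [map_neg, hF.even],
    A, |B| * ‖LinearMap.toContinuousLinearMap T‖, fun x => (hAB _).trans ?_⟩
  have h1 : ‖T x‖ ≤ ‖LinearMap.toContinuousLinearMap T‖ * ‖x‖ :=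
    (LinearMap.toContinuousLinearMap T).le_opNorm x
  have h2 : B * ‖T x‖ ≤ |B| * ‖T x‖ := mul_le_mul_of_nonneg_right (le_abs_self B) (norm_nonneg _)
  have h3 := mul_le_mul_of_nonneg_left h1 (abs_nonneg B)
  linarith

theorem EvenConvex.integral_right {E G : Type*} [NormedAddCommGroup E] [NormedSpace ℝ E]
    [NormedAddCommGroup G] [NormedSpace ℝ G] [FiniteDimensional ℝ E]
    [FiniteDimensional ℝ G] [MeasurableSpace G] [BorelSpace G] {F : E × G → ℝ} (hF : EvenConvex F)
    {μ : Measure G} [IsProbabilityMeasure μ] (hμ : Integrable (fun x => ‖x‖) μ)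
    (hneg : MeasurePreserving (fun x : G => -x) μ μ) :
    EvenConvex fun s => ∫ x, F (s, x) ∂μ := by
  obtain ⟨A, B, hAB⟩ := hF.growth
  have hb : ∀ s x, |F (s, x)| ≤ (A + |B| * ‖s‖) + |B| * ‖x‖ := by
    intro s x
    have h1 : B * ‖(s, x)‖ ≤ |B| * ‖(s, x)‖ :=
      mul_le_mul_of_nonneg_right (le_abs_self B) (norm_nonneg _)
    have h2 : ‖(s, x)‖ ≤ ‖s‖ + ‖x‖ := by
      rw [Prod.norm_mk]
      exact max_le_add_of_nonneg (norm_nonneg _) (norm_nonneg _)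
    have h3 := mul_le_mul_of_nonneg_left h2 (abs_nonneg B)
    linarith [hAB (s, x)]
  have hbi : ∀ s : E, Integrable (fun x : G => (A + |B| * ‖s‖) + |B| * ‖x‖) μ := fun s =>
    (integrable_const _).add (hμ.const_mul _)
  have hint : ∀ s, Integrable (fun x => F (s, x)) μ := fun s =>
    (hbi s).mono' (hF.continuous.comp (Continuous.prodMk_right s)).aestronglyMeasurable
      (Filter.Eventually.of_forall (hb s))
  refine ⟨⟨convex_univ, fun s _ r _ a b ha hb hab => ?_⟩, fun s => ?_,
    A + |B| * ∫ x : G, ‖x‖ ∂μ, |B|, fun s => ?_⟩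
  · simp only [smul_eq_mul]
    rw [← integral_const_mul, ← integral_const_mul,
      ← integral_add ((hint s).const_mul a) ((hint r).const_mul b)]
    refine integral_mono (hint _) (((hint s).const_mul a).add ((hint r).const_mul b)) fun x => ?_
    have := hF.conv.2 (mem_univ (s, x)) (mem_univ (r, x)) ha hb hab
    simpa [← add_smul, hab] using this
  · rw [← hneg.integral_comp (MeasurableEquiv.neg G).measurableEmbedding]
    refine integral_congr_ae (Filter.Eventually.of_forall fun x => ?_)
    exact hF.even (s, x)
  · have h := norm_integral_le_of_norm_le (f := fun x => F (s, x)) (hbi s)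
      (Filter.Eventually.of_forall (hb s))
    refine h.trans (le_of_eq ?_)
    rw [integral_add (integrable_const _) (hμ.const_mul _), integral_const_mul]
    simp
    ring

theorem integrable_norm_pi {n : ℕ} {ν : Measure ℝ} [IsProbabilityMeasure ν]
    (hν : Integrable (fun s => |s|) ν) :
    Integrable (fun x : Fin n → ℝ => ‖x‖) (Measure.pi fun _ => ν) := by
  refine (integrable_finsetSum Finset.univ fun i _ =>
    integrable_comp_eval (μ := fun _ : Fin n => ν) (i := i) hν).mono'
    continuous_norm.aestronglyMeasurable (Filter.Eventually.of_forall fun x => ?_)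
  rw [norm_norm]
  exact (pi_norm_le_iff_of_nonneg (Finset.sum_nonneg fun i _ => abs_nonneg _)).mpr fun i =>
    Finset.single_le_sum (f := fun i => |x i|) (fun i _ => abs_nonneg _) (Finset.mem_univ i)

theorem integrable_norm_gaussVec (n : ℕ) : Integrable (fun x : Fin n → ℝ => ‖x‖) (gaussVec n) :=
  integrable_norm_pi integrable_abs_gaussianReal

theorem integrable_norm_expVec (n : ℕ) : Integrable (fun x : Fin n → ℝ => ‖x‖) (expVec n) :=
  integrable_norm_pi integrable_abs_symExp

theorem expVec_succ (n : ℕ) : expVec (n + 1) =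
    (symExp.prod (expVec n)).map (fun p => (Fin.cons p.1 p.2 : Fin (n + 1) → ℝ)) := by
  have := (measurePreserving_piFinSuccAbove (fun _ : Fin (n + 1) => symExp) 0).symm
  rw [expVec, expVec, ← this.map_eq]
  congr 1
  funext p
  exact Fin.insertNth_zero' p.1 p.2

/-- The linear map prepending a coordinate. -/
def consLinear (n : ℕ) : (ℝ × (Fin n → ℝ)) →ₗ[ℝ] (Fin (n + 1) → ℝ) where
  toFun p := Fin.cons p.1 p.2
  map_add' p q := by ext i; refine Fin.cases ?_ (fun j => ?_) i <;> simp
  map_smul' c p := by ext i; refine Fin.cases ?_ (fun j => ?_) i <;> simp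

theorem integrable_norm_prod {E G : Type*} [NormedAddCommGroup E] [NormedAddCommGroup G]
    [MeasurableSpace E] [MeasurableSpace G] [BorelSpace E] [BorelSpace G]
    [SecondCountableTopology E] [SecondCountableTopology G] {μ : Measure E}
    {ν : Measure G} [IsProbabilityMeasure μ] [IsProbabilityMeasure ν]
    (hμ : Integrable (fun x => ‖x‖) μ) (hν : Integrable (fun x => ‖x‖) ν) :
    Integrable (fun p : E × G => ‖p‖) (μ.prod ν) := by
  refine ((hμ.comp_fst ν).add (hν.comp_snd μ)).mono'
    continuous_norm.aestronglyMeasurable (Filter.Eventually.of_forall fun p => ?_)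
  rw [norm_norm, Prod.norm_def]
  exact max_le_add_of_nonneg (norm_nonneg _) (norm_nonneg _)

theorem integral_gaussVec_le_expVec {n : ℕ} {F : (Fin n → ℝ) → ℝ} (hF : EvenConvex F) :
    ∫ x, F x ∂gaussVec n ≤ ∫ x, F ((2 : ℝ) • x) ∂expVec n := by
  induction n with
  | zero =>
    have h : ∀ x : Fin 0 → ℝ, F ((2 : ℝ) • x) = F x := fun x => by
      rw [Subsingleton.elim ((2 : ℝ) • x) x]
    simp_rw [h]
    rw [gaussVec, expVec, Measure.pi_of_empty _ 0, Measure.pi_of_empty _ 0]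
  | succ n ih =>
    have hF' : EvenConvex fun p => F (consLinear n p) := hF.comp_linear _
    have hn1 : Integrable (fun x : ℝ => ‖x‖) (gaussianReal 0 1) := by
      simpa using integrable_abs_gaussianReal
    have hn2 : Integrable (fun x : ℝ => ‖x‖) symExp := by simpa using integrable_abs_symExp
    have hg := hF'.integral_right (integrable_norm_gaussVec n) (measurePreserving_neg_gaussVec n)
    let D : (ℝ × (Fin n → ℝ)) →ₗ[ℝ] (ℝ × (Fin n → ℝ)) :=
      LinearMap.prodMap ((2 : ℝ) • LinearMap.id) LinearMap.id
    let S : ((Fin n → ℝ) × ℝ) →ₗ[ℝ] (ℝ × (Fin n → ℝ)) :=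
      (LinearEquiv.prodComm ℝ (Fin n → ℝ) ℝ).toLinearMap
    have hh := (hF'.comp_linear (D ∘ₗ S)).integral_right hn2 measurePreserving_neg_symExp
    have hm := (measurable_finCons n).aemeasurable (μ := (gaussianReal 0 1).prod (gaussVec n))
    have hm' := (measurable_finCons n).aemeasurable (μ := symExp.prod (expVec n))
    have hi1 := hF'.integrable (integrable_norm_prod hn1 (integrable_norm_gaussVec n))
    have hi2 := (hF'.comp_linear D).integrable
      (integrable_norm_prod hn2 (integrable_norm_gaussVec n))
    have hi3 := (hF'.comp_linear ((2 : ℝ) • LinearMap.id)).integrable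
      (integrable_norm_prod hn2 (integrable_norm_expVec n))
    calc ∫ x, F x ∂gaussVec (n + 1)
        = ∫ p, F (consLinear n p) ∂(gaussianReal 0 1).prod (gaussVec n) := by
          rw [gaussVec_succ, integral_map hm hF.continuous.aestronglyMeasurable]
          rfl
      _ = ∫ s, ∫ x, F (consLinear n (s, x)) ∂gaussVec n ∂gaussianReal 0 1 := integral_prod _ hi1
      _ ≤ ∫ s, ∫ x, F (consLinear n (2 * s, x)) ∂gaussVec n ∂symExp :=
          integral_gaussianReal_le_symExp hg
      _ = ∫ x, ∫ s, F (consLinear n (2 * s, x)) ∂symExp ∂gaussVec n := integral_integral_swap hi2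
      _ ≤ ∫ x, ∫ s, F (consLinear n (2 * s, (2 : ℝ) • x)) ∂symExp ∂expVec n := ih hh
      _ = ∫ s, ∫ x, F (consLinear n (2 * s, (2 : ℝ) • x)) ∂expVec n ∂symExp :=
          (integral_integral_swap hi3).symm
      _ = ∫ p, F (consLinear n ((2 : ℝ) • p)) ∂symExp.prod (expVec n) :=
          (integral_prod _ hi3).symm
      _ = ∫ x, F ((2 : ℝ) • x) ∂expVec (n + 1) := by
          have hc : Continuous fun x => F ((2 : ℝ) • x) := hF.continuous.comp (by fun_prop)
          rw [expVec_succ, integral_map hm' hc.aestronglyMeasurable]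
          refine integral_congr_ae (Filter.Eventually.of_forall fun p => ?_)
          simp only [map_smul]
          rfl

theorem evenConvex_seminorm {n : ℕ} (N : Seminorm ℝ (Fin n → ℝ)) : EvenConvex N := by
  refine ⟨N.convexOn, map_neg_eq_map N, 0, ∑ i, N (Pi.single i 1), fun x => ?_⟩
  rw [abs_of_nonneg (apply_nonneg N x), zero_add, Finset.sum_mul]
  calc N x = N (∑ i, x i • Pi.single i (1 : ℝ)) := by
        rw [← pi_eq_sum_univ' x]
    _ ≤ ∑ i, N (x i • Pi.single i (1 : ℝ)) :=
        Finset.le_sum_of_subadditive N (map_zero N).le (map_add_le_add N) _ _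
    _ ≤ _ := by
      refine Finset.sum_le_sum fun i _ => ?_
      rw [map_smul_eq_mul, mul_comm]
      exact mul_le_mul_of_nonneg_left (norm_le_pi_norm x i) (apply_nonneg N _)

theorem integral_seminorm_gaussVec_le {n : ℕ} (N : Seminorm ℝ (Fin n → ℝ)) :
    ∫ x, N x ∂gaussVec n ≤ 2 * ∫ x, N x ∂expVec n := by
  refine (integral_gaussVec_le_expVec (evenConvex_seminorm N)).trans (le_of_eq ?_)
  rw [← integral_const_mul]
  simp [map_smul_eq_mul]

theorem integrable_seminorm_gaussVec (N : Seminorm ℝ (Fin n → ℝ)) : Integrable N (gaussVec n) :=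
  (evenConvex_seminorm N).integrable (integrable_norm_gaussVec n)

theorem symBody_seminorm (N : Seminorm ℝ (Fin n → ℝ)) (R : ℝ) : SymBody {x | N x ≤ R} := by
  refine ⟨measurableSet_le (evenConvex_seminorm N).continuous.measurable measurable_const, ?_,
    fun p hp => by simpa using hp⟩
  simpa using N.convexOn.convex_le R

/-- Markov's inequality. -/
theorem gaussVec_seminorm_le_ge (N : Seminorm ℝ (Fin n → ℝ)) {J η : ℝ} (hη : 0 < η) (hJ0 : 0 ≤ J)
    (hJ : ∫ x, N x ∂gaussVec n ≤ 2 * J) :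
    1 - η ≤ (gaussVec n).real {x | N x ≤ 2 / η * J} := by
  have hi := integrable_seminorm_gaussVec N
  have hc : {x | N x ≤ 2 / η * J}ᶜ = {x | 2 / η * J < N x} := by ext; simp
  have hm := (symBody_seminorm N (2 / η * J)).meas
  suffices h : (gaussVec n).real {x | 2 / η * J < N x} ≤ η by
    rw [← hc, probReal_compl_eq_one_sub hm] at h
    linarith
  have hnn : 0 ≤ᵐ[gaussVec n] N := Filter.Eventually.of_forall fun x => apply_nonneg N x
  rcases hJ0.eq_or_lt with h0 | h0
  · rw [← h0, mul_zero] at hJ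
    have h1 := (integral_eq_zero_iff_of_nonneg_ae hnn hi).mp
      (le_antisymm hJ (integral_nonneg fun x => apply_nonneg N x))
    have h2 : (gaussVec n) {x | 2 / η * J < N x} = 0 := by
      rw [← h0, mul_zero]
      refine measure_mono_null (fun x hx => ?_) (ae_iff.mp h1)
      exact ne_of_gt hx
    rw [Measure.real, h2]
    simpa using hη.le
  · have h1 := mul_meas_ge_le_integral_of_nonneg hnn hi (2 / η * J)
    have h2 : (gaussVec n).real {x | 2 / η * J < N x} ≤ (gaussVec n).real {x | 2 / η * J ≤ N x} :=
      measureReal_mono (ofPred_subset_ofPred.mpr fun x hx => hx.le)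
    have h3 : 2 / η * J * (gaussVec n).real {x | 2 / η * J ≤ N x} ≤ 2 / η * J * η := by
      rw [show 2 / η * J * η = 2 * J by field_simp]
      exact h1.trans hJ
    exact h2.trans (le_of_mul_le_mul_left h3 (by positivity))

/-- `shrinkV` as a linear map. -/
def shrinkL (v : Fin n → ℝ) (τ : ℝ) : (Fin n → ℝ) →ₗ[ℝ] (Fin n → ℝ) where
  toFun := shrinkV v τ
  map_add' x y := by simp only [shrinkV, dotProduct_add]; module
  map_smul' c x := by simp only [shrinkV, dotProduct_smul, smul_eq_mul, RingHom.id_apply]; module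

theorem integral_seminorm_shrink_le (N : Seminorm ℝ (Fin n → ℝ)) {v : Fin n → ℝ} (hv : v ⬝ᵥ v = 1)
    {τ : ℝ} (hτ0 : 0 ≤ τ) (hτ1 : τ ≤ 1) :
    ∫ x, N (shrinkV v τ x) ∂gaussVec n ≤ ∫ x, N x ∂gaussVec n := by
  have hr := measurePreserving_reflectV v
  have hi := integrable_seminorm_gaussVec N
  have hi2 : Integrable (fun x => N (reflectV v x)) (gaussVec n) :=
    integrable_seminorm_gaussVec (N.comp (reflectV v))
  have hi3 := integrable_seminorm_gaussVec (N.comp (shrinkL v τ))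
  have he : ∫ x, N (reflectV v x) ∂gaussVec n = ∫ x, N x ∂gaussVec n := by
    have h := integral_map (μ := gaussVec n) hr.measurable.aemeasurable (f := N)
      (evenConvex_seminorm N).continuous.aestronglyMeasurable
    rw [hr.map_eq] at h
    exact h.symm
  calc ∫ x, N (shrinkV v τ x) ∂gaussVec n
      ≤ ∫ x, ((1 + τ) / 2 * N x + (1 - τ) / 2 * N (reflectV v x)) ∂gaussVec n := by
        refine integral_mono hi3 ((hi.const_mul _).add (hi2.const_mul _)) fun x => ?_
        have h1 : shrinkV v τ x = ((1 + τ) / 2) • x + ((1 - τ) / 2) • reflectV v x := by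
          rw [shrinkV, reflectV_apply, hv]; module
        rw [h1]
        refine (map_add_le_add N _ _).trans (le_of_eq ?_)
        rw [map_smul_eq_mul, map_smul_eq_mul, Real.norm_of_nonneg (by linarith),
          Real.norm_of_nonneg (by linarith)]
    _ = (1 + τ) / 2 * ∫ x, N x ∂gaussVec n + (1 - τ) / 2 * ∫ x, N (reflectV v x) ∂gaussVec n := by
        rw [integral_add (hi.const_mul _) (hi2.const_mul _), integral_const_mul,
          integral_const_mul]
    _ = ∫ x, N x ∂gaussVec n := by rw [he]; ring

theorem gaussVec_seminorm_ge (N : Seminorm ℝ (Fin n → ℝ)) {η : ℝ} (hη : 0 < η) :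
    1 - η ≤ (gaussVec n).real {x | N x ≤ 2 / η * ∫ e, N e ∂expVec n} :=
  gaussVec_seminorm_le_ge N hη (integral_nonneg fun x => apply_nonneg N x)
    (integral_seminorm_gaussVec_le N)

theorem gaussVec_seminorm_shrink_ge (N : Seminorm ℝ (Fin n → ℝ)) {η : ℝ} (hη : 0 < η)
    {v : Fin n → ℝ} (hv : v ⬝ᵥ v = 1) {τ : ℝ} (hτ0 : 0 ≤ τ) (hτ1 : τ ≤ 1) :
    1 - η ≤ (gaussVec n).real {x | N (shrinkV v τ x) ≤ 2 / η * ∫ e, N e ∂expVec n} :=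
  gaussVec_seminorm_le_ge (N.comp (shrinkL v τ)) hη (integral_nonneg fun x => apply_nonneg N x)
    ((integral_seminorm_shrink_le N hv hτ0 hτ1).trans (integral_seminorm_gaussVec_le N))

theorem integral_rpow_mul_exp_neg_half_sq {q : ℝ} (hq : -1 < q) :
    ∫ x in Ioi (0 : ℝ), x ^ q * Real.exp (-(x ^ 2 / 2)) =
      (2 : ℝ) ^ ((q + 1) / 2) * (1 / 2) * Real.Gamma ((q + 1) / 2) := by
  have h := integral_rpow_mul_exp_neg_mul_rpow (p := 2) (q := q) (b := 1 / 2)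
    (by norm_num) hq (by norm_num)
  have e : (1 / 2 : ℝ) ^ (-(q + 1) / 2) = 2 ^ ((q + 1) / 2) := by
    rw [one_div, Real.inv_rpow (by norm_num), ← Real.rpow_neg (by norm_num)]
    congr 1; ring
  rw [e] at h
  rw [← h]
  refine setIntegral_congr_fun measurableSet_Ioi fun x _ => ?_
  simp only [Real.rpow_two]
  ring_nf

theorem integral_abs_gaussianReal :
    ∫ s, |s| ∂gaussianReal 0 1 = √(2 / Real.pi) := by
  have h1 : ∀ s : ℝ, gaussianPDFReal 0 1 s • |s| =
      (√(2 * Real.pi))⁻¹ * (|s| * Real.exp (-(|s| ^ 2 / 2))) := by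
    intro s
    simp only [gaussianPDFReal, NNReal.coe_one, mul_one, sub_zero, smul_eq_mul, sq_abs]
    ring_nf
  rw [integral_gaussianReal_eq_integral_smul one_ne_zero]
  simp_rw [h1]
  rw [integral_const_mul, integral_comp_abs (f := fun r => r * Real.exp (-(r ^ 2 / 2)))]
  have h2 := integral_rpow_mul_exp_neg_half_sq (q := 1) (by norm_num)
  simp only [Real.rpow_one] at h2
  rw [h2, show ((1 : ℝ) + 1) / 2 = 1 by norm_num, Real.rpow_one, Real.Gamma_one,
    Real.sqrt_mul zero_le_two, Real.sqrt_div zero_le_two]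
  have := Real.pi_pos
  field_simp
  simp

theorem integral_norm_gaussianReal_prod :
    ∫ p, √(p.1 ^ 2 + p.2 ^ 2) ∂(gaussianReal 0 1).prod (gaussianReal 0 1) =
      √(Real.pi / 2) := by
  have hm := measurable_gaussianPDF 0 1
  rw [gaussianReal_of_var_ne_zero 0 one_ne_zero, prod_withDensity hm hm,
    integral_withDensity_eq_integral_toReal_smul (by fun_prop)
      (Filter.Eventually.of_forall fun p => ENNReal.mul_lt_top (by simp [gaussianPDF])
        (by simp [gaussianPDF])), ← Measure.volume_eq_prod,
    ← integral_comp_polarCoord_symm, polarCoord_target]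
  have h : ∀ p ∈ Ioi (0 : ℝ) ×ˢ Ioo (-Real.pi) Real.pi,
      p.1 • ((gaussianPDF 0 1 (polarCoord.symm p).1 *
        gaussianPDF 0 1 (polarCoord.symm p).2).toReal •
        √((polarCoord.symm p).1 ^ 2 + (polarCoord.symm p).2 ^ 2)) =
      (p.1 ^ (2 : ℝ) * Real.exp (-(p.1 ^ 2 / 2))) * (2 * Real.pi)⁻¹ := by
    intro p hp
    have hp1 : 0 ≤ p.1 := (mem_Ioi.mp hp.1).le
    have e1 : (p.1 * Real.cos p.2) ^ 2 + (p.1 * Real.sin p.2) ^ 2 = p.1 ^ 2 := by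
      linear_combination p.1 ^ 2 * Real.cos_sq_add_sin_sq p.2
    simp only [polarCoord_symm_apply, ENNReal.toReal_mul, toReal_gaussianPDF, smul_eq_mul]
    rw [e1, Real.sqrt_sq hp1]
    simp only [gaussianPDFReal, NNReal.coe_one, mul_one, sub_zero, Real.rpow_two]
    have e2 : Real.exp (-(p.1 ^ 2 / 2)) = Real.exp (-(p.1 * Real.cos p.2) ^ 2 / 2) *
        Real.exp (-(p.1 * Real.sin p.2) ^ 2 / 2) := by
      rw [← Real.exp_add, ← e1]; ring_nf
    have e3 : (√(2 * Real.pi))⁻¹ * (√(2 * Real.pi))⁻¹ = (2 * Real.pi)⁻¹ := by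
      rw [← mul_inv, Real.mul_self_sqrt (by positivity)]
    rw [e2, ← e3]
    ring
  rw [setIntegral_congr_fun (measurableSet_Ioi.prod measurableSet_Ioo) h, Measure.volume_eq_prod,
    setIntegral_prod_mul (fun x : ℝ => x ^ (2 : ℝ) * Real.exp (-(x ^ 2 / 2)))
      (fun _ : ℝ => (2 * Real.pi)⁻¹), integral_rpow_mul_exp_neg_half_sq (by norm_num)]
  have hG : Real.Gamma ((2 + 1) / 2) = √Real.pi / 2 := by
    rw [show ((2 : ℝ) + 1) / 2 = 1 / 2 + 1 by norm_num, Real.Gamma_add_one (by norm_num),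
      Real.Gamma_one_half_eq]
    ring
  have h2 : (2 : ℝ) ^ (((2 : ℝ) + 1) / 2) = 2 * √2 := by
    rw [show ((2 : ℝ) + 1) / 2 = 1 + 1 / 2 by norm_num, Real.rpow_add two_pos, Real.rpow_one,
      Real.sqrt_eq_rpow]
  have hpi := Real.pi_pos
  rw [hG, h2, Real.sqrt_div hpi.le]
  simp only [integral_const, MeasurableSet.univ, measureReal_restrict_apply, univ_inter,
    Real.volume_real_Ioo_of_le (show -Real.pi ≤ Real.pi by linarith), smul_eq_mul]
  field_simp
  rw [Real.sq_sqrt zero_le_two]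
  ring

/-- Superadditive functions on the nonnegative orthant which are nonnegative at the vectors
`c • (eᵢ + eⱼ)` with `i ≠ j` are nonnegative on the cone these vectors generate. -/
structure PairNonneg {ι : Type*} [DecidableEq ι] (L : (ι → ℝ) → ℝ) : Prop where
  zero : 0 ≤ L 0
  superadd : ∀ x y, 0 ≤ x → 0 ≤ y → L x + L y ≤ L (x + y)
  pair : ∀ i j, i ≠ j → ∀ c : ℝ, 0 ≤ c → 0 ≤ L (c • (Pi.single i 1 + Pi.single j 1))

section PairNonneg

variable {ι : Type*} [DecidableEq ι] {L : (ι → ℝ) → ℝ}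

theorem PairNonneg.star_nonneg (hL : PairNonneg L) {x : ι → ℝ} (hx : 0 ≤ x) (k : ι)
    (s : Finset ι) (hk : k ∉ s) :
    0 ≤ L (∑ j ∈ s, x j • (Pi.single k 1 + Pi.single j 1)) := by
  induction s using Finset.induction_on with
  | empty => simpa using hL.zero
  | insert i s hi ih =>
    rw [Finset.sum_insert hi]
    have hnn : ∀ j, 0 ≤ x j • (Pi.single k (1 : ℝ) + Pi.single j 1 : ι → ℝ) := fun j =>
      smul_nonneg (hx j) (add_nonneg (Pi.single_nonneg.mpr zero_le_one)
        (Pi.single_nonneg.mpr zero_le_one))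
    refine le_trans ?_ (hL.superadd _ _ (hnn i) (Finset.sum_nonneg fun j _ => hnn j))
    have h1 := hL.pair k i (fun h => hk (h ▸ Finset.mem_insert_self _ _)) (x i) (hx i)
    have h2 := ih fun h => hk (Finset.mem_insert_of_mem h)
    linarith

theorem sum_star [Fintype ι] (x : ι → ℝ) (k : ι) :
    (x k - ∑ j ∈ Finset.univ.erase k, x j) • Pi.single k 1 +
      ∑ j ∈ Finset.univ.erase k, x j • (Pi.single k 1 + Pi.single j 1) = x := by
  simp only [smul_add, Finset.sum_add_distrib, ← Finset.sum_smul]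
  rw [sub_smul, ← add_assoc, sub_add_cancel,
    Finset.add_sum_erase _ (fun j => x j • (Pi.single j 1 : ι → ℝ)) (Finset.mem_univ k),
    ← pi_eq_sum_univ' x]

theorem PairNonneg.nonneg_of_tight [Fintype ι] (hL : PairNonneg L) {x : ι → ℝ} (hx : 0 ≤ x) (k : ι)
    (hk : 2 * x k = ∑ j, x j) : 0 ≤ L x := by
  have h := hL.star_nonneg hx k (Finset.univ.erase k) (Finset.notMem_erase k _)
  have e := sum_star x k
  have e1 := Finset.add_sum_erase Finset.univ x (Finset.mem_univ k)
  rw [show x k - ∑ j ∈ Finset.univ.erase k, x j = 0 by linarith, zero_smul, zero_add] at e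
  rwa [e] at h

theorem PairNonneg.nonneg [Fintype ι] (hL : PairNonneg L) (N : ℕ) {x : ι → ℝ} (hx : 0 ≤ x)
    (hN : (Finset.univ.filter fun j => x j ≠ 0).card ≤ N) (hb : ∀ j, 2 * x j ≤ ∑ i, x i) :
    0 ≤ L x := by
  induction N generalizing x with
  | zero =>
    have h0 : x = 0 := by
      ext j
      simpa using Finset.filter_eq_empty_iff.mp (Finset.card_eq_zero.mp (Nat.le_zero.mp hN))
        (Finset.mem_univ j)
    rw [h0]; exact hL.zero
  | succ N ih =>
    by_cases htight : ∃ k, 2 * x k = ∑ i, x i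
    · obtain ⟨k, hk⟩ := htight
      exact hL.nonneg_of_tight hx k hk
    push Not at htight
    have hlt : ∀ j, 2 * x j < ∑ i, x i := fun j => (hb j).lt_of_ne (htight j)
    by_cases h0 : x = 0
    · rw [h0]; exact hL.zero
    obtain ⟨i, hi⟩ : ∃ i, x i ≠ 0 := by
      by_contra! h
      exact h0 (funext h)
    have hi' : 0 < x i := (hx i).lt_of_ne' hi
    obtain ⟨j, hj, hj'⟩ : ∃ j, j ≠ i ∧ 0 < x j := by
      by_contra! h
      have e : ∑ l, x l = x i := Finset.sum_eq_single i
        (fun l _ hl => le_antisymm (h l hl) (hx l)) (by simp)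
      linarith [hlt i]
    let f : ι → ℝ := fun k => if k = i ∨ k = j then x k else (∑ l, x l) / 2 - x k
    have hf : ∀ k, 0 < f k := by
      intro k
      by_cases hk : k = i ∨ k = j
      · simp only [f, hk, if_true]
        rcases hk with rfl | rfl <;> assumption
      · simp only [f, hk, if_false]
        linarith [hlt k]
    have : Nonempty ι := ⟨i⟩
    obtain ⟨k, hk⟩ := Finite.exists_min f
    have hδ := hf k
    have hδi : f k ≤ x i := by simpa [f] using hk i
    have hδj : f k ≤ x j := by simpa [f] using hk j
    set δ := f k with hδdef
    let y : ι → ℝ := x - δ • (Pi.single i 1 + Pi.single j 1)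
    have hyi : y i = x i - δ := by simp [y, Pi.single_eq_of_ne' hj]
    have hyj : y j = x j - δ := by simp [y, Pi.single_eq_of_ne hj]
    have hyl : ∀ l, ¬ (l = i ∨ l = j) → y l = x l := by
      intro l hl
      push Not at hl
      simp [y, Pi.single_eq_of_ne hl.1, Pi.single_eq_of_ne hl.2]
    have hy0 : 0 ≤ y := by
      intro l
      by_cases hl : l = i ∨ l = j
      · rcases hl with rfl | rfl
        · rw [hyi]; exact sub_nonneg.mpr hδi
        · rw [hyj]; exact sub_nonneg.mpr hδj
      · rw [hyl l hl]; exact hx l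
    have hysum : ∑ l, y l = ∑ l, x l - 2 * δ := by
      simp [y, Finset.sum_sub_distrib, ← Finset.mul_sum, Finset.sum_add_distrib]
      ring
    have hyb : ∀ l, 2 * y l ≤ ∑ m, y m := by
      intro l
      rw [hysum]
      by_cases hl : l = i ∨ l = j
      · rcases hl with rfl | rfl
        · rw [hyi]; linarith [hb l]
        · rw [hyj]; linarith [hb l]
      · rw [hyl l hl]
        have := hk l
        simp only [f, hl, if_false] at this
        linarith
    have hLy : 0 ≤ L y := by
      by_cases hkij : k = i ∨ k = j
      · refine ih hy0 ?_ hyb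
        have hyk : y k = 0 := by
          have e : δ = x k := by simp [hδdef, f, hkij]
          rcases hkij with rfl | rfl
          · rw [hyi, e, sub_self]
          · rw [hyj, e, sub_self]
        have hxk : x k ≠ 0 := by
          rcases hkij with rfl | rfl
          · exact hi
          · exact hj'.ne'
        refine Nat.lt_succ_iff.mp (lt_of_lt_of_le (Finset.card_lt_card ?_) hN)
        refine Finset.ssubset_iff_subset_ne.mpr ⟨fun l hl => ?_, fun h => ?_⟩
        · simp only [Finset.mem_filter, Finset.mem_univ, true_and] at hl ⊢
          intro hxl
          by_cases hl' : l = i ∨ l = j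
          · rcases hl' with rfl | rfl
            · exact hi hxl
            · exact hj'.ne' hxl
          · exact hl (by rw [hyl l hl', hxl])
        · have : k ∈ Finset.univ.filter fun l => y l ≠ 0 := by
            rw [h]; simpa using hxk
          simp [hyk] at this
      · refine hL.nonneg_of_tight hy0 k ?_
        have e : δ = (∑ l, x l) / 2 - x k := by simp [hδdef, f, hkij]
        rw [hysum, hyl k hkij]
        linarith
    have hp0 : 0 ≤ δ • (Pi.single i (1 : ℝ) + Pi.single j 1 : ι → ℝ) :=
      smul_nonneg hδ.le (add_nonneg (Pi.single_nonneg.mpr zero_le_one)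
        (Pi.single_nonneg.mpr zero_le_one))
    have h1 := hL.superadd y _ hy0 hp0
    rw [sub_add_cancel] at h1
    linarith [hL.pair i j hj.symm δ hδ.le]

end PairNonneg

/-- The mean of the root of the quadratic form with diagonal coefficients `x`. -/
def rootMean (x : Fin n → ℝ) : ℝ := ∫ g, √(∑ j, x j * g j ^ 2) ∂gaussVec n

theorem integrable_sqrt_sum (x : Fin n → ℝ) :
    Integrable (fun g : Fin n → ℝ => √(∑ j, x j * g j ^ 2)) (gaussVec n) := by
  refine ((integrable_norm_gaussVec n).const_mul (√(∑ j, |x j|))).mono'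
    (Continuous.aestronglyMeasurable (by fun_prop)) (Filter.Eventually.of_forall fun g => ?_)
  rw [Real.norm_of_nonneg (Real.sqrt_nonneg _)]
  refine Real.sqrt_le_iff.mpr ⟨by positivity, ?_⟩
  rw [mul_pow, Real.sq_sqrt (Finset.sum_nonneg fun j _ => abs_nonneg _), Finset.sum_mul]
  refine Finset.sum_le_sum fun j _ => ?_
  have h1 : g j ^ 2 ≤ ‖g‖ ^ 2 := by
    rw [← sq_abs]
    exact pow_le_pow_left₀ (abs_nonneg _) (norm_le_pi_norm g j) 2
  exact (mul_le_mul_of_nonneg_right (le_abs_self _) (by positivity)).trans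
    (mul_le_mul_of_nonneg_left h1 (abs_nonneg _))

theorem sqrt_mul_sqrt_add_le {a b q r : ℝ} (ha : 0 ≤ a) (hb : 0 ≤ b) (hq : 0 ≤ q) (hr : 0 ≤ r) :
    √a * √q + √b * √r ≤ √(a + b) * √(q + r) := by
  rw [← Real.sqrt_mul (add_nonneg ha hb)]
  refine Real.le_sqrt_of_sq_le ?_
  have h1 := Real.sq_sqrt ha
  have h2 := Real.sq_sqrt hb
  have h3 := Real.sq_sqrt hq
  have h4 := Real.sq_sqrt hr
  have h5 : (a + b) * (q + r) - (√a * √q + √b * √r) ^ 2 = (√a * √r - √b * √q) ^ 2 := by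
    linear_combination (-q - r) * h1 + (-q - r) * h2 - (√a ^ 2 + √b ^ 2) * h3 -
      (√a ^ 2 + √b ^ 2) * h4
  linarith [sq_nonneg (√a * √r - √b * √q)]

theorem rootMean_superadditive {x y : Fin n → ℝ} (hx : 0 ≤ x) (hy : 0 ≤ y) :
    √(∑ j, x j) * rootMean x + √(∑ j, y j) * rootMean y ≤
      √(∑ j, (x + y) j) * rootMean (x + y) := by
  simp only [rootMean]
  rw [← integral_const_mul, ← integral_const_mul, ← integral_const_mul,
    ← integral_add ((integrable_sqrt_sum x).const_mul _) ((integrable_sqrt_sum y).const_mul _)]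
  refine integral_mono (((integrable_sqrt_sum x).const_mul _).add
    ((integrable_sqrt_sum y).const_mul _)) ((integrable_sqrt_sum _).const_mul _) fun g => ?_
  simp only [Pi.add_apply, add_mul, Finset.sum_add_distrib]
  exact sqrt_mul_sqrt_add_le (Finset.sum_nonneg fun j _ => hx j) (Finset.sum_nonneg fun j _ => hy j)
    (Finset.sum_nonneg fun j _ => mul_nonneg (hx j) (sq_nonneg _))
    (Finset.sum_nonneg fun j _ => mul_nonneg (hy j) (sq_nonneg _))

theorem rootMean_single (i : Fin n) {c : ℝ} (hc : 0 ≤ c) :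
    √(∑ j, (c • Pi.single i (1 : ℝ) : Fin n → ℝ) j) * rootMean (c • Pi.single i (1 : ℝ)) =
      c * √(2 / Real.pi) := by
  have h1 : ∀ g : Fin n → ℝ, √(∑ j, (c • Pi.single i (1 : ℝ) : Fin n → ℝ) j * g j ^ 2) =
      √c * |g i| := by
    intro g
    rw [Finset.sum_eq_single i (fun j _ hj => by simp [Pi.single_eq_of_ne hj]) (by simp)]
    simp [Real.sqrt_mul hc, Real.sqrt_sq_eq_abs]
  have h2 : ∫ g, |g i| ∂gaussVec n = √(2 / Real.pi) := by
    rw [← integral_abs_gaussianReal]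
    exact integral_comp_eval (μ := fun _ : Fin n => gaussianReal 0 1) (i := i)
      continuous_abs.aestronglyMeasurable
  simp only [rootMean, h1]
  rw [integral_const_mul, h2, ← mul_assoc]
  simp [← Finset.mul_sum, Real.mul_self_sqrt hc]

theorem map_pair_gaussVec {i j : Fin n} (hij : i ≠ j) :
    (gaussVec n).map (fun g => (g i, g j)) = (gaussianReal 0 1).prod (gaussianReal 0 1) := by
  have h := (iIndepFun_pi (μ := fun _ : Fin n => gaussianReal 0 1) (X := fun _ x => x)
    fun _ => aemeasurable_id').indepFun hij
  rw [indepFun_iff_map_prod_eq_prod_map_map (measurable_pi_apply i).aemeasurable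
    (measurable_pi_apply j).aemeasurable] at h
  rw [gaussVec, h, (measurePreserving_eval (fun _ : Fin n => gaussianReal 0 1) i).map_eq,
    (measurePreserving_eval (fun _ : Fin n => gaussianReal 0 1) j).map_eq]

theorem rootMean_pair {i j : Fin n} (hij : i ≠ j) {c : ℝ} (hc : 0 ≤ c) :
    √(∑ l, (c • (Pi.single i (1 : ℝ) + Pi.single j 1) : Fin n → ℝ) l) *
      rootMean (c • (Pi.single i (1 : ℝ) + Pi.single j 1)) = c * √Real.pi := by
  have h1 : ∀ g : Fin n → ℝ,
      √(∑ l, (c • (Pi.single i (1 : ℝ) + Pi.single j 1) : Fin n → ℝ) l * g l ^ 2) =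
        √c * √(g i ^ 2 + g j ^ 2) := by
    intro g
    rw [← Real.sqrt_mul hc]
    congr 1
    simp only [Pi.smul_apply, Pi.add_apply, smul_eq_mul, mul_add, add_mul, Finset.sum_add_distrib]
    rw [Finset.sum_eq_single i (fun l _ hl => by simp [Pi.single_eq_of_ne hl]) (by simp),
      Finset.sum_eq_single j (fun l _ hl => by simp [Pi.single_eq_of_ne hl]) (by simp)]
    simp
  have h2 : ∫ g, √(g i ^ 2 + g j ^ 2) ∂gaussVec n = √(Real.pi / 2) := by
    rw [← integral_norm_gaussianReal_prod, ← map_pair_gaussVec hij, integral_map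
      (by fun_prop) (Continuous.aestronglyMeasurable (by fun_prop))]
  have h3 : ∑ l, (c • (Pi.single i (1 : ℝ) + Pi.single j 1) : Fin n → ℝ) l = c * 2 := by
    simp [← Finset.mul_sum, Finset.sum_add_distrib]
    norm_num
  simp only [rootMean, h1]
  rw [integral_const_mul, h2, h3, Real.sqrt_mul hc, Real.sqrt_div Real.pi_pos.le]
  have := Real.mul_self_sqrt hc
  field_simp
  linear_combination this

theorem pairNonneg_rootMean : PairNonneg fun x : Fin n → ℝ =>
    √(∑ j, x j) * rootMean x - √Real.pi / 2 * ∑ j, x j := by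
  refine ⟨by simp, fun x y hx hy => ?_, fun i j hij c hc => ?_⟩
  · have := rootMean_superadditive hx hy
    have e : ∑ j, (x + y) j = ∑ j, x j + ∑ j, y j := by simp [Finset.sum_add_distrib]
    rw [e] at this ⊢
    linarith
  · rw [rootMean_pair hij hc]
    have h3 : ∑ l, (c • (Pi.single i (1 : ℝ) + Pi.single j 1) : Fin n → ℝ) l = c * 2 := by
      simp [← Finset.mul_sum, Finset.sum_add_distrib]
      norm_num
    rw [h3]
    linarith

theorem rootMean_ge_of_balanced {x : Fin n → ℝ} (hx : 0 ≤ x) (hb : ∀ j, 2 * x j ≤ ∑ i, x i) :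
    Real.pi / 4 * ∑ j, x j ≤ rootMean x ^ 2 := by
  have h := pairNonneg_rootMean.nonneg _ hx le_rfl hb
  have h0 : 0 ≤ ∑ j, x j := Finset.sum_nonneg fun j _ => hx j
  rcases h0.eq_or_lt with h1 | h1
  · rw [← h1, mul_zero]; positivity
  · have h3 := Real.mul_self_sqrt h0
    have h4 : √Real.pi / 2 * √(∑ j, x j) ≤ rootMean x := by
      refine le_of_mul_le_mul_left ?_ (Real.sqrt_pos.mpr h1)
      linear_combination h + √Real.pi / 2 * h3
    calc Real.pi / 4 * ∑ j, x j = (√Real.pi / 2 * √(∑ j, x j)) ^ 2 := by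
          rw [mul_pow, div_pow, Real.sq_sqrt h0, Real.sq_sqrt Real.pi_pos.le]; norm_num
      _ ≤ _ := pow_le_pow_left₀ (by positivity) h4 2

theorem rootMean_ge_of_dominant {x : Fin n → ℝ} (hx : 0 ≤ x) (k : Fin n)
    (hk : ∑ j, x j ≤ 2 * x k) :
    0.6366 * x k + 0.9185 * (∑ j, x j - x k) ≤ rootMean x ^ 2 := by
  have e := Finset.add_sum_erase Finset.univ x (Finset.mem_univ k)
  have hY : 0 ≤ ∑ j ∈ Finset.univ.erase k, x j := Finset.sum_nonneg fun j _ => hx j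
  have hstar := pairNonneg_rootMean.star_nonneg hx k (Finset.univ.erase k) (Finset.notMem_erase k _)
  have hsum := sum_star x k
  rw [← e] at hk ⊢
  set Y := ∑ j ∈ Finset.univ.erase k, x j with hYdef
  set R : Fin n → ℝ := ∑ j ∈ Finset.univ.erase k, x j • (Pi.single k 1 + Pi.single j 1) with hR
  have hu : 0 ≤ x k - Y := by linarith
  have hR0 : 0 ≤ R := Finset.sum_nonneg fun j _ => smul_nonneg (hx j)
    (add_nonneg (Pi.single_nonneg.mpr zero_le_one) (Pi.single_nonneg.mpr zero_le_one))
  have hRs : ∑ j, R j = 2 * Y := by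
    rw [hR, Finset.sum_congr rfl fun j _ => Finset.sum_apply j _ _, Finset.sum_comm, hYdef,
      Finset.mul_sum]
    refine Finset.sum_congr rfl fun j _ => ?_
    simp [← Finset.mul_sum, Finset.sum_add_distrib]
    ring
  have h1 := rootMean_superadditive (smul_nonneg hu (Pi.single_nonneg.mpr zero_le_one)) hR0
    (x := (x k - Y) • Pi.single k (1 : ℝ))
  rw [hsum, rootMean_single k hu, ← e] at h1
  simp only [hRs] at h1 hstar
  have hpi := Real.pi_pos
  have hw : (x k - Y) * √(2 / Real.pi) + √Real.pi * Y ≤ √(x k + Y) * rootMean x := by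
    linarith
  have hw2 := pow_le_pow_left₀ (add_nonneg (mul_nonneg hu (Real.sqrt_nonneg _))
    (mul_nonneg (Real.sqrt_nonneg _) hY)) hw 2
  have hxk := hx k
  simp only [Pi.zero_apply] at hxk
  rw [mul_pow, Real.sq_sqrt (add_nonneg hxk hY), add_pow_two, mul_pow, mul_pow,
    Real.sq_sqrt (by positivity), Real.sq_sqrt hpi.le] at hw2
  have hcross : √(2 / Real.pi) * √Real.pi = √2 := by
    rw [← Real.sqrt_mul (by positivity)]; congr 1; field_simp
  have hs2 : 1.41421 ≤ √2 := Real.le_sqrt_of_sq_le (by norm_num)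
  have h2pi : 0.6366 ≤ 2 / Real.pi := by
    rw [le_div_iff₀ hpi]; linarith [Real.pi_lt_d4]
  rcases (add_nonneg hxk hY).eq_or_lt with h0 | h0
  · have hx0 : x k = 0 := by linarith
    have hY0 : Y = 0 := by linarith
    rw [hx0, hY0]; simpa using sq_nonneg (rootMean x)
  · refine le_of_mul_le_mul_left (le_trans ?_ hw2) h0
    have t1 := mul_le_mul_of_nonneg_right h2pi (sq_nonneg (x k - Y))
    have t2 := mul_le_mul_of_nonneg_right hs2 (mul_nonneg hu hY)
    have t3 := mul_le_mul_of_nonneg_right Real.pi_gt_d2.le (sq_nonneg Y)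
    have t4 : 2 * ((x k - Y) * √(2 / Real.pi)) * (√Real.pi * Y) =
        2 * (√2 * ((x k - Y) * Y)) := by rw [← hcross]; ring
    rw [t4]
    nlinarith [mul_nonneg hu hY, sq_nonneg Y]

/-- Diagonalisation of a sum of squares of linear forms. -/
theorem exists_diagonal_coordinates {ι : Type*} [Fintype ι] (M : ι → Fin n → ℝ) :
    ∃ (U : (Fin n → ℝ) →ₗ[ℝ] (Fin n → ℝ)) (l : Fin n → ℝ),
      (∀ c, U c ⬝ᵥ U c = c ⬝ᵥ c) ∧ 0 ≤ l ∧
      (∀ c, ∑ i, (M i ⬝ᵥ U c) ^ 2 = ∑ j, l j * c j ^ 2) ∧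
      ∑ j, l j = ∑ i, M i ⬝ᵥ M i := by
  let B : Matrix ι (Fin n) ℝ := Matrix.of M
  have hG : (Bᵀ * B).IsHermitian := by
    simpa using Matrix.isHermitian_conjTranspose_mul_self B
  let b := hG.eigenvectorBasis
  let U : (Fin n → ℝ) →ₗ[ℝ] (Fin n → ℝ) := Fintype.linearCombination ℝ fun j => (b j).ofLp
  have hU : ∀ c, U c = ∑ j, c j • (b j).ofLp := fun c => by
    simp [U, Fintype.linearCombination_apply]
  have hb : ∀ i j, (b i).ofLp ⬝ᵥ (b j).ofLp = if i = j then 1 else 0 := by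
    intro i j
    have := orthonormal_iff_ite.mp b.orthonormal j i
    rw [EuclideanSpace.inner_eq_star_dotProduct, star_trivial] at this
    rw [this]; simp [eq_comm]
  have hUU : ∀ c d, U c ⬝ᵥ U d = c ⬝ᵥ d := by
    intro c d
    simp only [hU, sum_dotProduct, dotProduct_sum, smul_dotProduct, dotProduct_smul, hb,
      smul_eq_mul]
    simp [dotProduct, mul_comm]
  have hGU : ∀ c, (Bᵀ * B) *ᵥ U c = U (fun j => hG.eigenvalues j * c j) := by
    intro c
    simp only [hU, Matrix.mulVec_sum, Matrix.mulVec_smul]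
    refine Finset.sum_congr rfl fun j _ => ?_
    rw [hG.mulVec_eigenvectorBasis, smul_smul, mul_comm]
  have hq : ∀ c, ∑ i, (M i ⬝ᵥ U c) ^ 2 = ∑ j, hG.eigenvalues j * c j ^ 2 := by
    intro c
    calc ∑ i, (M i ⬝ᵥ U c) ^ 2 = (B *ᵥ U c) ⬝ᵥ (B *ᵥ U c) := by
          simp [dotProduct, Matrix.mulVec, B, pow_two]
      _ = U c ⬝ᵥ ((Bᵀ * B) *ᵥ U c) := by
          rw [← Matrix.mulVec_mulVec, Matrix.dotProduct_mulVec (U c), Matrix.vecMul_transpose]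
      _ = _ := by
          rw [hGU, hUU]
          refine Finset.sum_congr rfl fun j _ => ?_
          ring
  refine ⟨U, hG.eigenvalues, fun c => hUU c c, fun j => ?_, hq, ?_⟩
  · have h := hq (Pi.single j 1)
    rw [Finset.sum_eq_single j (fun i _ hi => by simp [Pi.single_eq_of_ne hi]) (by simp)] at h
    simp only [Pi.single_eq_same, one_pow, mul_one] at h
    rw [← h]
    exact Finset.sum_nonneg fun i _ => sq_nonneg _
  · have h := hG.trace_eq_sum_eigenvalues
    simp only [RCLike.ofReal_real_eq_id, id_eq] at h
    rw [← h, Matrix.trace_mul_comm]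
    rfl

theorem sq_integral_sqrt_ge {ι : Type*} [Fintype ι] (M : ι → Fin (n + 1) → ℝ) :
    ∃ v : Fin (n + 1) → ℝ, v ⬝ᵥ v = 1 ∧ ∑ i, (M i ⬝ᵥ v) ^ 2 ≤ ∑ i, M i ⬝ᵥ M i ∧
      ((∑ i, M i ⬝ᵥ M i ≤ 2 * ∑ i, (M i ⬝ᵥ v) ^ 2 ∧
        0.6366 * ∑ i, (M i ⬝ᵥ v) ^ 2 + 0.9185 * (∑ i, M i ⬝ᵥ M i - ∑ i, (M i ⬝ᵥ v) ^ 2) ≤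
          (∫ x, √(∑ i, (M i ⬝ᵥ x) ^ 2) ∂gaussVec (n + 1)) ^ 2) ∨
      0.785 * ∑ i, M i ⬝ᵥ M i ≤ (∫ x, √(∑ i, (M i ⬝ᵥ x) ^ 2) ∂gaussVec (n + 1)) ^ 2) := by
  obtain ⟨U, l, hU, hl, hq, hs⟩ := exists_diagonal_coordinates M
  have hmp := measurePreserving_of_dotProduct U hU
  have hE : ∫ x, √(∑ i, (M i ⬝ᵥ x) ^ 2) ∂gaussVec (n + 1) = rootMean l := by
    have h := integral_map (μ := gaussVec (n + 1)) hmp.measurable.aemeasurable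
      (f := fun x => √(∑ i, (M i ⬝ᵥ x) ^ 2))
      (Continuous.aestronglyMeasurable (by unfold dotProduct; fun_prop))
    rw [hmp.map_eq] at h
    rw [h, rootMean]
    simp_rw [hq]
  obtain ⟨k, hk⟩ := Finite.exists_max l
  have hlk : ∑ i, (M i ⬝ᵥ U (Pi.single k 1)) ^ 2 = l k := by
    rw [hq, Finset.sum_eq_single k (fun i _ hi => by simp [Pi.single_eq_of_ne hi]) (by simp)]
    simp
  refine ⟨U (Pi.single k 1), by simp [hU], ?_, ?_⟩
  · rw [hlk, ← hs]
    exact Finset.single_le_sum (fun j _ => hl j) (Finset.mem_univ k)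
  · rw [hlk, hE, ← hs]
    rcases le_total (∑ j, l j) (2 * l k) with h | h
    · exact Or.inl ⟨h, rootMean_ge_of_dominant hl k h⟩
    · refine Or.inr (le_trans ?_ (rootMean_ge_of_balanced hl fun j => ?_))
      · refine mul_le_mul_of_nonneg_right ?_ (Finset.sum_nonneg fun j _ => hl j)
        linarith [Real.pi_gt_d2]
      · linarith [hk j]

theorem exp_neg_ge_cubic {x : ℝ} (hx : 0 ≤ x) :
    1 - x + x ^ 2 / 2 - x ^ 3 / 6 ≤ Real.exp (-x) := by
  have := alternating_exp_neg_taylor 4 hx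
  simp only [Finset.sum_range_succ, Finset.sum_range_zero, Nat.factorial] at this
  norm_num at this
  linarith

theorem le_exp_neg_077 : (0.463 : ℝ) ≤ Real.exp (-0.77) := by
  have := alternating_exp_neg_taylor 8 (show (0 : ℝ) ≤ 0.77 by norm_num)
  simp only [Finset.sum_range_succ, Finset.sum_range_zero, Nat.factorial] at this
  norm_num at this ⊢
  linarith

theorem gainH_mono {p q : ℝ} (hp : 0 ≤ p) (hpq : p ≤ q) : gainH p ≤ gainH q := by
  unfold gainH; gcongr

theorem quadratic_interpolated_nonneg {Y u : ℝ} (hY : 0 ≤ Y) (hu0 : 0 ≤ u)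
    (hu : u = Real.exp (-(0.77 * Y))) :
    0.145 ≤ 0.0733 * Y + 0.1211 * u * 1.6366 ∧
    0.145 ≤ 0.0733 * Y + 0.1211 * u * (1.1366 + 0.45925 * Y) + 0.0176 * u ^ 2 * 0.8183 ∧
    0.0882 ≤ 0.0733 * Y + 0.1211 * u * (0.6366 + 0.9185 * Y) + 0.0176 * u ^ 2 * 0.6366 := by
  have h3 : 1 - 0.77 * Y + 0.29645 * Y ^ 2 - 0.0761 * Y ^ 3 ≤ u := by
    have h := exp_neg_ge_cubic (show 0 ≤ 0.77 * Y by positivity)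
    rw [← hu] at h
    have h2 := pow_nonneg hY 2
    have h4 := pow_nonneg hY 3
    linarith
  have h1 : 1 - 0.77 * Y ≤ u := by
    rw [hu]; linarith [Real.add_one_le_exp (-(0.77 * Y))]
  refine ⟨?_, ?_, ?_⟩
  · rcases le_total 2 Y with h | h
    · nlinarith
    · have a1 := mul_nonneg hY (sub_nonneg.mpr h)
      nlinarith [mul_nonneg hY a1, mul_nonneg (sub_nonneg.mpr h) a1]
  · rcases le_total 2 Y with h | h
    · nlinarith [mul_nonneg hu0 hY, sq_nonneg u]
    · have a1 := mul_le_mul_of_nonneg_right h3 (show 0 ≤ 0.15492 + 0.05561 * Y by positivity)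
      have h2 : 0 ≤ 2 - Y := sub_nonneg.mpr h
      have a2 : 0.145 ≤ 0.0733 * Y + (1 - 0.77 * Y + 0.29645 * Y ^ 2 - 0.0761 * Y ^ 3) *
          (0.15492 + 0.05561 * Y) - 0.0052 := by
        have b0 : 0 ≤ (2 - Y) ^ 4 := by positivity
        have b1 : 0 ≤ Y * (2 - Y) ^ 3 := by positivity
        have b2 : 0 ≤ Y ^ 2 * (2 - Y) ^ 2 := by positivity
        have b3 : 0 ≤ Y ^ 3 * (2 - Y) := by positivity
        have b4 : 0 ≤ Y ^ 4 := by positivity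
        linarith
      nlinarith [sq_nonneg (u - 0.6), mul_nonneg hu0 hY]
  · rcases le_total 1.21 Y with h | h
    · nlinarith [mul_nonneg hu0 hY, sq_nonneg u]
    · have a1 := mul_le_mul_of_nonneg_right h1 (show 0 ≤ 0.0994 + 0.1112 * Y by positivity)
      nlinarith [sq_nonneg (u - 1), mul_nonneg hu0 hY, mul_nonneg hY (sub_nonneg.mpr h)]

/-- A lower bound, uniform in `Y`, for the total gain. -/
theorem gain_ge {μ Y u : ℝ} (hY : 0 ≤ Y) (hμ0 : 0 ≤ μ) (hμ1 : μ ≤ 1)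
    (hu : u = Real.exp (-(0.77 * Y))) :
    min 0.145 (0.2018 - 0.1136 * μ) ≤ 0.0733 * Y + (1 - μ) * (0.1211 * u + 0.0176 * u ^ 2) +
      (0.6366 + 0.9185 * Y * μ) * (0.1211 * u + 0.0176 * μ * u ^ 2) := by
  have hu0 : 0 ≤ u := hu ▸ (Real.exp_pos _).le
  obtain ⟨l0, l1, l2⟩ := quadratic_interpolated_nonneg hY hu0 hu
  have hdrop : 0 ≤ 0.9185 * Y * μ * (0.0176 * μ * u ^ 2) := by positivity
  have hu2 := sq_nonneg u
  rcases le_total μ (1 / 2) with h | h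
  · refine (min_le_left _ _).trans ?_
    have c0 := mul_le_mul_of_nonneg_left l0 (show 0 ≤ 1 - 2 * μ by linarith)
    have c1 := mul_le_mul_of_nonneg_left l1 (show 0 ≤ 2 * μ by linarith)
    have c2 := mul_nonneg (show 0 ≤ 1 - 2 * μ by linarith) hu2
    linarith
  · refine (min_le_right _ _).trans ?_
    have c1 := mul_le_mul_of_nonneg_left l1 (show 0 ≤ 2 - 2 * μ by linarith)
    have c2 := mul_le_mul_of_nonneg_left l2 (show 0 ≤ 2 * μ - 1 by linarith)
    linarith

theorem le_exp_mul_sq {x : ℝ} (hx : 1 ≤ x) :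
    x ≤ Real.exp (0.6353268 * x - 0.77) * (1 + min 0.145 (0.2018 - 0.1136 * x⁻¹)) ^ 2 := by
  have hx0 : 0 < x := by linarith
  have main1 : x ≤ Real.exp (0.6353268 * x - 0.77) * (1 + 0.145) ^ 2 := by
    have h1 := Real.add_one_le_exp (0.6353268 * x - 1)
    have h2 : Real.exp (0.6353268 * x - 1) =
      Real.exp (0.6353268 * x - 0.77) * Real.exp (-0.23) := by rw [← Real.exp_add]; ring_nf
    have h3 : Real.exp (-0.23) ≤ 0.8 :=
      exp_neg_le_of_exp_ge (by norm_num) (exp_ge_quintic (by norm_num)) (by norm_num)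
    have h4 := mul_le_mul_of_nonneg_left h3 (Real.exp_pos (0.6353268 * x - 0.77)).le
    linarith
  have main2 : x ≤ 2 → x ≤ Real.exp (0.6353268 * x - 0.77) * (1 + (0.2018 - 0.1136 * x⁻¹)) ^ 2 := by
    intro hx2
    obtain ⟨w, rfl⟩ : ∃ w, x = 1 + w := ⟨x - 1, by ring⟩
    have hw : 0 ≤ w := by linarith
    have hw1 : 0 ≤ 1 - w := by linarith
    have h1 := Real.sum_le_exp_of_nonneg (show 0 ≤ 0.6353 * w by positivity) 4
    simp only [Finset.sum_range_succ, Finset.sum_range_zero, Nat.factorial] at h1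
    norm_num at h1
    have h2 : 0.8739 ≤ Real.exp (-0.1346732) :=
      le_trans (by norm_num) (exp_neg_ge_cubic (by norm_num))
    have h3 : 0.8739 * Real.exp (0.6353 * w) ≤ Real.exp (0.6353268 * (1 + w) - 0.77) := by
      refine (mul_le_mul_of_nonneg_right h2 (Real.exp_pos _).le).trans ?_
      rw [← Real.exp_add]
      exact Real.exp_le_exp.mpr (by linarith)
    have h4 : (1 + w) ^ 3 ≤ 0.8739 * Real.exp (0.6353 * w) * (1.2018 * (1 + w) - 0.1136) ^ 2 := by
      have h5 := mul_le_mul_of_nonneg_right h1 (sq_nonneg (1.2018 * (1 + w) - 0.1136))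
      have b0 : 0 ≤ (1 - w) ^ 5 := by positivity
      have b1 : 0 ≤ w * (1 - w) ^ 4 := by positivity
      have b2 : 0 ≤ w ^ 2 * (1 - w) ^ 3 := by positivity
      have b3 : 0 ≤ w ^ 3 * (1 - w) ^ 2 := by positivity
      have b4 : 0 ≤ w ^ 4 * (1 - w) := by positivity
      have b5 : 0 ≤ w ^ 5 := by positivity
      linarith
    have h6 : (1 + w) * (1 + w) ^ 2 ≤ Real.exp (0.6353268 * (1 + w) - 0.77) *
        (1 + (0.2018 - 0.1136 * (1 + w)⁻¹)) ^ 2 * (1 + w) ^ 2 := by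
      have e : Real.exp (0.6353268 * (1 + w) - 0.77) * (1 + (0.2018 - 0.1136 * (1 + w)⁻¹)) ^ 2 *
          (1 + w) ^ 2 = Real.exp (0.6353268 * (1 + w) - 0.77) *
            (1.2018 * (1 + w) - 0.1136) ^ 2 := by
        field_simp; ring
      rw [e]
      have h7 := mul_le_mul_of_nonneg_right h3 (sq_nonneg (1.2018 * (1 + w) - 0.1136))
      linarith
    exact le_of_mul_le_mul_right h6 (by positivity)
  rcases le_total x 2 with h | h
  · rcases min_choice (0.145 : ℝ) (0.2018 - 0.1136 * x⁻¹) with e | e <;> rw [e]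
    · exact main1
    · exact main2 h
  · rw [min_eq_left]
    · exact main1
    · have : x⁻¹ ≤ 2⁻¹ := inv_anti₀ two_pos h
      linarith

theorem gain_small {x Y a : ℝ} (hx0 : 0 ≤ x) (hx1 : x ≤ 1) (hY : 0 ≤ Y)
    (ha : 0.6366 * x + 0.9185 * Y ≤ a) :
    1 ≤ Real.exp (0.499 * a) * (Real.exp (-(0.385 * (x + Y))) *
      (1 + a * gainH (Real.exp (-(0.385 * (x + Y)))))) := by
  set q := Real.exp (-(0.385 * (x + Y))) with hq
  set p := 0.0673366 * x - 0.0733 * Y with hp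
  have ha0 : 0 ≤ a := le_trans (by positivity) ha
  have hexp : Real.exp (-p) ≤ Real.exp (0.499 * a) * q := by
    rw [hq, ← Real.exp_add]
    exact Real.exp_le_exp.mpr (by linarith)
  suffices h : Real.exp p ≤ 1 + a * gainH q by
    rw [← mul_assoc]
    calc (1 : ℝ) = Real.exp (-p) * Real.exp p := by rw [← Real.exp_add]; simp
      _ ≤ _ := mul_le_mul hexp h (Real.exp_pos _).le (by positivity)
  have hH := gainH_nonneg q
  rcases le_total p 0 with h0 | h0
  · have := Real.exp_le_one_iff.mpr h0
    nlinarith [mul_nonneg ha0 hH]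
  set u := Real.exp (-(0.77 * Y)) with hu
  have hu0 : 0 < u := Real.exp_pos _
  have hp1 : p ≤ 0.0673366 := by linarith
  have he : Real.exp p ≤ 1 + p + p ^ 2 := by
    have := Real.abs_exp_sub_one_sub_id_le (x := p) (by rw [abs_of_nonneg h0]; linarith)
    linarith [le_abs_self (Real.exp p - 1 - p)]
  have hpu : p ≤ 0.0673366 * x * u := by
    have h1 : 1 - 0.77 * Y ≤ u := by rw [hu]; linarith [Real.add_one_le_exp (-(0.77 * Y))]
    have h2 := mul_le_mul_of_nonneg_left h1 hx0
    have h3 := mul_le_mul_of_nonneg_right hx1 hY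
    linarith
  have hq2 : 0.46 * u ≤ q ^ 2 := by
    have h1 : (0.46 : ℝ) ≤ Real.exp (-0.77) := le_trans (by norm_num) le_exp_neg_077
    have h2 : Real.exp (-0.77) * u ≤ q ^ 2 := by
      rw [hq, hu, ← Real.exp_add, ← Real.exp_nat_mul]
      refine Real.exp_le_exp.mpr ?_
      push_cast
      linarith
    exact (mul_le_mul_of_nonneg_right h1 hu0.le).trans h2
  have hHu : 0.2617 * (0.46 * u) ≤ gainH q := by
    unfold gainH
    have : 0 ≤ 0.0822 * q ^ 4 := by positivity
    linarith
  have h5 : 0.6366 * x * (0.2617 * (0.46 * u)) ≤ a * gainH q :=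
    mul_le_mul (by linarith) hHu (by positivity) ha0
  have h6 : 0 ≤ x * u := by positivity
  nlinarith [mul_le_mul_of_nonneg_left hp1 h0]

theorem gain_large {x Y a : ℝ} (hx : 1 ≤ x) (hY : 0 ≤ Y) (ha : 0.6366 * x + 0.9185 * Y ≤ a)
    {τ e q : ℝ} (hτ : τ = √(x⁻¹)) (he : e = Real.exp (-(0.385 * (1 + Y))))
    (hq : q = τ * (e * (1 + (1 - τ ^ 2) * gainH e))) :
    1 ≤ Real.exp (0.499 * a) * (q * (1 + a * gainH q)) := by
  have hx0 : 0 < x := by linarith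
  have hτ0 : 0 < τ := hτ ▸ Real.sqrt_pos.mpr (inv_pos.mpr hx0)
  have hτ2 : τ ^ 2 = x⁻¹ := by rw [hτ, Real.sq_sqrt (inv_nonneg.mpr hx0.le)]
  have he0 : 0 < e := he ▸ Real.exp_pos _
  have hμ1 : x⁻¹ ≤ 1 := inv_le_one_of_one_le₀ hx
  have hμ0 : 0 < x⁻¹ := inv_pos.mpr hx0
  have ha0 : 0 ≤ a := le_trans (by positivity) ha
  rw [hτ2] at hq
  set μ := x⁻¹ with hμ
  have hμx : μ * x = 1 := inv_mul_cancel₀ hx0.ne'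
  set u := Real.exp (-(0.77 * Y)) with hu
  have hu0 : 0 < u := Real.exp_pos _
  have he2 : 0.463 * u ≤ e ^ 2 := by
    have h2 : Real.exp (-0.77) * u = e ^ 2 := by
      rw [he, hu, ← Real.exp_add, ← Real.exp_nat_mul]
      congr 1
      push_cast
      ring
    exact (mul_le_mul_of_nonneg_right le_exp_neg_077 hu0.le).trans h2.le
  have he4 : (0.463 * u) ^ 2 ≤ e ^ 4 := by
    rw [show e ^ 4 = (e ^ 2) ^ 2 by ring]
    exact pow_le_pow_left₀ (by positivity) he2 2
  have hHe : 0.1211 * u + 0.0176 * u ^ 2 ≤ gainH e := by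
    unfold gainH; nlinarith [sq_nonneg u]
  set t := (1 - μ) * (0.1211 * u + 0.0176 * u ^ 2) with ht
  have ht0 : 0 ≤ t := mul_nonneg (by linarith) (by positivity)
  have htH : t ≤ (1 - μ) * gainH e := mul_le_mul_of_nonneg_left hHe (by linarith)
  have hqe : τ * e * (1 + t) ≤ q := by
    rw [hq, mul_assoc]
    exact mul_le_mul_of_nonneg_left (mul_le_mul_of_nonneg_left (by linarith) he0.le) hτ0.le
  have hq1 : τ * e ≤ q := le_trans (le_mul_of_one_le_right (by positivity) (by linarith)) hqe
  have hq0 : 0 < q := lt_of_lt_of_le (by positivity) hq1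
  have hHq : μ * (0.1211 * u + 0.0176 * μ * u ^ 2) ≤ gainH q := by
    refine le_trans ?_ (gainH_mono (by positivity) hq1)
    unfold gainH
    rw [show (τ * e) ^ 4 = (τ ^ 2) ^ 2 * e ^ 4 by ring, mul_pow, hτ2]
    have c1 := mul_le_mul_of_nonneg_left he2 hμ0.le
    have c2 := mul_le_mul_of_nonneg_left he4 (sq_nonneg μ)
    have c3 : 0 ≤ μ ^ 2 * u ^ 2 := by positivity
    have c4 : 0 ≤ μ * u := by positivity
    nlinarith
  set g := (0.6366 + 0.9185 * Y * μ) * (0.1211 * u + 0.0176 * μ * u ^ 2) with hg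
  have hg0 : 0 ≤ g := by positivity
  have haH : g ≤ a * gainH q := by
    refine le_trans (le_of_eq ?_) (mul_le_mul ha hHq (by positivity) ha0)
    rw [hg]
    linear_combination (-(0.6366 * (0.1211 * u + 0.0176 * μ * u ^ 2))) * hμx
  have hgain := gain_ge hY hμ0.le hμ1 hu
  have hmin : 0 ≤ min (0.145 : ℝ) (0.2018 - 0.1136 * μ) := le_min (by norm_num) (by linarith)
  have hsq := le_exp_mul_sq hx
  set d := min (0.145 : ℝ) (0.2018 - 0.1136 * μ) with hd
  have hA : 1 ≤ τ * (Real.exp (0.3176634 * x - 0.385) * (1 + d)) := by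
    refine (one_le_sq_iff₀ (by positivity)).mp ?_
    have e2 : Real.exp (0.6353268 * x - 0.77) = Real.exp (0.3176634 * x - 0.385) ^ 2 := by
      rw [← Real.exp_nat_mul]; push_cast; ring_nf
    rw [mul_pow, mul_pow, hτ2, ← e2]
    have := mul_le_mul_of_nonneg_left hsq hμ0.le
    rwa [hμx] at this
  have hE : Real.exp (0.3176634 * x - 0.385) * (1 + 0.0733 * Y) ≤ Real.exp (0.499 * a) * e := by
    have h1 := Real.add_one_le_exp (0.0733 * Y)
    have h2 := mul_le_mul_of_nonneg_left h1 (Real.exp_pos (0.3176634 * x - 0.385)).le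
    rw [← Real.exp_add] at h2
    rw [he, ← Real.exp_add]
    refine le_trans (by linarith) (h2.trans (Real.exp_le_exp.mpr (by linarith)))
  have hsum : 1 + d ≤ (1 + 0.0733 * Y) * ((1 + t) * (1 + g)) := by
    have p1 : 0 ≤ t * g := mul_nonneg ht0 hg0
    have p2 : 0 ≤ 0.0733 * Y * (t + g + t * g) := by positivity
    linarith
  calc (1 : ℝ) ≤ τ * (Real.exp (0.3176634 * x - 0.385) * (1 + d)) := hA
    _ ≤ τ * (Real.exp (0.3176634 * x - 0.385) *
        ((1 + 0.0733 * Y) * ((1 + t) * (1 + g)))) := by gcongr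
    _ = τ * (Real.exp (0.3176634 * x - 0.385) * (1 + 0.0733 * Y)) * ((1 + t) * (1 + g)) := by ring
    _ ≤ τ * (Real.exp (0.499 * a) * e) * ((1 + t) * (1 + g)) := by gcongr
    _ = Real.exp (0.499 * a) * (τ * e * (1 + t) * (1 + g)) := by ring
    _ ≤ Real.exp (0.499 * a) * (q * (1 + a * gainH q)) := by gcongr

theorem gainH_scale {k q : ℝ} (hk0 : 0 ≤ k) (hk1 : k ≤ 1) :
    k ^ 4 * gainH q ≤ gainH (k * q) := by
  have h : 0 ≤ (k ^ 2 - k ^ 4) * q ^ 2 :=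
    mul_nonneg (sub_nonneg.mpr (pow_le_pow_of_le_one hk0 hk1 (by norm_num))) (sq_nonneg q)
  unfold gainH
  rw [mul_pow, mul_pow]
  linarith

theorem gain_scale {k b p q : ℝ} (hk0 : 0 ≤ k) (hk1 : k ≤ 1) (hb : 0 ≤ b) (hq : 0 ≤ q)
    (hqp : k * q ≤ p) : k ^ 5 * (q * (1 + b * gainH q)) ≤ p * (1 + b * gainH p) := by
  have h1 : k ^ 4 * (1 + b * gainH q) ≤ 1 + b * gainH p := by
    have h2 := (gainH_scale (q := q) hk0 hk1).trans (gainH_mono (by positivity) hqp)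
    have h3 := pow_le_one₀ (n := 4) hk0 hk1
    linarith [mul_le_mul_of_nonneg_left h2 hb]
  have h4 := mul_nonneg hb (gainH_nonneg q)
  calc k ^ 5 * (q * (1 + b * gainH q)) = k * q * (k ^ 4 * (1 + b * gainH q)) := by ring
    _ ≤ p * (1 + b * gainH p) := mul_le_mul hqp h1 (by positivity)
      ((by positivity : 0 ≤ k * q).trans hqp)

theorem exp_half_gain_antitone {s a H : ℝ} (hs : 0 ≤ s) (hsa : s ≤ a) (hH0 : 0 ≤ H)
    (hH1 : H ≤ 1 / 2) :
    Real.exp (-(a / 2)) * (1 + a * H) ≤ Real.exp (-(s / 2)) * (1 + s * H) := by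
  have h1 := Real.add_one_le_exp ((a - s) / 2)
  have h2 : Real.exp (-(s / 2)) = Real.exp (-(a / 2)) * Real.exp ((a - s) / 2) := by
    rw [← Real.exp_add]; ring_nf
  have h3 : 1 + a * H ≤ Real.exp ((a - s) / 2) * (1 + s * H) := by
    have h5 := mul_le_mul_of_nonneg_right h1 (show 0 ≤ 1 + s * H by positivity)
    have h6 : 0 ≤ (a - s) * (1 / 2 - H) := mul_nonneg (by linarith) (by linarith)
    have h7 : 0 ≤ (a - s) * (s * H) := mul_nonneg (by linarith) (by positivity)
    linarith
  rw [h2, mul_assoc]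
  exact mul_le_mul_of_nonneg_left h3 (Real.exp_pos _).le

theorem dotProduct_shrinkV (v w x : Fin n → ℝ) (τ : ℝ) :
    w ⬝ᵥ shrinkV v τ x = shrinkV v τ w ⬝ᵥ x := by
  simp only [shrinkV, dotProduct_sub, sub_dotProduct, dotProduct_smul, smul_dotProduct,
    smul_eq_mul, dotProduct_comm w v]
  ring

theorem shrinkV_dotProduct_self {v : Fin n → ℝ} (hv : v ⬝ᵥ v = 1) (w : Fin n → ℝ) (τ : ℝ) :
    shrinkV v τ w ⬝ᵥ shrinkV v τ w = w ⬝ᵥ w - (1 - τ ^ 2) * (w ⬝ᵥ v) ^ 2 := by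
  simp only [shrinkV, dotProduct_sub, sub_dotProduct, dotProduct_smul, smul_dotProduct,
    smul_eq_mul, dotProduct_comm v w, hv]
  ring

theorem gaussVec_shift_ge_of_le {W : Set (Fin (n + 1) → ℝ)} (hW : SymBody W)
    {z : Fin (n + 1) → ℝ} {a : ℝ} (hz : z ⬝ᵥ z ≤ a) :
    Real.exp (-(a / 2)) * ((gaussVec (n + 1)).real W *
      (1 + a * gainH ((gaussVec (n + 1)).real W))) ≤
      (gaussVec (n + 1)).real {x | x - z ∈ W} := by
  refine le_trans ?_ (gaussVec_shift_ge hW z)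
  set q := (gaussVec (n + 1)).real W
  have hq0 : 0 ≤ q := measureReal_nonneg
  have hq1 : gainH q ≤ 1 / 2 := by
    refine (gainH_mono hq0 measureReal_le_one).trans ?_
    norm_num [gainH]
  have := exp_half_gain_antitone (dotProduct_self_nonneg' z) hz (gainH_nonneg q) hq1
  nlinarith [mul_le_mul_of_nonneg_left this hq0]

theorem gaussVec_shift_slabs_ge {ι : Type*} [Fintype ι] (M : ι → Fin (n + 1) → ℝ)
    (N : Seminorm ℝ (Fin (n + 1) → ℝ)) {η a T : ℝ} (hη0 : 0 < η) (hη1 : η ≤ 1) (hT : 0 < T)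
    (ha : a * T ^ 2 = (∫ x, √(∑ i, (M i ⬝ᵥ x) ^ 2) ∂gaussVec (n + 1)) ^ 2)
    {z : Fin (n + 1) → ℝ} (hz : z ⬝ᵥ z ≤ a) :
    (1 - η) ^ 25 * Real.exp (-(0.999 * a)) ≤ (gaussVec (n + 1)).real
      {x | x - z ∈ {x | N x ≤ 2 / η * ∫ e, N e ∂expVec (n + 1)} ∩ {x | ∀ i, |M i ⬝ᵥ x| ≤ T}} := by
  obtain ⟨v, hv, hle, hcase⟩ := sq_integral_sqrt_ge M
  rw [← ha] at hcase
  set R := 2 / η * ∫ e, N e ∂expVec (n + 1)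
  set k := 1 - η
  have hk0 : 0 ≤ k := sub_nonneg.mpr hη1
  have hk1 : k ≤ 1 := by simp only [k]; linarith
  have hT2 : 0 < T ^ 2 := by positivity
  have ha0 : 0 ≤ a := (dotProduct_self_nonneg' z).trans hz
  set W := {x | N x ≤ R} ∩ {x : Fin (n + 1) → ℝ | ∀ i, |M i ⬝ᵥ x| ≤ T} with hWdef
  obtain ⟨hWq, hW⟩ := gaussVec_inter_slabs_ge Finset.univ M hT (symBody_seminorm N R)
  simp only [Finset.mem_univ, true_implies] at hWq hW
  refine le_trans ?_ (gaussVec_shift_ge_of_le hW hz)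
  rw [← hWdef] at hWq ⊢
  set q := (gaussVec (n + 1)).real W
  obtain ⟨X, hX⟩ : ∃ X, ∑ i, M i ⬝ᵥ M i = X * T ^ 2 := ⟨_, (div_mul_cancel₀ _ hT2.ne').symm⟩
  obtain ⟨x, hx⟩ : ∃ x, ∑ i, (M i ⬝ᵥ v) ^ 2 = x * T ^ 2 := ⟨_, (div_mul_cancel₀ _ hT2.ne').symm⟩
  have hq : k * Real.exp (-(0.385 * X)) ≤ q := by
    refine le_trans ?_ hWq
    rw [hX, mul_div_cancel_right₀ _ hT2.ne']
    exact mul_le_mul_of_nonneg_right (gaussVec_seminorm_ge N hη0) (Real.exp_pos _).le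
  have hx0 : 0 ≤ x := nonneg_of_mul_nonneg_left (hx ▸ Finset.sum_nonneg fun i _ => sq_nonneg _) hT2
  rw [hX, hx] at hle hcase
  have hxX : x ≤ X := le_of_mul_le_mul_right hle hT2
  have concl : ∀ p, 1 ≤ Real.exp (0.499 * a) * (p * (1 + a * gainH p)) → 0 ≤ p →
      k ^ 5 * p ≤ q → k ^ 25 * Real.exp (-(0.999 * a)) ≤
        Real.exp (-(a / 2)) * (q * (1 + a * gainH q)) := by
    intro p hp hp0 hpq
    have h1 := gain_scale (pow_nonneg hk0 5) (pow_le_one₀ hk0 hk1) ha0 hp0 hpq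
    rw [← pow_mul] at h1
    have h2 : Real.exp (-(0.999 * a)) ≤ Real.exp (-(a / 2)) * (p * (1 + a * gainH p)) := by
      have h3 := mul_le_mul_of_nonneg_left hp (Real.exp_pos (-(0.999 * a))).le
      rw [mul_one, ← mul_assoc, ← Real.exp_add] at h3
      refine h3.trans (le_of_eq ?_)
      ring_nf
    calc k ^ 25 * Real.exp (-(0.999 * a))
        ≤ k ^ 25 * (Real.exp (-(a / 2)) * (p * (1 + a * gainH p))) := by gcongr
      _ = Real.exp (-(a / 2)) * (k ^ (5 * 5) * (p * (1 + a * gainH p))) := by ring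
      _ ≤ _ := by gcongr
  have hk5 : k ^ 5 ≤ k := pow_le_of_le_one hk0 hk1 (by norm_num)
  rcases hcase with ⟨-, h⟩ | h
  · have h : 0.6366 * x + 0.9185 * (X - x) ≤ a :=
      le_of_mul_le_mul_right (by linarith) hT2
    rcases le_total x 1 with hx1 | hx1
    · have hg := gain_small hx0 hx1 (sub_nonneg.mpr hxX) h
      rw [add_sub_cancel] at hg
      exact concl _ hg (Real.exp_pos _).le
        ((mul_le_mul_of_nonneg_right hk5 (Real.exp_pos _).le).trans hq)
    · have hxp : 0 < x := by linarith
      set τ := √(x⁻¹) with hτ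
      have hτ0 : 0 < τ := Real.sqrt_pos.mpr (inv_pos.mpr hxp)
      have hτ2 : τ ^ 2 = x⁻¹ := Real.sq_sqrt (inv_nonneg.mpr hxp.le)
      have hτ1 : τ ≤ 1 := Real.sqrt_le_one.mpr (inv_le_one_of_one_le₀ hx1)
      have hshrink := gaussVec_shrink_ge hW hv hτ0 hτ1
      obtain ⟨hq1, -⟩ := gaussVec_inter_slabs_ge Finset.univ (fun i => shrinkV v τ (M i)) hT
        (symBody_seminorm (N.comp (shrinkL v τ)) R)
      have hset : {x | N.comp (shrinkL v τ) x ≤ R} ∩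
          {x | ∀ i ∈ Finset.univ, |shrinkV v τ (M i) ⬝ᵥ x| ≤ T} = {x | shrinkV v τ x ∈ W} := by
        ext y
        simp [hWdef, dotProduct_shrinkV, shrinkL]
      have hsum : (∑ i, shrinkV v τ (M i) ⬝ᵥ shrinkV v τ (M i)) / T ^ 2 = 1 + (X - x) := by
        simp only [shrinkV_dotProduct_self hv, Finset.sum_sub_distrib, ← Finset.mul_sum, hX, hx,
          hτ2]
        field_simp
        ring
      rw [hset, hsum] at hq1
      have hq1' : k * Real.exp (-(0.385 * (1 + (X - x)))) ≤
          (gaussVec (n + 1)).real {x | shrinkV v τ x ∈ W} :=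
        (mul_le_mul_of_nonneg_right (gaussVec_seminorm_shrink_ge N hη0 hv hτ0.le hτ1)
          (Real.exp_pos _).le).trans hq1
      have hτs : 0 ≤ 1 - τ ^ 2 := sub_nonneg.mpr (pow_le_one₀ hτ0.le hτ1)
      have hg := gain_large hx1 (sub_nonneg.mpr hxX) h hτ rfl rfl
      refine concl _ hg ?_ (le_trans ?_ hshrink)
      · have := gainH_nonneg (Real.exp (-(0.385 * (1 + (X - x)))))
        positivity
      · rw [mul_left_comm]
        exact mul_le_mul_of_nonneg_left (gain_scale hk0 hk1 hτs (Real.exp_pos _).le hq1') hτ0.le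
  · have h : 0.785 * X ≤ a := le_of_mul_le_mul_right (by linarith) hT2
    refine concl _ ?_ (Real.exp_pos _).le
      ((mul_le_mul_of_nonneg_right hk5 (Real.exp_pos _).le).trans hq)
    rw [← mul_assoc, ← Real.exp_add]
    exact one_le_mul_of_one_le_of_one_le (Real.one_le_exp (by linarith [hx0.trans hxX]))
      (le_add_of_nonneg_right (mul_nonneg ha0 (gainH_nonneg _)))

theorem eq_zero_of_integral_sqrt_eq_zero {ι : Type*} [Fintype ι] {M : ι → Fin (n + 1) → ℝ}
    (h : ∫ x, √(∑ i, (M i ⬝ᵥ x) ^ 2) ∂gaussVec (n + 1) = 0) (i : ι) : M i = 0 := by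
  obtain ⟨v, -, hle, hcase⟩ := sq_integral_sqrt_ge M
  have hs : 0 ≤ ∑ i, (M i ⬝ᵥ v) ^ 2 := Finset.sum_nonneg fun i _ => sq_nonneg _
  rw [h] at hcase
  have hS : ∑ i, M i ⬝ᵥ M i ≤ 0 := by
    rcases hcase with ⟨-, h⟩ | h <;> linarith
  have := Finset.single_le_sum (fun i _ => dotProduct_self_nonneg' (M i)) (Finset.mem_univ i)
  exact dotProduct_self_eq_zero.mp (le_antisymm (this.trans hS) (dotProduct_self_nonneg' _))

theorem gaussVec_shift_relative_slabs_ge {ι : Type*} [Fintype ι] (M : ι → Fin (n + 1) → ℝ)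
    (N : Seminorm ℝ (Fin (n + 1) → ℝ)) {η ε : ℝ} (hη0 : 0 < η) (hη1 : η ≤ 1) (hε : 0 < ε)
    {z : Fin (n + 1) → ℝ} (hz : z ⬝ᵥ z ≤ 1 / ε ^ 2) :
    (1 - η) ^ 25 * Real.exp (-(0.999 / ε ^ 2)) ≤ (gaussVec (n + 1)).real
      {x | x - z ∈ {x | N x ≤ 2 / η * ∫ e, N e ∂expVec (n + 1)} ∩
        {x | ∀ i, |M i ⬝ᵥ x| ≤ ε * ∫ x, √(∑ i, (M i ⬝ᵥ x) ^ 2) ∂gaussVec (n + 1)}} := by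
  have hE : 0 ≤ ∫ x, √(∑ i, (M i ⬝ᵥ x) ^ 2) ∂gaussVec (n + 1) :=
    integral_nonneg fun x => Real.sqrt_nonneg _
  rcases hE.eq_or_lt' with h | h
  · have hM := eq_zero_of_integral_sqrt_eq_zero h
    have huniv : {x : Fin (n + 1) → ℝ | ∀ i, |M i ⬝ᵥ x| ≤
        ε * ∫ x, √(∑ i, (M i ⬝ᵥ x) ^ 2) ∂gaussVec (n + 1)} = univ := by
      ext x; simp [hM]
    rw [huniv, inter_univ]
    refine le_trans ?_ (gaussVec_shift_ge_of_le (symBody_seminorm N _) hz)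
    have hq := gaussVec_seminorm_ge N hη0
    set q := (gaussVec (n + 1)).real {x | N x ≤ 2 / η * ∫ e, N e ∂expVec (n + 1)}
    have hq0 : 0 ≤ q := measureReal_nonneg
    have hε2 : 0 ≤ 1 / ε ^ 2 := by positivity
    rw [mul_comm]
    refine mul_le_mul (Real.exp_le_exp.mpr ?_) ?_ (pow_nonneg (sub_nonneg.mpr hη1) _)
      (Real.exp_pos _).le
    · rw [← mul_one_div 0.999 (ε ^ 2)]; linarith
    · exact ((pow_le_of_le_one (sub_nonneg.mpr hη1) (by linarith) (by norm_num)).trans hq).trans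
        (le_mul_of_one_le_right hq0 (le_add_of_nonneg_right (mul_nonneg hε2 (gainH_nonneg _))))
  · have := gaussVec_shift_slabs_ge M N hη0 hη1 (mul_pos hε h) (a := 1 / ε ^ 2)
      (by field_simp) hz
    rwa [mul_one_div] at this

theorem sum_tens (A : Fin n → Fin n → Fin m → ℝ) (x : Fin n → ℝ) (t : Fin m → ℝ) (i : Fin n) :
    ∑ j, ∑ k, A i j k * tens x t j k = (fun j => ∑ k, A i j k * t k) ⬝ᵥ x := by
  simp only [tens, dotProduct, Finset.sum_mul]
  exact Finset.sum_congr rfl fun j _ => Finset.sum_congr rfl fun k _ => by ring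

theorem alphaInf_tens_le (A : Fin n → Fin n → Fin m → ℝ) (x : Fin n → ℝ) (t : Fin m → ℝ) {R : ℝ}
    (hR : 0 ≤ R) (h : ∀ i, |(fun j => ∑ k, A i j k * t k) ⬝ᵥ x| ≤ R) :
    alphaInf A (tens x t) ≤ R :=
  Real.iSup_le (fun i => by rw [sum_tens]; exact h i) hR

theorem smul_preimage_image_add_superset (A : Fin n → Fin n → Fin m → ℝ)
    (N : Seminorm ℝ (Fin n → ℝ)) (t : Fin m → ℝ) {ε : ℝ} (hε : 0 < ε) (y : Fin n → ℝ) {C E J : ℝ}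
    (hE : 0 ≤ E) :
    {x | x - ε⁻¹ • y ∈ {x | N x ≤ C * J} ∩
        {x | ∀ i, |(fun j => ∑ k, A i j k * t k) ⬝ᵥ x| ≤ ε * E}} ⊆
      (fun x => ε • x) ⁻¹' ((fun x => x + y) ''
        {x | alphaInf A (tens x t) ≤ ε ^ 2 * E ∧ N x ≤ C * ε * J}) := by
  rintro x ⟨h1, h2⟩
  refine ⟨ε • (x - ε⁻¹ • y), ⟨?_, ?_⟩, ?_⟩
  · refine alphaInf_tens_le A _ t (by positivity) fun i => ?_
    rw [dotProduct_smul, smul_eq_mul, abs_mul, abs_of_pos hε, pow_two, mul_assoc]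
    exact mul_le_mul_of_nonneg_left (h2 i) hε.le
  · rw [map_smul_eq_mul, Real.norm_of_nonneg hε.le, mul_comm C ε, mul_assoc]
    exact mul_le_mul_of_nonneg_left h1 hε.le
  · simp [smul_sub, smul_inv_smul₀ hε.ne']

theorem smul_dotProduct_self_le {y : Fin n → ℝ} (hy : y ∈ B2 n) {ε : ℝ} (hε : 0 < ε) :
    (ε⁻¹ • y) ⬝ᵥ (ε⁻¹ • y) ≤ 1 / ε ^ 2 := by
  have h : y ⬝ᵥ y ≤ 1 := by
    have := Real.sqrt_le_one.mp hy
    simpa [dotProduct, pow_two] using this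
  rw [smul_dotProduct, dotProduct_smul, smul_eq_mul, smul_eq_mul, ← mul_assoc, ← pow_two, inv_pow,
    one_div]
  exact mul_le_of_le_one_right (by positivity) h

theorem integral_alphaA_nonneg (A : Fin n → Fin n → Fin m → ℝ) (t : Fin m → ℝ) :
    0 ≤ ∫ g, alphaA A (tens g t) ∂gaussVec n :=
  integral_nonneg fun _ => Real.sqrt_nonneg _

theorem gaussVec_real_ge (A : Fin n → Fin n → Fin m → ℝ)
    (N : Seminorm ℝ (Fin n → ℝ)) (t : Fin m → ℝ) {η ε : ℝ} (hη0 : 0 < η) (hη1 : η ≤ 1)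
    (hε : 0 < ε) {z : Fin n → ℝ} (hz : z ⬝ᵥ z ≤ 1 / ε ^ 2) :
    (1 - η) ^ 25 * Real.exp (-(0.999 / ε ^ 2)) ≤ (gaussVec n).real
      {x | x - z ∈ {x | N x ≤ 2 / η * ∫ e, N e ∂expVec n} ∩
        {x | ∀ i, |(fun j => ∑ k, A i j k * t k) ⬝ᵥ x| ≤
          ε * ∫ g, alphaA A (tens g t) ∂gaussVec n}} := by
  cases n with
  | zero =>
    have hset : {x : Fin 0 → ℝ | x - z ∈ {x | N x ≤ 2 / η * ∫ e, N e ∂expVec 0} ∩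
        {x | ∀ i, |(fun j => ∑ k, A i j k * t k) ⬝ᵥ x| ≤
          ε * ∫ g, alphaA A (tens g t) ∂gaussVec 0}} = univ := by
      refine eq_univ_of_forall fun x => ⟨?_, fun i => i.elim0⟩
      rw [Subsingleton.elim (x - z) 0, mem_ofPred_eq, map_zero]
      exact mul_nonneg (by positivity) (integral_nonneg fun _ => apply_nonneg N _)
    rw [hset, probReal_univ]
    refine mul_le_one₀ (pow_le_one₀ (sub_nonneg.mpr hη1) (by linarith)) (Real.exp_pos _).le
      (Real.exp_le_one_iff.mpr (neg_nonpos.mpr (by positivity)))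
  | succ n =>
    simp only [alphaA, sum_tens]
    exact gaussVec_shift_relative_slabs_ge _ N hη0 hη1 hε hz

end SmallBall

/-- small-ball estimate for the Gaussian measure `γ_{n,ε}`. -/
theorem statement_14 :
    ∃ C c : ℝ, 0 < C ∧ 0 < c ∧
      ∀ (n m : ℕ) (A : Fin n → Fin n → Fin m → ℝ) (nrm : Seminorm ℝ (Fin n → ℝ)),
        (∀ x, nrm x = 0 → x = 0) →
      ∀ (t : Fin m → ℝ) (ε : ℝ), 0 < ε →
      ∀ y ∈ B2 n,
        ENNReal.ofReal (c * Real.exp (-(c / ε ^ 2))) ≤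
          Measure.map (fun x => ε • x) (gaussVec n)
            ((fun x => x + y) ''
              {x | alphaInf A (tens x t)
                    ≤ ε ^ 2 * (∫ g, alphaA A (tens g t) ∂gaussVec n) ∧
                   nrm x ≤ C * ε * ∫ e, nrm e ∂expVec n}) := by
  have hη : (0 : ℝ) < 1 / 100000 := by norm_num
  refine ⟨2 / (1 / 100000), 0.999, by norm_num, by norm_num, fun n m A N _ t ε hε y hy => ?_⟩
  refine le_trans ?_ (Measure.le_map_apply (by fun_prop) _)
  refine le_trans ?_ (measure_mono (smul_preimage_image_add_superset A N t hε y
    (integral_alphaA_nonneg A t)))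
  rw [ENNReal.ofReal_le_iff_le_toReal (measure_ne_top _ _)]
  refine le_trans ?_ (gaussVec_real_ge A N t hη (by norm_num) hε (smul_dotProduct_self_le hy hε))
  exact mul_le_mul_of_nonneg_right (by norm_num) (Real.exp_pos _).le

end Stmt14
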